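/- arXiv:2505.16110 — 2 statements merged into one kernel-verified Lean document; each statement's English description precedes it below -/
import Mathlib

section
/- Let n, k ∈ ℕ, p ∈ [1,∞), γ ∈ Γ_{p,1}, η ∈ (0,1), and 0 ≤ s₀ < s < 1 < q < q₀ < ∞ satisfy s = (1−η)s₀ + η and 1/q = (1−η)/q₀ + η. Then there exists a constant C > 0 such that for every locally integrable f : ℝ^n → ℝ having weak derivatives of order k with |∇^k f| ∈ L^p(ℝ^n), sup_{λ∈(0,∞)} λ (∫_{ℝ^n}[∫_{ℝ^n} 1_{E_{λ,γ/q+s−1,k}[f]}(x,h) |h|^{γ−n} dh]^{p} dx)^{1/(pq)} ≤ C [sup_{λ∈(0,∞)} λ (∫_{ℝ^n}[∫_{ℝ^n} 1_{E_{λ,γ/q₀+s₀−1,k}[f]}(x,h) |h|^{γ−n} dh]^{p} dx)^{1/(pq₀)}]^{1−η} ‖|∇^k f|‖_{L^p}^{η}. -/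
open MeasureTheory Filter Set
open scoped ENNReal NNReal BigOperators Topology Classical

noncomputable section

/-- `ℝ^n`. -/
abbrev En (n : ℕ) := EuclideanSpace ℝ (Fin n)

variable {n : ℕ}

/-- The `k`-th order difference `Δ_h^k f (x) = ∑_{j=0}^k (-1)^{k-j} C(k,j) f (x + j h)`. -/
def kDiff (k : ℕ) (f : En n → ℝ) (h x : En n) : ℝ :=
  ∑ j ∈ Finset.range (k + 1), (-1 : ℝ) ^ (k - j) * (k.choose j : ℝ) * f (x + (j : ℝ) • h)

/-- Membership of `(x,h)` in `E_{λ,b,k,ℓ}[f]`. -/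
def memE (k ℓ : ℕ) (lam b : ℝ) (f : En n → ℝ) (x h : En n) : Prop :=
  h ≠ 0 ∧ lam * ‖h‖ ^ ((ℓ : ℝ) + b) < |kDiff k f h x|

/-- `∫_{ℝ^n} 1_{E_{λ,b,k,ℓ}[f]}(x,h) |h|^{γ-n} dh`. -/
def innerInt (k ℓ : ℕ) (lam b γ : ℝ) (f : En n → ℝ) (x : En n) : ℝ≥0∞ :=
  ∫⁻ h, if memE k ℓ lam b f x h then ENNReal.ofReal (‖h‖ ^ (γ - (n : ℝ))) else 0

/-- `λ (∫_{ℝ^n} (∫_{ℝ^n} 1_E |h|^{γ-n} dh)^{p/q} dx)^{1/p}`. -/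
def bsvy (k ℓ : ℕ) (p q b γ : ℝ) (f : En n → ℝ) (lam : ℝ) : ℝ≥0∞ :=
  ENNReal.ofReal lam * (∫⁻ x, (innerInt k ℓ lam b γ f x) ^ (p / q)) ^ (1 / p)

/-- First-order partial derivative in the `i`-th coordinate direction. -/
def pd (i : Fin n) (ψ : En n → ℝ) : En n → ℝ :=
  fun x => fderiv ℝ ψ x (EuclideanSpace.single i (1 : ℝ))

/-- Higher-order partial derivative `∂^α` associated with a multi-index `α`. -/
def mpd (α : Fin n → ℕ) (φ : En n → ℝ) : En n → ℝ :=
  (List.finRange n).foldr (fun i ψ => (pd i)^[α i] ψ) φ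

/-- `g` is the family of `m`-th order weak partial derivatives of `f`. -/
def HasWeakDerivs (m : ℕ) (f : En n → ℝ) (g : (Fin n → ℕ) → En n → ℝ) : Prop :=
  (∀ α : Fin n → ℕ, (∑ i, α i) = m → LocallyIntegrable (g α) volume) ∧
  ∀ α : Fin n → ℕ, (∑ i, α i) = m →
    ∀ φ : En n → ℝ, ContDiff ℝ (⊤ : ℕ∞) φ → HasCompactSupport φ →
      ∫ x, f x * mpd α φ x = (-1 : ℝ) ^ m * ∫ x, g α x * φ x

/-- `|∇^m f| = (∑_{|α| = m} |∂^α f|^2)^{1/2}`, given the family `g` of weak derivatives. -/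
def gradLen (m : ℕ) (g : (Fin n → ℕ) → En n → ℝ) (x : En n) : ℝ :=
  Real.sqrt (∑' α : Fin n → ℕ, if (∑ i, α i) = m then (g α x) ^ 2 else 0)

/-- The parameter range `Γ_{p,q}`. -/
def Gam (p q : ℝ) : Set ℝ := if p = 1 then Iio (-q) ∪ Ioi 0 else {(0 : ℝ)}ᶜ

/-- `‖ |∇^m f| ‖_{L^p}` as an `ℝ≥0∞`-valued quantity. -/
def gradLp (p : ℝ) (m : ℕ) (g : (Fin n → ℕ) → En n → ℝ) : ℝ≥0∞ :=
  (∫⁻ x, ENNReal.ofReal (gradLen m g x ^ p)) ^ (1 / p)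

end

open MeasureTheory Set
open scoped ENNReal

lemma ContDiff.pd {n : ℕ} {φ : En n → ℝ} (hφ : ContDiff ℝ (⊤ : ℕ∞) φ) (i : Fin n) :
    ContDiff ℝ (⊤ : ℕ∞) (pd i φ) :=
  (hφ.fderiv_right (m := (⊤ : ℕ∞)) (by exact_mod_cast le_top)).clm_apply contDiff_const

lemma ContDiff.iterate_pd {n : ℕ} {φ : En n → ℝ} (hφ : ContDiff ℝ (⊤ : ℕ∞) φ) (i : Fin n)
    (m : ℕ) : ContDiff ℝ (⊤ : ℕ∞) ((_root_.pd i)^[m] φ) := by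
  induction m with
  | zero => simpa using hφ
  | succ m ih => rw [Function.iterate_succ_apply']; exact ih.pd i

lemma ContDiff.foldr_pd {n : ℕ} {φ : En n → ℝ} (hφ : ContDiff ℝ (⊤ : ℕ∞) φ) (α : Fin n → ℕ)
    (l : List (Fin n)) :
    ContDiff ℝ (⊤ : ℕ∞) (l.foldr (fun i ψ => (_root_.pd i)^[α i] ψ) φ) := by
  induction l with
  | nil => simpa using hφ
  | cons a l ih => exact ih.iterate_pd a _

lemma ContDiff.mpd {n : ℕ} {φ : En n → ℝ} (hφ : ContDiff ℝ (⊤ : ℕ∞) φ) (α : Fin n → ℕ) :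
    ContDiff ℝ (⊤ : ℕ∞) (mpd α φ) := hφ.foldr_pd α _

lemma pd_pd_comm {n : ℕ} {φ : En n → ℝ} (hφ : ContDiff ℝ (⊤ : ℕ∞) φ) (i j : Fin n) :
    pd i (pd j φ) = pd j (pd i φ) := by
  have hd : Differentiable ℝ (fderiv ℝ φ) :=
    (hφ.fderiv_right (m := (⊤ : ℕ∞)) (by exact_mod_cast le_top)).differentiable (by simp)
  have key : ∀ (a b : Fin n) (x : En n), pd a (pd b φ) x =
      fderiv ℝ (fderiv ℝ φ) x (EuclideanSpace.single a 1) (EuclideanSpace.single b 1) := by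
    intro a b x
    unfold pd
    rw [fderiv_clm_apply (hd x) (differentiableAt_const _)]
    simp
  funext x
  rw [key, key]
  refine (ContDiffAt.isSymmSndFDerivAt (n := (⊤ : ℕ∞)) hφ.contDiffAt ?_) _ _
  simp only [minSmoothness_of_isRCLikeNormedField]
  exact WithTop.coe_le_coe.2 (le_top : (2 : ℕ∞) ≤ ⊤)

lemma pd_iterate_comm {n : ℕ} {φ : En n → ℝ} (hφ : ContDiff ℝ (⊤ : ℕ∞) φ) (i j : Fin n) (m : ℕ) :
    pd i ((pd j)^[m] φ) = (pd j)^[m] (pd i φ) := by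
  induction m with
  | zero => rfl
  | succ m ih =>
    rw [Function.iterate_succ_apply', Function.iterate_succ_apply',
      pd_pd_comm (hφ.iterate_pd j m), ih]

lemma pd_foldr {n : ℕ} {φ : En n → ℝ} (hφ : ContDiff ℝ (⊤ : ℕ∞) φ) (i : Fin n) (α : Fin n → ℕ)
    (l : List (Fin n)) (hl : l.Nodup) :
    pd i (l.foldr (fun i ψ => (pd i)^[α i] ψ) φ) =
      l.foldr (fun j ψ => (pd j)^[(α + Pi.single i 1 : Fin n → ℕ) j] ψ)
        (if i ∈ l then φ else pd i φ) := by
  induction l with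
  | nil => simp
  | cons a l ih =>
    rw [List.nodup_cons] at hl
    rw [List.foldr_cons, List.foldr_cons, pd_iterate_comm (hφ.foldr_pd α l), ih hl.2]
    by_cases hia : i = a
    · subst hia
      have h1 : (α + Pi.single i 1 : Fin n → ℕ) i = α i + 1 := by simp
      have h2 := ih hl.2
      rw [if_neg hl.1] at h2
      have h3 : l.foldr (fun j ψ => (pd j)^[(α + Pi.single i 1 : Fin n → ℕ) j] ψ) φ =
          l.foldr (fun j ψ => (pd j)^[α j] ψ) φ := by
        refine List.foldr_ext _ _ _ fun j hj ψ => ?_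
        have : j ≠ i := fun h => hl.1 (h ▸ hj)
        simp [this]
      rw [if_neg hl.1, ← h2, h1, Function.iterate_succ_apply, if_pos (by simp), h3]
    · have h1 : (α + Pi.single i 1 : Fin n → ℕ) a = α a := by simp [Ne.symm hia]
      rw [h1]
      simp [hia]

lemma pd_mpd {n : ℕ} {φ : En n → ℝ} (hφ : ContDiff ℝ (⊤ : ℕ∞) φ) (i : Fin n) (α : Fin n → ℕ) :
    pd i (mpd α φ) = mpd (α + Pi.single i 1) φ := by
  have := pd_foldr hφ i α (List.finRange n) (List.nodup_finRange n)
  rw [if_pos (List.mem_finRange i)] at this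
  exact this

lemma fderiv_apply_eq_sum_pd {n : ℕ} (φ : En n → ℝ) (x h : En n) :
    fderiv ℝ φ x h = ∑ i, h i * pd i φ x := by
  conv_lhs => rw [← (EuclideanSpace.basisFun (Fin n) ℝ).sum_repr h]
  simp [pd]

lemma sum_abs_coord_le {n : ℕ} (h : En n) : ∑ i, |h i| ≤ n * ‖h‖ := by
  calc ∑ i, |h i| ≤ ∑ _i : Fin n, ‖h‖ := Finset.sum_le_sum fun i _ => by
        exact PiLp.norm_apply_le h i
    _ = n * ‖h‖ := by simp

lemma HasCompactSupport.pd {n : ℕ} {φ : En n → ℝ} (hφ : HasCompactSupport φ) (i : Fin n) :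
    HasCompactSupport (pd i φ) := hφ.fderiv_apply ℝ _

lemma HasCompactSupport.mpd {n : ℕ} {φ : En n → ℝ} (hφ : HasCompactSupport φ) (α : Fin n → ℕ) :
    HasCompactSupport (mpd α φ) := by
  have hit : ∀ (i : Fin n) (m : ℕ) (ψ : En n → ℝ), HasCompactSupport ψ →
      HasCompactSupport ((_root_.pd i)^[m] ψ) := by
    intro i m ψ hψ
    induction m with
    | zero => exact hψ
    | succ m ih => rw [Function.iterate_succ_apply']; exact ih.pd i
  unfold _root_.mpd
  induction List.finRange n with
  | nil => exact hφ
  | cons a l ih => exact hit a _ _ ih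

/-- The `k`-th derivative of `φ` along a line is a fixed combination of the `∂^α φ`, `|α| = k`. -/
lemma exists_iteratedDeriv_line_eq {n : ℕ} (h : En n) (k : ℕ) :
    ∃ (ι : Type) (_ : Fintype ι) (c : ι → ℝ) (A : ι → Fin n → ℕ),
      (∀ a, ∑ i, A a i = k) ∧ ∑ a, |c a| ≤ (n * ‖h‖) ^ k ∧
      ∀ φ : En n → ℝ, ContDiff ℝ (⊤ : ℕ∞) φ → ∀ (x : En n) (t : ℝ),
        iteratedDeriv k (fun t : ℝ => φ (x + t • h)) t = ∑ a, c a * mpd (A a) φ (x + t • h) := by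
  induction k with
  | zero =>
    refine ⟨Unit, inferInstance, fun _ => 1, fun _ => 0, by simp, by simp, fun φ _ x t => ?_⟩
    have : mpd (0 : Fin n → ℕ) φ = φ := by
      unfold mpd
      induction List.finRange n with
      | nil => rfl
      | cons a l ih => exact ih
    simp [this]
  | succ k ih =>
    obtain ⟨ι, _, c, A, hA, hc, H⟩ := ih
    refine ⟨Fin n × ι, inferInstance, fun b => h b.1 * c b.2,
      fun b => A b.2 + Pi.single b.1 1, fun b => ?_, ?_, fun φ hφ x t => ?_⟩
    · simp [Finset.sum_add_distrib, hA]
    · simp only [abs_mul, Fintype.sum_prod_type, ← Finset.mul_sum, ← Finset.sum_mul]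
      rw [pow_succ']
      exact mul_le_mul (sum_abs_coord_le h) hc (by positivity) (by positivity)
    · rw [iteratedDeriv_succ, funext (H φ hφ x)]
      have hline : HasDerivAt (fun t : ℝ => x + t • h) h t := by
        simpa using ((hasDerivAt_id t).smul_const h).const_add x
      have hd : ∀ a ∈ Finset.univ, HasDerivAt (fun t : ℝ => c a * mpd (A a) φ (x + t • h))
          (c a * fderiv ℝ (mpd (A a) φ) (x + t • h) h) t := fun a _ =>
        ((((hφ.mpd (A a)).differentiable (by simp)) _).hasFDerivAt.comp_hasDerivAt t
          hline).const_mul _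
      have := (HasDerivAt.fun_sum hd).deriv
      rw [this, Fintype.sum_prod_type_right]
      refine Finset.sum_congr rfl fun a _ => ?_
      rw [fderiv_apply_eq_sum_pd, Finset.mul_sum]
      refine Finset.sum_congr rfl fun i _ => ?_
      rw [pd_mpd hφ]
      ring

/-- The B-spline measure: the law of a sum of `k` independent uniform variables on `[0, 1]`. -/
lemma exists_fwdDiff_eq_integral_iteratedDeriv (k : ℕ) :
    ∃ ν : Measure ℝ, IsProbabilityMeasure ν ∧ (∀ᵐ t ∂ν, t ∈ Icc (0 : ℝ) k) ∧
      (0 < k → ν ≤ volume.restrict (Icc (0 : ℝ) k)) ∧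
      ∀ F : ℝ → ℝ, ContDiff ℝ (⊤ : ℕ∞) F →
        (fwdDiff 1)^[k] F 0 = ∫ t, iteratedDeriv k F t ∂ν := by
  induction k with
  | zero =>
    refine ⟨Measure.dirac 0, inferInstance, ?_, by simp, fun F _ => by simp⟩
    rw [ae_dirac_iff (by measurability)]
    simp
  | succ k ih =>
    obtain ⟨ν, hν, hν0, -, H⟩ := ih
    let unif : Measure ℝ := volume.restrict (Icc (0 : ℝ) 1)
    have hu : IsProbabilityMeasure unif := ⟨by simp [unif]⟩
    have hadd : Measurable fun z : ℝ × ℝ => z.1 + z.2 := by fun_prop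
    have hle : (ν.prod unif).map (fun z => z.1 + z.2) ≤
        volume.restrict (Icc (0 : ℝ) (k + 1 : ℕ)) := by
      refine Measure.le_iff.2 fun s hs => ?_
      rw [Measure.map_apply hadd hs, Measure.prod_apply (hadd hs), Measure.restrict_apply hs]
      calc ∫⁻ t, unif (Prod.mk t ⁻¹' ((fun z : ℝ × ℝ => z.1 + z.2) ⁻¹' s)) ∂ν
          ≤ ∫⁻ _, volume (s ∩ Icc (0 : ℝ) (k + 1 : ℕ)) ∂ν := by
            refine lintegral_mono_ae ?_
            filter_upwards [hν0] with t ht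
            have hm : MeasurableSet (Prod.mk t ⁻¹' ((fun z : ℝ × ℝ => z.1 + z.2) ⁻¹' s)) :=
              measurable_prodMk_left (hadd hs)
            rw [Measure.restrict_apply hm]
            refine (measure_mono ?_).trans
              (measure_preimage_add volume t (s ∩ Icc (0 : ℝ) (k + 1 : ℕ))).le
            rintro u ⟨hus, hu0, hu1⟩
            refine ⟨hus, ?_, ?_⟩
            · exact add_nonneg ht.1 hu0
            · push_cast
              exact add_le_add ht.2 hu1
        _ = _ := by simp
    refine ⟨(ν.prod unif).map (fun z => z.1 + z.2), Measure.isProbabilityMeasure_map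
      hadd.aemeasurable, ?_, fun _ => hle, fun F hF => ?_⟩
    · exact (Measure.absolutelyContinuous_of_le hle).ae_le (ae_restrict_mem measurableSet_Icc)
    · have hD : ContDiff ℝ (⊤ : ℕ∞) (fwdDiff 1 F) := by
        unfold fwdDiff
        exact (hF.comp (contDiff_id.add contDiff_const)).sub hF
      have hcont : Continuous (iteratedDeriv (k + 1) F) :=
        hF.continuous_iteratedDeriv (k + 1) (by exact_mod_cast le_top)
      have hder : ∀ t, HasDerivAt (iteratedDeriv k F) (iteratedDeriv (k + 1) F t) t := by
        intro t
        rw [iteratedDeriv_succ]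
        exact ((hF.differentiable_iteratedDeriv k
          (by exact_mod_cast ENat.natCast_lt_top k)) t).hasDerivAt
      have hstep : ∀ t, iteratedDeriv k (fwdDiff 1 F) t =
          ∫ u, iteratedDeriv (k + 1) F (t + u) ∂unif := by
        intro t
        have h1 : iteratedDeriv k (fwdDiff 1 F) t =
            iteratedDeriv k F (t + 1) - iteratedDeriv k F t := by
          have : fwdDiff 1 F = (fun x => F (x + 1)) - F := rfl
          rw [this, iteratedDeriv_sub, iteratedDeriv_comp_add_const]
          · exact ((hF.comp (contDiff_id.add contDiff_const)).of_le
              (by exact_mod_cast le_top)).contDiffAt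
          · exact (hF.of_le (by exact_mod_cast le_top)).contDiffAt
        rw [h1, ← intervalIntegral.integral_eq_sub_of_hasDerivAt (fun u _ => hder u)
          (hcont.intervalIntegrable _ _)]
        have h2 := intervalIntegral.integral_comp_add_left (a := 0) (b := 1)
          (iteratedDeriv (k + 1) F) t
        rw [add_zero] at h2
        rw [← h2, intervalIntegral.integral_of_le zero_le_one, ← integral_Icc_eq_integral_Ioc]
      rw [Function.iterate_succ_apply, H _ hD, funext hstep,
        integral_map hadd.aemeasurable hcont.aestronglyMeasurable, integral_prod]
      have hcomp : Continuous fun z : ℝ × ℝ => iteratedDeriv (k + 1) F (z.1 + z.2) :=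
        hcont.comp (by fun_prop)
      obtain ⟨B, hB⟩ :=
        (isCompact_Icc (a := (0 : ℝ)) (b := (k + 1 : ℕ))).exists_bound_of_continuousOn
        hcont.continuousOn
      refine Integrable.of_bound hcomp.aestronglyMeasurable B ?_
      have := (Measure.absolutelyContinuous_of_le hle).ae_le (ae_restrict_mem measurableSet_Icc)
      filter_upwards [ae_of_ae_map hadd.aemeasurable this] with z hz
      exact hB _ hz

section SplineAverage

variable {n : ℕ} {u : En n → ℝ} {ν : Measure ℝ} [IsProbabilityMeasure ν] {L : ℝ}

lemma LocallyIntegrable.integrable_mul_translate (hu : LocallyIntegrable u volume)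
    (hν : ∀ᵐ t ∂ν, t ∈ Icc (0 : ℝ) L) (h : En n) {ψ : En n → ℝ} (hψ : Measurable ψ) {B R : ℝ}
    (hB : ∀ x, ‖ψ x‖ ≤ B) (hR : ∀ x, ψ x ≠ 0 → ‖x‖ ≤ R) :
    Integrable (fun z : ℝ × En n => u z.2 * ψ (z.2 - z.1 • h)) (ν.prod volume) := by
  have hK : IntegrableOn u (Metric.closedBall 0 (R + L * ‖h‖)) volume :=
    hu.integrableOn_isCompact (isCompact_closedBall _ _)
  have h1 : Integrable (fun z : ℝ × En n =>
      ((Metric.closedBall 0 (R + L * ‖h‖)).indicator u z.2) * ψ (z.2 - z.1 • h))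
      (ν.prod volume) := by
    refine Integrable.mul_bdd (c := B)
      ((hK.integrable_indicator Metric.isClosed_closedBall.measurableSet).comp_snd ν) ?_ ?_
    · exact (hψ.comp (by fun_prop)).aestronglyMeasurable
    · exact Filter.Eventually.of_forall fun z => hB _
  refine h1.congr ?_
  have hν' : ∀ᵐ z ∂(ν.prod (volume : Measure (En n))), z.1 ∈ Icc (0 : ℝ) L :=
    Measure.quasiMeasurePreserving_fst.ae hν
  filter_upwards [hν'] with z hz
  by_cases h0 : ψ (z.2 - z.1 • h) = 0
  · simp [h0]
  · rw [indicator_of_mem]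
    have h2 := hR _ h0
    have h3 : ‖z.2‖ ≤ ‖z.2 - z.1 • h‖ + ‖z.1 • h‖ := by
      simpa using norm_add_le (z.2 - z.1 • h) (z.1 • h)
    rw [norm_smul, Real.norm_of_nonneg hz.1] at h3
    have h4 := mul_le_mul_of_nonneg_right hz.2 (norm_nonneg h)
    rw [mem_closedBall_zero_iff]
    linarith

lemma measurePreserving_shear (ν : Measure ℝ) [IsProbabilityMeasure ν] (h : En n) :
    MeasurePreserving (fun z : ℝ × En n => (z.1, z.2 + z.1 • h)) (ν.prod volume)
      (ν.prod volume) :=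
  (MeasurePreserving.id ν).skew_product (g := fun (t : ℝ) (x : En n) => x + t • h)
    (by fun_prop) (Filter.Eventually.of_forall fun t => map_add_right_eq_self volume (t • h))

lemma LocallyIntegrable.integrable_translate_mul (hu : LocallyIntegrable u volume)
    (hν : ∀ᵐ t ∂ν, t ∈ Icc (0 : ℝ) L) (h : En n) {ψ : En n → ℝ} (hψ : Measurable ψ) {B R : ℝ}
    (hB : ∀ x, ‖ψ x‖ ≤ B) (hR : ∀ x, ψ x ≠ 0 → ‖x‖ ≤ R) :
    Integrable (fun z : ℝ × En n => u (z.2 + z.1 • h) * ψ z.2) (ν.prod volume) := by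
  have h1 := (measurePreserving_shear ν h).integrable_comp_of_integrable
    (LocallyIntegrable.integrable_mul_translate hu hν h hψ hB hR)
  simpa [Function.comp_def] using h1

lemma LocallyIntegrable.integral_translate (hu : LocallyIntegrable u volume)
    (hν : ∀ᵐ t ∂ν, t ∈ Icc (0 : ℝ) L) (h : En n) :
    LocallyIntegrable (fun x => ∫ t, u (x + t • h) ∂ν) volume := by
  rw [locallyIntegrable_iff]
  intro K hK
  obtain ⟨R, hR⟩ := hK.isBounded.subset_closedBall (0 : En n)
  have h1 := (LocallyIntegrable.integrable_translate_mul hu hν h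
    (ψ := K.indicator 1) (measurable_one.indicator hK.measurableSet) (B := 1) (R := R)
    (fun x => by
      by_cases hx : x ∈ K <;> simp [hx])
    (fun x hx => by
      have := hR (mem_of_indicator_ne_zero hx)
      simpa using this)).integral_prod_right
  rw [← integrable_indicator_iff hK.measurableSet]
  refine h1.congr (Filter.Eventually.of_forall fun x => ?_)
  by_cases hx : x ∈ K <;> simp [hx]

lemma LocallyIntegrable.comp_add_const (hu : LocallyIntegrable u volume) (v : En n) :
    LocallyIntegrable (fun x => u (x + v)) volume := by
  have := locallyIntegrable_map_homeomorph (Homeomorph.addRight v) (f := u)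
    (μ := (volume : Measure (En n)))
  rw [Homeomorph.coe_addRight, map_add_right_eq_self] at this
  exact this.1 hu

lemma locallyIntegrable_kDiff (hu : LocallyIntegrable u volume) (k : ℕ) (h : En n) :
    LocallyIntegrable (kDiff k u h) volume := by
  have : kDiff k u h = fun x => ∑ j ∈ Finset.range (k + 1),
      ((-1 : ℝ) ^ (k - j) * (k.choose j : ℝ)) • u (x + (j : ℝ) • h) := rfl
  rw [this]
  exact locallyIntegrable_finsetSum _ fun j _ =>
    (LocallyIntegrable.comp_add_const hu ((j : ℝ) • h)).smul
      ((-1 : ℝ) ^ (k - j) * (k.choose j : ℝ))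

end SplineAverage

lemma kDiff_eq_sum_fwdDiff {n : ℕ} (k : ℕ) (φ : En n → ℝ) (h x : En n) :
    (fwdDiff 1)^[k] (fun t : ℝ => φ (x + t • h)) 0 = kDiff k φ h x := by
  rw [fwdDiff_iter_eq_sum_shift]
  refine Finset.sum_congr rfl fun j _ => ?_
  simp

lemma integral_kDiff_mul {n : ℕ} {f : En n → ℝ} (hf : LocallyIntegrable f volume) (k : ℕ)
    (h : En n) {φ : En n → ℝ} (hφ : Continuous φ) (hc : HasCompactSupport φ) :
    ∫ x, φ x • kDiff k f h x = ∫ x, f x * kDiff k φ (-h) x := by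
  have hint : ∀ v : En n, Integrable (fun x => φ x * f (x + v)) volume := fun v =>
    (LocallyIntegrable.comp_add_const hf v).integrable_smul_left_of_hasCompactSupport hφ hc
  have hsub : ∀ v : En n, ∫ x, φ x * f (x + v) = ∫ x, f x * φ (x - v) := fun v => by
    rw [← integral_sub_right_eq_self (fun x => φ x * f (x + v)) v]
    simp [mul_comm]
  have hint' : ∀ v : En n, Integrable (fun x => f x * φ (x - v)) volume := fun v => by
    simpa [mul_comm] using (hint v).comp_sub_right v
  have hl : ∀ x, φ x • kDiff k f h x = ∑ j ∈ Finset.range (k + 1),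
      ((-1 : ℝ) ^ (k - j) * (k.choose j : ℝ)) * (φ x * f (x + (j : ℝ) • h)) := fun x => by
    rw [kDiff, smul_eq_mul, Finset.mul_sum]
    exact Finset.sum_congr rfl fun j _ => by ring
  have hr : ∀ x, f x * kDiff k φ (-h) x = ∑ j ∈ Finset.range (k + 1),
      ((-1 : ℝ) ^ (k - j) * (k.choose j : ℝ)) * (f x * φ (x - (j : ℝ) • h)) := fun x => by
    rw [kDiff, Finset.mul_sum]
    exact Finset.sum_congr rfl fun j _ => by rw [smul_neg, ← sub_eq_add_neg]; ring
  simp_rw [hl, hr]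
  rw [integral_finsetSum _ fun j _ => (hint _).const_mul _,
    integral_finsetSum _ fun j _ => (hint' _).const_mul _]
  exact Finset.sum_congr rfl fun j _ => by
    rw [integral_const_mul, integral_const_mul, hsub]

lemma exists_bound_of_hasCompactSupport {n : ℕ} {ψ : En n → ℝ} (h1 : Continuous ψ)
    (h2 : HasCompactSupport ψ) : ∃ B R : ℝ, (∀ x, ‖ψ x‖ ≤ B) ∧ ∀ x, ψ x ≠ 0 → ‖x‖ ≤ R := by
  obtain ⟨B, hB⟩ := h1.bounded_above_of_compact_support h2
  obtain ⟨R, hR⟩ := h2.isCompact.isBounded.subset_closedBall (0 : En n)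
  exact ⟨B, R, hB, fun x hx => by simpa using hR (subset_tsupport ψ hx)⟩

lemma exists_iteratedDeriv_line_eq_comp {n : ℕ} {φ : En n → ℝ} (hφ : ContDiff ℝ (⊤ : ℕ∞) φ)
    (hc : HasCompactSupport φ) (k : ℕ) (h : En n) :
    ∃ D : En n → ℝ, Continuous D ∧ HasCompactSupport D ∧
      ∀ x t, iteratedDeriv k (fun t : ℝ => φ (x + t • (-h))) t = D (x - t • h) := by
  obtain ⟨ι, _, c, A, -, -, hD⟩ := exists_iteratedDeriv_line_eq (-h) k
  refine ⟨fun x => ∑ a, c a * mpd (A a) φ x, ?_, ?_, fun x t => ?_⟩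
  · exact continuous_finsetSum _ fun a _ => continuous_const.mul (hφ.mpd (A a)).continuous
  · have h1 := HasCompactSupport.finset_sum (s := Finset.univ)
      fun a _ => (hc.mpd (A a)).mul_left (f := fun _ => c a)
    have h2 : (fun x => ∑ a, c a * mpd (A a) φ x) = ∑ a, (fun _ => c a) * mpd (A a) φ := by
      funext x
      simp
    rwa [h2]
  · rw [hD φ hφ x t, smul_neg, ← sub_eq_add_neg]

/-- The `k`-th difference is the B-spline average of the `k`-th directional derivative. -/
lemma kDiff_ae_eq_integral {n k : ℕ} {f u : En n → ℝ} (hf : LocallyIntegrable f volume)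
    (hu : LocallyIntegrable u volume) (h : En n)
    (H : ∀ φ : En n → ℝ, ContDiff ℝ (⊤ : ℕ∞) φ → HasCompactSupport φ →
      ∫ x, f x * iteratedDeriv k (fun t : ℝ => φ (x + t • (-h))) 0 = ∫ x, u x * φ x)
    {ν : Measure ℝ} [IsProbabilityMeasure ν] (hν : ∀ᵐ t ∂ν, t ∈ Icc (0 : ℝ) k)
    (hF : ∀ F : ℝ → ℝ, ContDiff ℝ (⊤ : ℕ∞) F →
        (fwdDiff 1)^[k] F 0 = ∫ t, iteratedDeriv k F t ∂ν) :
    ∀ᵐ x, kDiff k f h x = ∫ t, u (x + t • h) ∂ν := by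
  refine ae_eq_of_integral_contDiff_smul_eq (locallyIntegrable_kDiff hf k h)
    (LocallyIntegrable.integral_translate hu hν h) fun φ hφ hc => ?_
  obtain ⟨D, hDc, hDs, hline⟩ := exists_iteratedDeriv_line_eq_comp hφ hc k h
  obtain ⟨B, R, hB, hR⟩ := exists_bound_of_hasCompactSupport hDc hDs
  obtain ⟨B', R', hB', hR'⟩ := exists_bound_of_hasCompactSupport hφ.continuous hc
  have hsmooth : ∀ x : En n, ContDiff ℝ (⊤ : ℕ∞) (fun t : ℝ => φ (x + t • (-h))) := fun x =>
    hφ.comp (contDiff_const.add (contDiff_id.smul contDiff_const))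
  have hmove : ∀ t : ℝ, ∫ x, f x * D (x - t • h) = ∫ x, u (x + t • h) * φ x := by
    intro t
    have h1 := H (fun x => φ (x - t • h)) (hφ.comp (contDiff_id.sub contDiff_const))
      (hc.comp_homeomorph (Homeomorph.subRight (t • h)))
    have h2 : ∀ x, iteratedDeriv k (fun s : ℝ => φ (x + s • (-h) - t • h)) 0 =
        D (x - t • h) := fun x => by
      have := hline (x - t • h) 0
      rw [zero_smul, sub_zero] at this
      rw [← this]
      congr 1
      funext s
      congr 1
      abel
    simp_rw [h2] at h1
    rw [h1, ← integral_add_right_eq_self _ (t • h)]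
    simp
  calc ∫ x, φ x • kDiff k f h x = ∫ x, f x * kDiff k φ (-h) x :=
        integral_kDiff_mul hf k h hφ.continuous hc
    _ = ∫ x, ∫ t, f x * D (x - t • h) ∂ν := by
        refine integral_congr_ae (Filter.Eventually.of_forall fun x => ?_)
        simp only
        rw [← kDiff_eq_sum_fwdDiff, hF _ (hsmooth x), ← integral_const_mul]
        simp_rw [hline]
    _ = ∫ t, (∫ x, f x * D (x - t • h)) ∂ν :=
        (integral_integral_swap (f := fun t x => f x * D (x - t • h))
          (LocallyIntegrable.integrable_mul_translate hf hν h
          hDc.measurable hB hR)).symm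
    _ = ∫ t, (∫ x, u (x + t • h) * φ x) ∂ν := by simp_rw [hmove]
    _ = ∫ x, ∫ t, u (x + t • h) * φ x ∂ν :=
        integral_integral_swap (f := fun t x => u (x + t • h) * φ x)
          (LocallyIntegrable.integrable_translate_mul hu hν h
          hφ.continuous.measurable hB' hR')
    _ = ∫ x, φ x • ∫ t, u (x + t • h) ∂ν := by
        simp_rw [integral_mul_const, smul_eq_mul, mul_comm]

lemma enorm_kDiff_le_lintegral {n k : ℕ} (hk : 0 < k) {f : En n → ℝ}
    {g : (Fin n → ℕ) → En n → ℝ} {G : En n → ℝ≥0∞} (hf : LocallyIntegrable f volume)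
    (hg : HasWeakDerivs k f g) (hG : ∀ α : Fin n → ℕ, ∑ i, α i = k → ∀ x, ‖g α x‖ₑ ≤ G x)
    (h : En n) :
    ∀ᵐ x, ‖kDiff k f h x‖ₑ ≤
      ENNReal.ofReal ((n * ‖h‖) ^ k) * ∫⁻ t in Icc (0 : ℝ) k, G (x + t • h) := by
  obtain ⟨ν, _, hν, hle, hF⟩ := exists_fwdDiff_eq_integral_iteratedDeriv k
  obtain ⟨ι, _, c, A, hA, hc, hD⟩ := exists_iteratedDeriv_line_eq (-h) k
  let u : En n → ℝ := fun x => ∑ a, ((-1) ^ k * c a) * g (A a) x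
  have hu : LocallyIntegrable u volume :=
    locallyIntegrable_finsetSum _ fun a _ => (hg.1 (A a) (hA a)).smul ((-1) ^ k * c a)
  have huG : ∀ x, ‖u x‖ₑ ≤ ENNReal.ofReal ((n * ‖h‖) ^ k) * G x := by
    intro x
    calc ‖u x‖ₑ ≤ ∑ a, ‖((-1) ^ k * c a) * g (A a) x‖ₑ := enorm_sum_le _ _
      _ ≤ ∑ a, ENNReal.ofReal |c a| * G x := by
          refine Finset.sum_le_sum fun a _ => ?_
          rw [enorm_mul]
          refine mul_le_mul' (le_of_eq ?_) (hG _ (hA a) x)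
          rw [← ofReal_norm]
          simp
      _ = ENNReal.ofReal (∑ a, |c a|) * G x := by
          rw [← Finset.sum_mul, ENNReal.ofReal_sum_of_nonneg fun a _ => abs_nonneg _]
      _ ≤ _ := by
          gcongr
          simpa using hc
  have H : ∀ φ : En n → ℝ, ContDiff ℝ (⊤ : ℕ∞) φ → HasCompactSupport φ →
      ∫ x, f x * iteratedDeriv k (fun t : ℝ => φ (x + t • (-h))) 0 = ∫ x, u x * φ x := by
    intro φ hφ hφc
    have hi : ∀ a, Integrable (fun x => f x * mpd (A a) φ x) := fun a => by
      simpa [mul_comm] using hf.integrable_smul_left_of_hasCompactSupport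
        (hφ.mpd (A a)).continuous (hφc.mpd (A a))
    have hi' : ∀ a, Integrable (fun x => g (A a) x * φ x) := fun a => by
      simpa [mul_comm] using (hg.1 (A a) (hA a)).integrable_smul_left_of_hasCompactSupport
        hφ.continuous hφc
    have e1 : ∀ x, f x * iteratedDeriv k (fun t : ℝ => φ (x + t • (-h))) 0 =
        ∑ a, c a * (f x * mpd (A a) φ x) := fun x => by
      rw [hD φ hφ, Finset.mul_sum]
      exact Finset.sum_congr rfl fun a _ => by rw [zero_smul, add_zero]; ring
    have e2 : ∀ x, u x * φ x = ∑ a, ((-1) ^ k * c a) * (g (A a) x * φ x) := fun x => by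
      rw [Finset.sum_mul]
      exact Finset.sum_congr rfl fun a _ => by ring
    simp_rw [e1, e2]
    rw [integral_finsetSum _ fun a _ => (hi a).const_mul _,
      integral_finsetSum _ fun a _ => (hi' a).const_mul _]
    refine Finset.sum_congr rfl fun a _ => ?_
    rw [integral_const_mul, integral_const_mul, hg.2 (A a) (hA a) φ hφ hφc]
    ring
  filter_upwards [kDiff_ae_eq_integral hf hu h H hν hF] with x hx
  rw [hx]
  calc ‖∫ t, u (x + t • h) ∂ν‖ₑ ≤ ∫⁻ t, ‖u (x + t • h)‖ₑ ∂ν :=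
        enorm_integral_le_lintegral_enorm _
    _ ≤ ∫⁻ t, ENNReal.ofReal ((n * ‖h‖) ^ k) * G (x + t • h) ∂ν :=
        lintegral_mono fun t => huG _
    _ = ENNReal.ofReal ((n * ‖h‖) ^ k) * ∫⁻ t, G (x + t • h) ∂ν :=
        lintegral_const_mul' _ _ ENNReal.ofReal_ne_top
    _ ≤ _ := mul_le_mul_right (lintegral_mono' (hle hk) le_rfl) _

section DyadicTree

/-- Total weight of the bad dyadic intervals (those with `c * w i < μ i m`) contained in the
`m`-th interval of generation `i`, each bad interval of generation `j` having weight `w j`. -/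
noncomputable def badWeight (w : ℕ → ℝ≥0∞) (μ : ℕ → ℕ → ℝ≥0∞) (c : ℝ≥0∞) : ℕ → ℕ → ℝ≥0∞
  | 0, m => if c * w 0 < μ 0 m then w 0 else 0
  | i + 1, m => (if c * w (i + 1) < μ (i + 1) m then w (i + 1) else 0) +
      (badWeight w μ c i (2 * m) + badWeight w μ c i (2 * m + 1))

variable {w : ℕ → ℝ≥0∞} {μ : ℕ → ℕ → ℝ≥0∞} {c : ℝ≥0∞}

lemma mul_ite_lt_le (a b : ℝ≥0∞) : c * (if c * a < b then a else 0) ≤ b := by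
  split_ifs with h
  · exact h.le
  · simp

/-- Increasing geometric weights: pass to the maximal bad intervals. -/
lemma badWeight_le_of_two_lt {r : ℝ≥0∞} (hr : 2 < r) (hr' : r ≠ ⊤)
    (hw : ∀ i, w (i + 1) = r * w i) (hμ : ∀ i m, μ (i + 1) m = μ i (2 * m) + μ i (2 * m + 1)) :
    ∀ i m, c * badWeight w μ c i m ≤ r / (r - 2) * μ i m := by
  have h0 : r - 2 ≠ 0 := (tsub_pos_of_lt hr).ne'
  have ht : r - 2 ≠ ⊤ := ENNReal.sub_ne_top hr'
  have h1 : 1 ≤ r / (r - 2) := by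
    rw [ENNReal.le_div_iff_mul_le (Or.inl h0) (Or.inl ht), one_mul]
    exact tsub_le_self
  have hκ : r + 2 * (r / (r - 2)) = r * (r / (r - 2)) := by
    have : r = (r - 2) + 2 := (tsub_add_cancel_of_le hr.le).symm
    calc r + 2 * (r / (r - 2)) = (r - 2) * (r / (r - 2)) + 2 * (r / (r - 2)) := by
          rw [ENNReal.mul_div_cancel h0 ht]
      _ = ((r - 2) + 2) * (r / (r - 2)) := by rw [add_mul]
      _ = _ := by rw [← this]
  have hfull : ∀ i m, badWeight w μ c i m ≤ r / (r - 2) * w i := by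
    intro i
    induction i with
    | zero =>
      intro m
      unfold badWeight
      split_ifs
      · exact le_mul_of_one_le_left' h1
      · simp
    | succ i ih =>
      intro m
      unfold badWeight
      calc _ ≤ w (i + 1) + (r / (r - 2) * w i + r / (r - 2) * w i) := by
            gcongr
            · split_ifs <;> simp
            · exact ih _
            · exact ih _
        _ = (r + 2 * (r / (r - 2))) * w i := by rw [hw]; ring
        _ = _ := by rw [hκ, hw]; ring
  intro i
  induction i with
  | zero =>
    intro m
    unfold badWeight
    exact (mul_ite_lt_le _ _).trans (le_mul_of_one_le_left' h1)
  | succ i ih =>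
    intro m
    by_cases hbad : c * w (i + 1) < μ (i + 1) m
    · calc _ ≤ c * (r / (r - 2) * w (i + 1)) := by gcongr; exact hfull _ _
        _ = r / (r - 2) * (c * w (i + 1)) := by ring
        _ ≤ _ := by gcongr
    · unfold badWeight
      rw [if_neg hbad, zero_add, mul_add, hμ, mul_add]
      exact add_le_add (ih _) (ih _)

/-- Decreasing geometric weights: pass to the minimal bad intervals. -/
lemma badWeight_le_of_lt_one {r : ℝ≥0∞} (hr : r < 1)
    (hw : ∀ i, w (i + 1) = r * w i) (hμ : ∀ i m, μ (i + 1) m = μ i (2 * m) + μ i (2 * m + 1)) :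
    ∀ i m, c * badWeight w μ c i m ≤ (1 + r / (1 - r)) * μ i m := by
  have h0 : 1 - r ≠ 0 := (tsub_pos_of_lt hr).ne'
  have ht : 1 - r ≠ ⊤ := ENNReal.sub_ne_top ENNReal.one_ne_top
  set κ := r / (1 - r) with hκdef
  have hκ : r * (1 + κ) = κ := by
    have h1 : r = (1 - r) * κ := (ENNReal.mul_div_cancel h0 ht).symm
    calc r * (1 + κ) = r + r * κ := by ring
      _ = (1 - r) * κ + r * κ := by rw [← h1]
      _ = ((1 - r) + r) * κ := by rw [add_mul]
      _ = κ := by rw [tsub_add_cancel_of_le hr.le, one_mul]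
  have main : ∀ i m, badWeight w μ c i m = 0 ∨
      c * (badWeight w μ c i m + κ * w i) ≤ (1 + κ) * μ i m := by
    intro i
    induction i with
    | zero =>
      intro m
      unfold badWeight
      split_ifs with h
      · right
        calc _ = (1 + κ) * (c * w 0) := by ring
          _ ≤ _ := by gcongr
      · exact Or.inl rfl
    | succ i ih =>
      intro m
      have hκw : κ * w i = w (i + 1) + κ * w (i + 1) := by
        rw [hw]
        calc κ * w i = r * (1 + κ) * w i := by rw [hκ]
          _ = _ := by ring
      have hif : (if c * w (i + 1) < μ (i + 1) m then w (i + 1) else 0) ≤ w (i + 1) := by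
        split_ifs <;> simp
      have weak : ∀ m, c * badWeight w μ c i m ≤ (1 + κ) * μ i m := fun m => by
        rcases ih m with h | h
        · simp [h]
        · exact (mul_le_mul_right le_self_add c).trans h
      unfold badWeight
      rcases ih (2 * m) with hl | hl
      · rcases ih (2 * m + 1) with hr | hr
        · rw [hl, hr, add_zero, add_zero]
          split_ifs with h
          · right
            calc _ = (1 + κ) * (c * w (i + 1)) := by ring
              _ ≤ _ := by gcongr
          · exact Or.inl rfl
        · right
          calc _ ≤ c * (w (i + 1) + (badWeight w μ c i (2 * m) +
                  badWeight w μ c i (2 * m + 1)) + κ * w (i + 1)) := by gcongr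
            _ = c * badWeight w μ c i (2 * m) + c * (badWeight w μ c i (2 * m + 1) +
                  (w (i + 1) + κ * w (i + 1))) := by ring
            _ ≤ (1 + κ) * μ i (2 * m) + (1 + κ) * μ i (2 * m + 1) := by
                rw [← hκw]
                exact add_le_add (weak _) hr
            _ = _ := by rw [hμ]; ring
      · right
        calc _ ≤ c * (w (i + 1) + (badWeight w μ c i (2 * m) +
                badWeight w μ c i (2 * m + 1)) + κ * w (i + 1)) := by gcongr
          _ = c * (badWeight w μ c i (2 * m) + (w (i + 1) + κ * w (i + 1))) +
                c * badWeight w μ c i (2 * m + 1) := by ring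
          _ ≤ (1 + κ) * μ i (2 * m) + (1 + κ) * μ i (2 * m + 1) := by
              rw [← hκw]
              exact add_le_add hl (weak _)
          _ = _ := by rw [hμ]; ring
  intro i m
  rcases main i m with h | h
  · simp [h]
  · exact (mul_le_mul_right le_self_add c).trans h

lemma exists_badWeight_le {r : ℝ≥0∞} (hr : r < 1 ∨ 2 < r) (hr' : r ≠ ⊤) :
    ∃ K : ℝ≥0∞, K ≠ ⊤ ∧ ∀ (w : ℕ → ℝ≥0∞) (μ : ℕ → ℕ → ℝ≥0∞) (c : ℝ≥0∞),
      (∀ i, w (i + 1) = r * w i) → (∀ i m, μ (i + 1) m = μ i (2 * m) + μ i (2 * m + 1)) →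
      ∀ i m, c * badWeight w μ c i m ≤ K * μ i m := by
  rcases hr with hr | hr
  · refine ⟨1 + r / (1 - r), ?_, fun w μ c hw hμ => badWeight_le_of_lt_one hr hw hμ⟩
    exact ENNReal.add_ne_top.2 ⟨ENNReal.one_ne_top,
      ENNReal.div_ne_top hr' (tsub_pos_of_lt hr).ne'⟩
  · exact ⟨r / (r - 2), ENNReal.div_ne_top hr' (tsub_pos_of_lt hr).ne',
      fun w μ c hw hμ => badWeight_le_of_two_lt hr hr' hw hμ⟩

lemma sum_range_two_mul (F : ℕ → ℝ≥0∞) (R : ℕ) :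
    ∑ m ∈ Finset.range (2 * R), F m = ∑ m ∈ Finset.range R, (F (2 * m) + F (2 * m + 1)) := by
  induction R with
  | zero => simp
  | succ R ih =>
    rw [show 2 * (R + 1) = 2 * R + 1 + 1 by ring, Finset.sum_range_succ, Finset.sum_range_succ, ih,
      Finset.sum_range_succ, add_assoc]

lemma sum_badWeight (L R : ℕ) :
    ∑ m ∈ Finset.range R, badWeight w μ c L m =
      ∑ i ∈ Finset.range (L + 1), ∑ m ∈ Finset.range (R * 2 ^ (L - i)),
        if c * w i < μ i m then w i else 0 := by
  induction L generalizing R with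
  | zero => simp [badWeight]
  | succ L ih =>
    rw [Finset.sum_range_succ, Nat.sub_self, pow_zero, mul_one]
    simp only [badWeight]
    rw [Finset.sum_add_distrib, add_comm, ← sum_range_two_mul, ih (2 * R)]
    congr 1
    refine Finset.sum_congr rfl fun i hi => ?_
    have : L + 1 - i = (L - i) + 1 := by
      have := Finset.mem_range.1 hi
      omega
    rw [this, pow_succ]
    congr 2
    ring

end DyadicTree

lemma sum_measure_Ico_mul (ρ : Measure ℝ) {ℓ : ℝ} (hℓ : 0 ≤ ℓ) (m R : ℕ) :
    ∑ i ∈ Finset.range R, ρ (Ico ((m + i : ℕ) * ℓ) (((m + i : ℕ) + 1) * ℓ)) =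
      ρ (Ico (m * ℓ) ((m + R : ℕ) * ℓ)) := by
  induction R with
  | zero => simp
  | succ R ih =>
    rw [Finset.sum_range_succ, ih, ← measure_union _ measurableSet_Ico,
      Ico_union_Ico_eq_Ico (by gcongr; simp) (by gcongr; simp)]
    · push_cast
      rw [add_assoc (m : ℝ)]
    · exact Ico_disjoint_Ico_same

lemma two_rpow_mul_ofReal_zpow (j : ℤ) (γ : ℝ) :
    (2 : ℝ≥0∞) ^ (j * γ) * ENNReal.ofReal ((2 : ℝ) ^ j) = (2 : ℝ≥0∞) ^ (j * (γ + 1)) := by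
  have : ENNReal.ofReal ((2 : ℝ) ^ j) = (2 : ℝ≥0∞) ^ (j : ℝ) := by
    rw [← Real.rpow_intCast, ← ENNReal.ofReal_rpow_of_pos two_pos]
    simp
  rw [this, ← ENNReal.rpow_add _ _ two_ne_zero ENNReal.ofNat_ne_top, mul_add, mul_one]

lemma volume_Ico_inter_le {ρ : Measure ℝ} {ℓ : ℝ} (hℓ : 0 ≤ ℓ) (k m : ℕ) (c W : ℝ≥0∞) :
    volume (Ico (m * ℓ) ((m + 1) * ℓ) ∩ {τ | (k + 1) * c * W < ρ (Icc τ (τ + k * ℓ))}) ≤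
      ∑ i ∈ Finset.range (k + 1),
        if c * W < ρ (Ico ((m + i : ℕ) * ℓ) (((m + i : ℕ) + 1) * ℓ))
          then ENNReal.ofReal ℓ else 0 := by
  rcases (Ico ((m : ℝ) * ℓ) ((m + 1) * ℓ) ∩
      {τ | (k + 1) * c * W < ρ (Icc τ (τ + k * ℓ))}).eq_empty_or_nonempty with he | ⟨τ, hτ, hτ'⟩
  · simp [he]
  · have h1 : ∃ i ∈ Finset.range (k + 1),
        c * W < ρ (Ico ((m + i : ℕ) * ℓ) (((m + i : ℕ) + 1) * ℓ)) := by
      by_contra! hcon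
      refine absurd (mem_ofPred.1 hτ') (not_lt.2 ?_)
      calc ρ (Icc τ (τ + k * ℓ)) ≤ ρ (Ico (m * ℓ) ((m + (k + 1) : ℕ) * ℓ)) := by
            refine measure_mono fun y hy => ⟨hτ.1.trans hy.1, ?_⟩
            have h1 := hy.2
            have h2 := hτ.2
            push_cast
            linarith
        _ ≤ ∑ _i ∈ Finset.range (k + 1), c * W := by
            rw [← sum_measure_Ico_mul ρ hℓ]
            exact Finset.sum_le_sum hcon
        _ = (k + 1) * c * W := by
            rw [Finset.sum_const, Finset.card_range, nsmul_eq_mul]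
            push_cast
            ring
    obtain ⟨i, hi, hlt⟩ := h1
    calc _ ≤ volume (Ico (m * ℓ) ((m + 1) * ℓ)) := measure_mono inter_subset_left
      _ = if c * W < ρ (Ico ((m + i : ℕ) * ℓ) (((m + i : ℕ) + 1) * ℓ))
          then ENNReal.ofReal ℓ else 0 := by
          rw [Real.volume_Ico, if_pos hlt]
          congr 1
          ring
      _ ≤ _ := Finset.single_le_sum (f := fun i : ℕ =>
          if c * W < ρ (Ico ((m + i : ℕ) * ℓ) (((m + i : ℕ) + 1) * ℓ))
            then ENNReal.ofReal ℓ else 0) (fun _ _ => zero_le) hi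

lemma sum_range_shift_le (b : ℕ → ℝ≥0∞) {k i R : ℕ} (hi : i ≤ k) (hR : 1 ≤ R) :
    ∑ m ∈ Finset.range R, b (m + i) ≤ ∑ m ∈ Finset.range ((k + 1) * R), b m := by
  calc ∑ m ∈ Finset.range R, b (m + i)
      ≤ ∑ m ∈ Finset.range i, b m + ∑ m ∈ Finset.range R, b (i + m) := by
        simp_rw [add_comm i]
        exact le_add_self
    _ = ∑ m ∈ Finset.range (i + R), b m := (Finset.sum_range_add _ _ _).symm
    _ ≤ _ := by
        refine Finset.sum_le_sum_of_subset (Finset.range_mono ?_)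
        nlinarith

/-- One-dimensional weak-type estimate at finitely many scales, for windows starting in a fixed
interval. -/
lemma exists_sum_mul_volume_window_le {γ : ℝ} (hγ : γ < -1 ∨ 0 < γ) (k : ℕ) :
    ∃ K : ℝ≥0∞, K ≠ ⊤ ∧ ∀ (ρ : Measure ℝ) (c : ℝ≥0∞) (N : ℤ) (L : ℕ),
      c * ∑ i ∈ Finset.range (L + 1), (2 : ℝ≥0∞) ^ (((i + N : ℤ) : ℝ) * γ) *
          volume (Ico 0 ((2 : ℝ) ^ (L + N : ℤ)) ∩
            {τ | c * (2 : ℝ≥0∞) ^ (((i + N : ℤ) : ℝ) * (γ + 1)) <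
              ρ (Icc τ (τ + k * (2 : ℝ) ^ (i + N : ℤ)))}) ≤
        K * ρ (Ico 0 ((k + 1) * (2 : ℝ) ^ (L + N : ℤ))) := by
  have hr : (2 : ℝ≥0∞) ^ (γ + 1) < 1 ∨ 2 < (2 : ℝ≥0∞) ^ (γ + 1) := by
    rcases hγ with h | h
    · left
      exact ENNReal.rpow_lt_one_of_one_lt_of_neg ENNReal.one_lt_two (by linarith)
    · right
      conv_lhs => rw [← ENNReal.rpow_one 2]
      exact ENNReal.rpow_lt_rpow_of_exponent_lt ENNReal.one_lt_two ENNReal.ofNat_ne_top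
        (by linarith)
  have hr' : (2 : ℝ≥0∞) ^ (γ + 1) ≠ ⊤ := ENNReal.rpow_ne_top_of_ne_zero two_ne_zero
    ENNReal.ofNat_ne_top
  obtain ⟨K, hK, H⟩ := exists_badWeight_le hr hr'
  refine ⟨(k + 1) ^ 2 * K, ENNReal.mul_ne_top (by finiteness) hK, fun ρ c N L => ?_⟩
  have hk0 : ((k : ℝ≥0∞) + 1) ≠ 0 := by simp
  have hkt : ((k : ℝ≥0∞) + 1) ≠ ⊤ := by finiteness
  obtain ⟨d, rfl⟩ : ∃ d, c = (k + 1) * d := ⟨c / (k + 1), (ENNReal.mul_div_cancel hk0 hkt).symm⟩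
  let ℓ : ℕ → ℝ := fun i => (2 : ℝ) ^ (i + N : ℤ)
  let W : ℕ → ℝ≥0∞ := fun i => (2 : ℝ≥0∞) ^ (((i + N : ℤ) : ℝ) * (γ + 1))
  let μ : ℕ → ℕ → ℝ≥0∞ := fun i m => ρ (Ico (m * ℓ i) ((m + 1) * ℓ i))
  have hℓ : ∀ i, 0 ≤ ℓ i := fun i => by positivity
  have hℓs : ∀ i, ℓ (i + 1) = 2 * ℓ i := fun i => by
    simp only [ℓ]
    rw [← zpow_one_add₀ two_ne_zero]
    congr 1
    push_cast
    ring
  have hW : ∀ i, W (i + 1) = (2 : ℝ≥0∞) ^ (γ + 1) * W i := fun i => by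
    simp only [W]
    rw [← ENNReal.rpow_add _ _ two_ne_zero ENNReal.ofNat_ne_top]
    congr 1
    push_cast
    ring
  have hμ : ∀ i m, μ (i + 1) m = μ i (2 * m) + μ i (2 * m + 1) := fun i m => by
    have := sum_measure_Ico_mul ρ (hℓ i) (2 * m) 2
    simp only [Finset.sum_range_succ, Finset.sum_range_zero, zero_add, add_zero] at this
    simp only [μ]
    rw [this, hℓs]
    congr 2 <;> push_cast <;> ring
  have hℓL : ∀ i ∈ Finset.range (L + 1), (2 ^ (L - i) : ℕ) * ℓ i = ℓ L := fun i hi => by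
    have : i ≤ L := by have := Finset.mem_range.1 hi; omega
    simp only [ℓ]
    push_cast
    rw [← zpow_natCast, ← zpow_add₀ two_ne_zero]
    congr 1
    push_cast [this]
    ring
  have hterm : ∀ i ∈ Finset.range (L + 1), (2 : ℝ≥0∞) ^ (((i + N : ℤ) : ℝ) * γ) *
      volume (Ico 0 (ℓ L) ∩ {τ | (k + 1) * d * W i < ρ (Icc τ (τ + k * ℓ i))}) ≤
      (k + 1) * ∑ m ∈ Finset.range ((k + 1) * 2 ^ (L - i)),
        if d * W i < μ i m then W i else 0 := by
    intro i hi
    set S := {τ | (k + 1) * d * W i < ρ (Icc τ (τ + k * ℓ i))} with hS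
    have h1 : volume (Ico 0 (ℓ L) ∩ S) = ∑ m ∈ Finset.range (2 ^ (L - i)),
        volume (Ico (m * ℓ i) ((m + 1) * ℓ i) ∩ S) := by
      have := sum_measure_Ico_mul (volume.restrict S) (hℓ i) 0 (2 ^ (L - i))
      simp only [Measure.restrict_apply measurableSet_Ico, zero_add, hℓL i hi] at this
      simpa using this.symm
    have h2 : ∀ m : ℕ, (2 : ℝ≥0∞) ^ (((i + N : ℤ) : ℝ) * γ) *
        volume (Ico (m * ℓ i) ((m + 1) * ℓ i) ∩ S) ≤
        ∑ j ∈ Finset.range (k + 1), if d * W i < μ i (m + j) then W i else 0 := fun m => by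
      refine (mul_le_mul_right (volume_Ico_inter_le (hℓ i) k m d (W i)) _).trans (le_of_eq ?_)
      rw [Finset.mul_sum]
      refine Finset.sum_congr rfl fun j _ => ?_
      rw [mul_ite, mul_zero, two_rpow_mul_ofReal_zpow]
    rw [h1, Finset.mul_sum]
    refine (Finset.sum_le_sum fun m _ => h2 m).trans ?_
    rw [Finset.sum_comm]
    refine (Finset.sum_le_sum fun j hj => sum_range_shift_le
      (fun m => if d * W i < μ i m then W i else 0)
      (Nat.lt_succ_iff.1 (Finset.mem_range.1 hj)) Nat.one_le_two_pow).trans ?_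
    rw [Finset.sum_const, Finset.card_range, nsmul_eq_mul]
    push_cast
    exact le_rfl
  calc _ ≤ (k + 1) * d * ∑ i ∈ Finset.range (L + 1), (k + 1) *
          ∑ m ∈ Finset.range ((k + 1) * 2 ^ (L - i)), (if d * W i < μ i m then W i else 0) :=
        mul_le_mul_right (Finset.sum_le_sum hterm) _
    _ = (k + 1) ^ 2 * (d * ∑ m ∈ Finset.range (k + 1), badWeight W μ d L m) := by
        rw [sum_badWeight, ← Finset.mul_sum]
        ring
    _ ≤ (k + 1) ^ 2 * (K * ∑ m ∈ Finset.range (k + 1), μ L m) := by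
        refine mul_le_mul_right ?_ _
        rw [Finset.mul_sum, Finset.mul_sum]
        exact Finset.sum_le_sum fun m _ => H W μ d hW hμ L m
    _ = _ := by
        have := sum_measure_Ico_mul ρ (hℓ L) 0 (k + 1)
        simp only [zero_add] at this
        simp only [μ]
        rw [this, ← mul_assoc]
        simp [ℓ]

/-- The integral of `G` along the segment from `x` to `x + k h`, parametrized by `[0, k]`. -/
noncomputable def segInt {n : ℕ} (k : ℕ) (G : En n → ℝ≥0∞) (x h : En n) : ℝ≥0∞ :=
  ∫⁻ t in Icc (0 : ℝ) k, G (x + t • h)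

lemma measurable_segInt {n k : ℕ} {G : En n → ℝ≥0∞} (hG : Measurable G) :
    Measurable fun z : En n × En n => segInt k G z.1 z.2 := by
  unfold segInt
  refine Measurable.lintegral_prod_right'
    (f := fun z : (En n × En n) × ℝ => G (z.1.1 + z.2 • z.1.2)) ?_
  fun_prop

lemma measurable_segInt_left {n k : ℕ} {G : En n → ℝ≥0∞} (hG : Measurable G) (h : En n) :
    Measurable fun x : En n => segInt k G x h :=
  (measurable_segInt hG).comp (measurable_id.prodMk measurable_const)

lemma setLIntegral_Icc_add_mul (F : ℝ → ℝ≥0∞) (τ : ℝ) (k : ℕ) {ℓ : ℝ} (hℓ : 0 < ℓ) :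
    ENNReal.ofReal ℓ * ∫⁻ t in Icc (0 : ℝ) k, F (τ + t * ℓ) =
      ∫⁻ σ in Icc τ (τ + k * ℓ), F σ := by
  have h1 : ∀ t, (Icc (0 : ℝ) k).indicator (fun t => F (τ + t * ℓ)) t =
      (fun y => (Icc τ (τ + k * ℓ)).indicator F (τ + y)) (t * ℓ) := fun t => by
    simp only [indicator_apply, mem_Icc, add_le_add_iff_left, le_add_iff_nonneg_right,
      mul_nonneg_iff_of_pos_right hℓ, mul_le_mul_iff_left₀ hℓ]
  rw [← lintegral_indicator measurableSet_Icc, ← lintegral_indicator measurableSet_Icc]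
  have e : MeasurableEmbedding fun t : ℝ => t * ℓ :=
    (Homeomorph.mulRight₀ ℓ hℓ.ne').measurableEmbedding
  rw [lintegral_congr h1, ← e.lintegral_map (μ := volume)
    (fun y => (Icc τ (τ + k * ℓ)).indicator F (τ + y)), ← smul_eq_mul, ← lintegral_smul_measure]
  have h2 := Real.smul_map_volume_mul_right hℓ.ne'
  rw [abs_of_pos hℓ] at h2
  rw [h2, lintegral_add_left_eq_self (fun y => (Icc τ (τ + k * ℓ)).indicator F y) τ]

lemma ofReal_mul_measure_eq {n : ℕ} {B : Set (En n)} (hB : MeasurableSet B) (ω : En n) (ℓ : ℝ) :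
    ENNReal.ofReal ℓ * volume B =
      ∫⁻ x, volume (Ico 0 ℓ ∩ {τ : ℝ | x + τ • ω ∈ B}) := by
  have hm : Measurable fun z : En n × ℝ => z.1 + z.2 • ω := by fun_prop
  have h1 : ∀ x : En n, volume (Ico 0 ℓ ∩ {τ : ℝ | x + τ • ω ∈ B}) =
      ∫⁻ τ in Ico 0 ℓ, B.indicator 1 (x + τ • ω) := fun x => by
    have hmx : MeasurableSet {τ : ℝ | x + τ • ω ∈ B} :=
      (hm.comp (measurable_const.prodMk measurable_id)) hB
    rw [inter_comm, ← Measure.restrict_apply hmx, ← lintegral_indicator_one hmx]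
    rfl
  simp_rw [h1]
  rw [lintegral_lintegral_swap]
  · simp_rw [lintegral_add_right_eq_self (fun x => B.indicator (1 : En n → ℝ≥0∞) x),
      lintegral_indicator_one hB]
    rw [setLIntegral_const, Real.volume_Ico, sub_zero, mul_comm]
  · exact ((measurable_one.indicator hB).comp hm).aemeasurable

lemma exists_sum_mul_measure_segInt_le {γ : ℝ} (hγ : γ < -1 ∨ 0 < γ) (n k : ℕ) :
    ∃ K : ℝ≥0∞, K ≠ ⊤ ∧ ∀ (G : En n → ℝ≥0∞), Measurable G → ∀ (ω : En n) (c : ℝ≥0∞) (N : ℤ)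
      (L : ℕ), c * ∑ i ∈ Finset.range (L + 1), (2 : ℝ≥0∞) ^ (((i + N : ℤ) : ℝ) * γ) *
          volume {x | c * (2 : ℝ≥0∞) ^ (((i + N : ℤ) : ℝ) * γ) <
            segInt k G x ((2 : ℝ) ^ (i + N : ℤ) • ω)} ≤ K * ∫⁻ x, G x := by
  obtain ⟨K, hK, H⟩ := exists_sum_mul_volume_window_le hγ k
  refine ⟨K * (k + 1), by finiteness, fun G hG ω c N L => ?_⟩
  set B : ℕ → Set (En n) := fun i => {x | c * (2 : ℝ≥0∞) ^ (((i + N : ℤ) : ℝ) * γ) <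
    segInt k G x ((2 : ℝ) ^ (i + N : ℤ) • ω)} with hBdef
  set ℓ : ℝ := (2 : ℝ) ^ (L + N : ℤ) with hℓ
  have hℓ0 : 0 < ℓ := by positivity
  have hB : ∀ i, MeasurableSet (B i) := fun i =>
    measurableSet_lt measurable_const (measurable_segInt_left hG _)
  let ρ : En n → Measure ℝ := fun x => volume.withDensity fun σ => G (x + σ • ω)
  have hmem : ∀ x i, {τ : ℝ | x + τ • ω ∈ B i} =
      {τ | c * (2 : ℝ≥0∞) ^ (((i + N : ℤ) : ℝ) * (γ + 1)) <
        ρ x (Icc τ (τ + k * (2 : ℝ) ^ (i + N : ℤ)))} := fun x i => by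
    ext τ
    have h2 : (0 : ℝ) < (2 : ℝ) ^ (i + N : ℤ) := by positivity
    simp only [hBdef, mem_ofPred_eq, ρ, segInt]
    rw [withDensity_apply _ measurableSet_Icc,
      ← setLIntegral_Icc_add_mul (fun σ => G (x + σ • ω)) τ k h2, ← two_rpow_mul_ofReal_zpow,
      ← mul_assoc, mul_comm (ENNReal.ofReal _),
      ENNReal.mul_lt_mul_iff_left (by simpa using h2) ENNReal.ofReal_ne_top]
    simp_rw [smul_smul, add_smul, add_assoc]
  have hmeas : ∀ i, Measurable fun x => volume (Ico 0 ℓ ∩ {τ : ℝ | x + τ • ω ∈ B i}) := by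
    intro i
    have hm : MeasurableSet {z : En n × ℝ | z.2 ∈ Ico 0 ℓ ∧ z.1 + z.2 • ω ∈ B i} :=
      (measurable_snd measurableSet_Ico).inter
        ((by fun_prop : Measurable fun z : En n × ℝ => z.1 + z.2 • ω) (hB i))
    exact measurable_measure_prodMk_left hm
  have hρ : ∫⁻ x, ρ x (Ico 0 ((k + 1) * ℓ)) = ENNReal.ofReal ℓ * ((k + 1) * ∫⁻ x, G x) := by
    simp only [ρ, withDensity_apply _ measurableSet_Ico]
    rw [lintegral_lintegral_swap]
    · simp_rw [lintegral_add_right_eq_self G]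
      rw [setLIntegral_const, Real.volume_Ico, sub_zero, ENNReal.ofReal_mul (by positivity),
        ENNReal.ofReal_add (by positivity) zero_le_one, ENNReal.ofReal_natCast,
        ENNReal.ofReal_one]
      ring
    · exact (by fun_prop : Measurable fun z : En n × ℝ => G (z.1 + z.2 • ω)).aemeasurable
  rw [← ENNReal.mul_le_mul_iff_right (a := ENNReal.ofReal ℓ) (by simpa using hℓ0)
    ENNReal.ofReal_ne_top]
  calc ENNReal.ofReal ℓ * (c * ∑ i ∈ Finset.range (L + 1),
        (2 : ℝ≥0∞) ^ (((i + N : ℤ) : ℝ) * γ) * volume (B i))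
      = c * ∑ i ∈ Finset.range (L + 1), (2 : ℝ≥0∞) ^ (((i + N : ℤ) : ℝ) * γ) *
          (ENNReal.ofReal ℓ * volume (B i)) := by
        rw [mul_left_comm, Finset.mul_sum]
        simp_rw [mul_left_comm (ENNReal.ofReal ℓ)]
    _ = ∫⁻ x, c * ∑ i ∈ Finset.range (L + 1), (2 : ℝ≥0∞) ^ (((i + N : ℤ) : ℝ) * γ) *
          volume (Ico 0 ℓ ∩ {τ : ℝ | x + τ • ω ∈ B i}) := by
        rw [lintegral_const_mul _ (Finset.measurable_fun_sum _ fun i _ =>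
          (hmeas i).const_mul _), lintegral_finsetSum _ fun i _ => (hmeas i).const_mul _]
        congr 1
        refine Finset.sum_congr rfl fun i _ => ?_
        rw [lintegral_const_mul _ (hmeas i), ofReal_mul_measure_eq (hB i) ω ℓ]
    _ ≤ ∫⁻ x, K * ρ x (Ico 0 ((k + 1) * ℓ)) := by
        refine lintegral_mono fun x => ?_
        simp_rw [hmem]
        exact H (ρ x) c N L
    _ = ENNReal.ofReal ℓ * (K * (k + 1) * ∫⁻ x, G x) := by
        rw [lintegral_const_mul' _ _ hK, hρ]
        ring

lemma exists_subset_image_range (s : Finset ℤ) :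
    ∃ (N : ℤ) (L : ℕ), s ⊆ (Finset.range (L + 1)).image fun i : ℕ => (i + N : ℤ) := by
  obtain ⟨a, ha⟩ := s.bddBelow
  obtain ⟨b, hb⟩ := s.bddAbove
  refine ⟨a, (b - a).toNat, fun j hj => ?_⟩
  have h1 := ha (Finset.mem_coe.2 hj)
  have h2 := hb (Finset.mem_coe.2 hj)
  refine Finset.mem_image.2 ⟨(j - a).toNat, Finset.mem_range.2 ?_, ?_⟩ <;> omega

lemma exists_lintegral_tsum_segInt_le {γ : ℝ} (hγ : γ < -1 ∨ 0 < γ) (n k : ℕ) :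
    ∃ K : ℝ≥0∞, K ≠ ⊤ ∧ ∀ (G : En n → ℝ≥0∞), Measurable G → ∀ (ω : En n) (c : ℝ≥0∞),
      c * ∫⁻ x, ∑' j : ℤ, (if c * (2 : ℝ≥0∞) ^ (j * γ) < segInt k G x ((2 : ℝ) ^ j • ω)
        then (2 : ℝ≥0∞) ^ (j * γ) else 0) ≤ K * ∫⁻ x, G x := by
  obtain ⟨K, hK, H⟩ := exists_sum_mul_measure_segInt_le hγ n k
  refine ⟨K, hK, fun G hG ω c => ?_⟩
  have hB : ∀ j : ℤ, MeasurableSet {x | c * (2 : ℝ≥0∞) ^ (j * γ) <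
      segInt k G x ((2 : ℝ) ^ j • ω)} := fun j =>
    measurableSet_lt measurable_const (measurable_segInt_left hG _)
  rw [lintegral_tsum fun j => (Measurable.ite (hB j) measurable_const
    measurable_const).aemeasurable, ENNReal.tsum_eq_iSup_sum, ENNReal.mul_iSup]
  refine iSup_le fun s => ?_
  obtain ⟨N, L, hs⟩ := exists_subset_image_range s
  refine le_trans ?_ (H G hG ω c N L)
  refine mul_le_mul_right ((Finset.sum_le_sum_of_subset hs).trans ?_) _
  rw [Finset.sum_image (by intro i _ j _ h; simpa using h)]
  refine Finset.sum_le_sum fun i _ => le_of_eq ?_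
  have := lintegral_indicator_const (μ := volume) (hB (i + N))
    ((2 : ℝ≥0∞) ^ (((i + N : ℤ) : ℝ) * γ))
  rw [← this]
  refine lintegral_congr fun x => ?_
  simp only [indicator_apply, mem_ofPred_eq]

lemma lintegral_segInt {n k : ℕ} {G : En n → ℝ≥0∞} (hG : Measurable G) (h : En n) :
    ∫⁻ x, segInt k G x h = k * ∫⁻ x, G x := by
  unfold segInt
  rw [lintegral_lintegral_swap]
  · simp_rw [lintegral_add_right_eq_self G]
    rw [setLIntegral_const, Real.volume_Icc, sub_zero, ENNReal.ofReal_natCast, mul_comm]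
  · exact (by fun_prop : Measurable fun z : En n × ℝ => G (z.1 + z.2 • h)).aemeasurable

lemma exists_tsum_two_rpow_le_of_pos {γ : ℝ} (hγ : 0 < γ) :
    ∃ C : ℝ≥0∞, C ≠ ⊤ ∧ ∀ (P : ℤ → Prop) [DecidablePred P] (B : ℝ≥0∞),
      (∀ j, P j → (2 : ℝ≥0∞) ^ (j * γ) ≤ B) →
      ∑' j, (if P j then (2 : ℝ≥0∞) ^ (j * γ) else 0) ≤ C * B := by
  have hr : (2 : ℝ≥0∞) ^ (-γ) < 1 :=
    ENNReal.rpow_lt_one_of_one_lt_of_neg ENNReal.one_lt_two (by linarith)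
  refine ⟨∑' m : ℕ, ((2 : ℝ≥0∞) ^ (-γ)) ^ m, ?_, fun P _ B hB => ?_⟩
  · rw [ENNReal.tsum_geometric]
    exact ENNReal.inv_ne_top.2 (tsub_pos_of_lt hr).ne'
  rw [ENNReal.tsum_eq_iSup_sum]
  refine iSup_le fun s => ?_
  rw [← Finset.sum_filter]
  rcases (s.filter P).eq_empty_or_nonempty with he | hne
  · simp [he]
  set J := (s.filter P).max' hne with hJ
  have hPJ : P J := (Finset.mem_filter.1 ((s.filter P).max'_mem hne)).2
  have hle : ∀ j ∈ s.filter P, j ≤ J := fun j hj => Finset.le_max' _ j hj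
  calc ∑ j ∈ s.filter P, (2 : ℝ≥0∞) ^ (j * γ)
      = ∑ j ∈ s.filter P, ((2 : ℝ≥0∞) ^ (-γ)) ^ (J - j).toNat * (2 : ℝ≥0∞) ^ (J * γ) := by
        refine Finset.sum_congr rfl fun j hj => ?_
        have h1 : (((J - j).toNat : ℤ) : ℝ) = (J : ℝ) - j := by
          rw [Int.toNat_of_nonneg (sub_nonneg.2 (hle j hj))]
          push_cast
          ring
        rw [← ENNReal.rpow_natCast, ← ENNReal.rpow_mul,
          ← ENNReal.rpow_add _ _ two_ne_zero ENNReal.ofNat_ne_top, ← Int.cast_natCast, h1]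
        congr 1
        ring
    _ = (∑ m ∈ (s.filter P).image fun j => (J - j).toNat, ((2 : ℝ≥0∞) ^ (-γ)) ^ m) *
          (2 : ℝ≥0∞) ^ (J * γ) := by
        rw [← Finset.sum_mul, Finset.sum_image]
        intro i hi j hj hij
        have h1 := hle i hi
        have h2 := hle j hj
        simp only at hij
        omega
    _ ≤ _ := mul_le_mul' (ENNReal.sum_le_tsum _) (hB J hPJ)

lemma exists_tsum_two_rpow_le {γ : ℝ} (hγ : γ ≠ 0) :
    ∃ C : ℝ≥0∞, C ≠ ⊤ ∧ ∀ (P : ℤ → Prop) [DecidablePred P] (B : ℝ≥0∞),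
      (∀ j, P j → (2 : ℝ≥0∞) ^ (j * γ) ≤ B) →
      ∑' j, (if P j then (2 : ℝ≥0∞) ^ (j * γ) else 0) ≤ C * B := by
  rcases hγ.lt_or_gt with h | h
  · obtain ⟨C, hC, H⟩ := exists_tsum_two_rpow_le_of_pos (neg_pos.2 h)
    refine ⟨C, hC, fun P _ B hB => ?_⟩
    have := H (fun j => P (-j)) B fun j hj => by simpa using hB _ hj
    rw [← (Equiv.neg ℤ).tsum_eq]
    simpa using this
  · exact exists_tsum_two_rpow_le_of_pos h

lemma exists_lintegral_tsum_segInt_rpow_le_of_one_lt {γ p : ℝ} (hγ : γ ≠ 0) (hp : 1 < p)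
    (n k : ℕ) (hk : 0 < k) :
    ∃ K : ℝ≥0∞, K ≠ ⊤ ∧ ∀ (G : En n → ℝ≥0∞), Measurable G → ∀ (ω : En n) (c : ℝ≥0∞),
      c ≠ 0 → c ≠ ⊤ →
      c ^ p * ∫⁻ x, (∑' j : ℤ, (if c * (2 : ℝ≥0∞) ^ (j * γ) < segInt k G x ((2 : ℝ) ^ j • ω)
        then (2 : ℝ≥0∞) ^ (j * γ) else 0)) ^ p ≤ K * ∫⁻ x, G x ^ p := by
  have hp0 : 0 < p := by linarith
  have hp1 : 0 < p - 1 := by linarith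
  obtain ⟨C, hC, HC⟩ := exists_tsum_two_rpow_le hγ
  obtain ⟨C', hC', HC'⟩ := exists_tsum_two_rpow_le (γ := γ * (p - 1)) (mul_ne_zero hγ hp1.ne')
  have hkp : (2 * k : ℝ≥0∞) ^ p ≠ ⊤ := ENNReal.rpow_ne_top_of_nonneg hp0.le (by finiteness)
  have hCp : C ^ p ≠ ⊤ := ENNReal.rpow_ne_top_of_nonneg hp0.le hC
  refine ⟨(2 * k) ^ p * C ^ p * C', by finiteness, fun G hG ω c hc0 hct => ?_⟩
  have h2k0 : (2 * k : ℝ≥0∞) ≠ 0 := by simp [hk.ne']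
  have h2kt : (2 * k : ℝ≥0∞) ≠ ⊤ := by finiteness
  obtain ⟨d, rfl⟩ : ∃ d, c = (2 * k) * d := ⟨c / (2 * k), (ENNReal.mul_div_cancel h2k0 h2kt).symm⟩
  have hd0 : d ≠ 0 := right_ne_zero_of_mul hc0
  have hdt : d ≠ ⊤ := fun h => hct (by rw [h, ENNReal.mul_top h2k0])
  let w : ℤ → ℝ≥0∞ := fun j => (2 : ℝ≥0∞) ^ (j * γ)
  have hw0 : ∀ j, w j ≠ 0 := fun j => (ENNReal.rpow_pos (by simp) ENNReal.ofNat_ne_top).ne'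
  have hwt : ∀ j, w j ≠ ⊤ := fun j =>
    ENNReal.rpow_ne_top_of_ne_zero two_ne_zero ENNReal.ofNat_ne_top
  have hwp : ∀ j, w j ^ (p - 1) = (2 : ℝ≥0∞) ^ (j * (γ * (p - 1))) := fun j => by
    rw [← ENNReal.rpow_mul, mul_assoc]
  have hsplit : ∀ a : ℝ≥0∞, a * a ^ (p - 1) = a ^ p := fun a => by
    nth_rewrite 1 [← ENNReal.rpow_one a]
    rw [← ENNReal.rpow_add_of_nonneg _ _ zero_le_one hp1.le]
    congr 1
    ring
  let P : ℤ → En n → Prop := fun j x => 2 * k * d * w j < segInt k G x ((2 : ℝ) ^ j • ω)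
  have hP : ∀ j, MeasurableSet {x | P j x} := fun j =>
    measurableSet_lt measurable_const (measurable_segInt_left hG _)
  let Gj : ℤ → En n → ℝ≥0∞ := fun j => {x | d * w j < G x}.indicator G
  have hGj : ∀ j, Measurable (Gj j) := fun j => hG.indicator (measurableSet_lt measurable_const hG)
  have hdp : d ^ (p - 1) ≠ 0 := (ENNReal.rpow_pos (pos_iff_ne_zero.2 hd0) hdt).ne'
  have hdp' : d ^ (p - 1) ≠ ⊤ := ENNReal.rpow_ne_top_of_nonneg hp1.le hdt
  have hpt : ∀ x, (∑' j, if P j x then w j else 0) ^ p ≤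
      C ^ p * ∑' j, if P j x then w j ^ p else 0 := fun x => by
    rw [← ENNReal.rpow_le_rpow_iff (inv_pos.2 hp0), ENNReal.rpow_rpow_inv hp0.ne',
      ENNReal.mul_rpow_of_nonneg _ _ (inv_nonneg.2 hp0.le), ENNReal.rpow_rpow_inv hp0.ne']
    refine HC (fun j => P j x) _ fun j hj => ?_
    rw [← ENNReal.rpow_le_rpow_iff hp0, ENNReal.rpow_inv_rpow hp0.ne']
    refine le_trans (le_of_eq ?_) (ENNReal.le_tsum j)
    rw [if_pos hj]
  have hmarkov : ∀ j, d * w j * volume {x | P j x} ≤ ∫⁻ x, Gj j x := fun j => by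
    have hVm := measurable_segInt_left (k := k) (hGj j) ((2 : ℝ) ^ j • ω)
    have hsub : {x | P j x} ⊆ {x | k * (d * w j) ≤ segInt k (Gj j) x ((2 : ℝ) ^ j • ω)} := by
      intro x hx
      by_contra hcon
      refine absurd (show P j x from hx) (not_lt.2 ?_)
      calc segInt k G x ((2 : ℝ) ^ j • ω)
          ≤ ∫⁻ t in Icc (0 : ℝ) k, (d * w j + Gj j (x + t • (2 : ℝ) ^ j • ω)) := by
            refine lintegral_mono fun t => ?_
            by_cases ht : d * w j < G (x + t • (2 : ℝ) ^ j • ω)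
            · simp [Gj, ht]
            · exact (not_lt.1 ht).trans le_self_add
        _ = k * (d * w j) + segInt k (Gj j) x ((2 : ℝ) ^ j • ω) := by
            rw [lintegral_add_left measurable_const, setLIntegral_const, Real.volume_Icc,
              sub_zero, ENNReal.ofReal_natCast, mul_comm (k : ℝ≥0∞)]
            rfl
        _ ≤ k * (d * w j) + k * (d * w j) := by
            gcongr
            exact (not_le.1 hcon).le
        _ = 2 * k * d * w j := by ring
    have h1 := (mul_le_mul_right (measure_mono (μ := volume) hsub) (k * (d * w j))).trans
      (mul_meas_ge_le_lintegral hVm _)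
    rw [lintegral_segInt (hGj j), mul_assoc] at h1
    exact (ENNReal.mul_le_mul_iff_right (by simp [hk.ne']) (by finiteness)).1 h1
  have hgeo : ∀ x, d ^ (p - 1) * ∑' j, w j ^ (p - 1) * Gj j x ≤ C' * G x ^ p := fun x => by
    have h1 := HC' (fun j => d * w j < G x) ((G x / d) ^ (p - 1)) fun j hj => by
      rw [← hwp]
      refine ENNReal.rpow_le_rpow ?_ hp1.le
      rw [ENNReal.le_div_iff_mul_le (Or.inl hd0) (Or.inl hdt), mul_comm]
      exact hj.le
    simp_rw [← hwp] at h1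
    calc _ = d ^ (p - 1) * ((∑' j, if d * w j < G x then w j ^ (p - 1) else 0) * G x) := by
          rw [← ENNReal.tsum_mul_right]
          congr 2
          ext j
          simp only [Gj, indicator_apply, mem_ofPred_eq]
          split_ifs <;> simp
      _ ≤ d ^ (p - 1) * (C' * (G x / d) ^ (p - 1) * G x) := by gcongr
      _ = C' * (G x * G x ^ (p - 1)) := by
          rw [ENNReal.div_rpow_of_nonneg _ _ hp1.le]
          have := ENNReal.mul_div_cancel (b := G x ^ (p - 1)) hdp hdp'
          calc _ = C' * (d ^ (p - 1) * (G x ^ (p - 1) / d ^ (p - 1))) * G x := by ring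
            _ = _ := by rw [this]; ring
      _ = _ := by rw [hsplit]
  calc (2 * k * d) ^ p * ∫⁻ x, (∑' j, if P j x then w j else 0) ^ p
      ≤ (2 * k * d) ^ p * ∫⁻ x, C ^ p * ∑' j, (if P j x then w j ^ p else 0) := by
        gcongr with x
        exact hpt x
    _ = (2 * k * d) ^ p * (C ^ p * ∑' j, w j ^ p * volume {x | P j x}) := by
        rw [lintegral_const_mul' _ _ hCp, lintegral_tsum fun j => (Measurable.ite (hP j)
          measurable_const measurable_const).aemeasurable]
        congr 3
        ext j
        rw [← lintegral_indicator_const (hP j)]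
        refine lintegral_congr fun x => ?_
        simp only [indicator_apply, mem_ofPred_eq]
    _ = (2 * k) ^ p * C ^ p * (d ^ (p - 1) *
          ∑' j, w j ^ (p - 1) * (d * w j * volume {x | P j x})) := by
        rw [ENNReal.mul_rpow_of_nonneg _ _ hp0.le, ← hsplit d]
        simp_rw [← hsplit (w _)]
        have : ∀ j, w j ^ (p - 1) * (d * w j * volume {x | P j x}) =
          d * (w j * w j ^ (p - 1) * volume {x | P j x}) := fun j => by ring
        simp_rw [this, ENNReal.tsum_mul_left]
        ring
    _ ≤ (2 * k) ^ p * C ^ p * (d ^ (p - 1) * ∑' j, w j ^ (p - 1) * ∫⁻ x, Gj j x) := by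
        gcongr with j
        exact hmarkov j
    _ = (2 * k) ^ p * C ^ p * ∫⁻ x, d ^ (p - 1) * ∑' j, w j ^ (p - 1) * Gj j x := by
        rw [lintegral_const_mul' _ _ hdp', lintegral_tsum fun j =>
          ((hGj j).const_mul _).aemeasurable]
        simp_rw [lintegral_const_mul _ (hGj _)]
    _ ≤ (2 * k) ^ p * C ^ p * ∫⁻ x, C' * G x ^ p := by
        exact mul_le_mul_right (lintegral_mono hgeo) _
    _ = (2 * k) ^ p * C ^ p * C' * ∫⁻ x, G x ^ p := by
        rw [lintegral_const_mul' _ _ hC', mul_assoc ((2 * k : ℝ≥0∞) ^ p * C ^ p)]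

lemma lt_neg_one_or_pos_of_mem_Gam {γ : ℝ} (hγ : γ ∈ Gam 1 1) : γ < -1 ∨ 0 < γ := by
  simpa [Gam] using hγ

lemma exists_lintegral_tsum_segInt_rpow_le {γ p : ℝ} (hp : 1 ≤ p) (hγ : γ ∈ Gam p 1)
    (n k : ℕ) (hk : 0 < k) :
    ∃ K : ℝ≥0∞, K ≠ ⊤ ∧ ∀ (G : En n → ℝ≥0∞), Measurable G → ∀ (ω : En n) (c : ℝ≥0∞),
      c ≠ 0 → c ≠ ⊤ →
      c ^ p * ∫⁻ x, (∑' j : ℤ, (if c * (2 : ℝ≥0∞) ^ (j * γ) < segInt k G x ((2 : ℝ) ^ j • ω)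
        then (2 : ℝ≥0∞) ^ (j * γ) else 0)) ^ p ≤ K * ∫⁻ x, G x ^ p := by
  rcases hp.eq_or_lt with rfl | hp
  · obtain ⟨K, hK, H⟩ := exists_lintegral_tsum_segInt_le (lt_neg_one_or_pos_of_mem_Gam hγ) n k
    refine ⟨K, hK, fun G hG ω c _ _ => ?_⟩
    simpa only [ENNReal.rpow_one] using H G hG ω c
  · refine exists_lintegral_tsum_segInt_rpow_le_of_one_lt ?_ hp n k hk
    simpa [Gam, hp.ne'] using hγ

lemma lintegral_eq_mul_lintegral_comp_smul {n : ℕ} (H : En n → ℝ≥0∞) {r : ℝ} (hr : 0 < r) :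
    ∫⁻ h, H h = ENNReal.ofReal (r ^ n) * ∫⁻ ω, H (r • ω) := by
  have e : MeasurableEmbedding fun ω : En n => r • ω :=
    (Homeomorph.smulOfNeZero r hr.ne').measurableEmbedding
  rw [← e.lintegral_map, Measure.map_addHaar_smul _ hr.ne', lintegral_smul_measure, smul_eq_mul,
    ← mul_assoc, ← ENNReal.ofReal_mul (by positivity), finrank_euclideanSpace, Fintype.card_fin,
    abs_of_pos (by positivity), mul_inv_cancel₀ (by positivity), ENNReal.ofReal_one, one_mul]

lemma lintegral_le_tsum_annulus {n : ℕ} (F : En n → ℝ≥0∞) (hF : F 0 = 0) :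
    ∫⁻ h, F h ≤ ∑' j : ℤ, ENNReal.ofReal (((2 : ℝ) ^ j) ^ n) *
      ∫⁻ ω in {ω : En n | 1 ≤ ‖ω‖ ∧ ‖ω‖ < 2}, F ((2 : ℝ) ^ j • ω) := by
  set A : Set (En n) := {ω : En n | 1 ≤ ‖ω‖ ∧ ‖ω‖ < 2} with hA
  have hAm : MeasurableSet A :=
    (measurableSet_le measurable_const measurable_norm).inter
      (measurableSet_lt measurable_norm measurable_const)
  let S : ℤ → Set (En n) := fun j => (fun h => ((2 : ℝ) ^ j)⁻¹ • h) ⁻¹' A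
  have hS : ∀ j, MeasurableSet (S j) := fun j => (measurable_const_smul _) hAm
  have hF' : ∀ h, F h = (⋃ j, S j).indicator F h := fun h => by
    by_cases hh : h = 0
    · subst hh
      rw [hF, indicator_apply_eq_zero.2 fun _ => hF]
    · obtain ⟨j, hj⟩ := exists_mem_Ico_zpow (norm_pos_iff.2 hh) one_lt_two
      refine (indicator_of_mem (mem_iUnion.2 ⟨j, ?_⟩) F).symm
      have h2 : (0 : ℝ) < (2 : ℝ) ^ j := by positivity
      rw [zpow_add_one₀ two_ne_zero] at hj
      simp only [S, hA, mem_preimage, mem_ofPred_eq, norm_smul, norm_inv, Real.norm_of_nonneg h2.le]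
      rw [inv_mul_eq_div, one_le_div h2, div_lt_iff₀ h2, mul_comm]
      exact hj
  calc ∫⁻ h, F h = ∫⁻ h in ⋃ j, S j, F h := by
        rw [← lintegral_indicator (MeasurableSet.iUnion hS), lintegral_congr hF']
    _ ≤ ∑' j, ∫⁻ h in S j, F h := lintegral_iUnion_le _ _
    _ = _ := by
        congr 1
        ext j
        have h2 : (0 : ℝ) < (2 : ℝ) ^ j := by positivity
        rw [← lintegral_indicator (hS j), lintegral_eq_mul_lintegral_comp_smul _ h2,
          ← lintegral_indicator hAm]
        congr 1
        refine lintegral_congr fun ω => ?_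
        simp only [indicator_apply, S, mem_preimage, inv_smul_smul₀ h2.ne']

lemma lintegral_rpow_le_measure_mul {α : Type*} [MeasurableSpace α] (μ : Measure α) {T : α → ℝ≥0∞}
    (hT : Measurable T) {p : ℝ} (hp : 1 ≤ p) :
    (∫⁻ a, T a ∂μ) ^ p ≤ μ univ ^ (p - 1) * ∫⁻ a, T a ^ p ∂μ := by
  have hp0 : 0 < p := by linarith
  have h := eLpNorm'_le_eLpNorm'_mul_rpow_measure_univ (μ := μ) one_pos hp
    hT.aestronglyMeasurable
  simp only [eLpNorm', enorm_eq_self, ENNReal.rpow_one, div_one] at h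
  refine (ENNReal.rpow_le_rpow h hp0.le).trans (le_of_eq ?_)
  rw [ENNReal.mul_rpow_of_nonneg _ _ hp0.le, one_div, ENNReal.rpow_inv_rpow hp0.ne',
    ← ENNReal.rpow_mul, mul_comm]
  congr 2
  field_simp

/-- The set of steps `h` for which the bound by the segment integral of `G` exceeds `λ |h|^{k+γ}`,
in a form normalized by `|h|^k`. -/
def segLarge {n : ℕ} (k : ℕ) (γ lam : ℝ) (G : En n → ℝ≥0∞) (x h : En n) : Prop :=
  h ≠ 0 ∧ ENNReal.ofReal (lam * ‖h‖ ^ γ) < ENNReal.ofReal ((n : ℝ) ^ k) * segInt k G x h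

lemma measurableSet_segLarge {n k : ℕ} {γ lam : ℝ} {G : En n → ℝ≥0∞} (hG : Measurable G) :
    MeasurableSet {z : En n × En n | segLarge k γ lam G z.1 z.2} := by
  have h1 : MeasurableSet {z : En n × En n | z.2 ≠ 0} :=
    (measurable_snd (measurableSet_singleton (0 : En n))).compl
  have h2 : MeasurableSet {z : En n × En n | ENNReal.ofReal (lam * ‖z.2‖ ^ γ) <
      ENNReal.ofReal ((n : ℝ) ^ k) * segInt k G z.1 z.2} :=
    measurableSet_lt (by fun_prop) ((measurable_segInt hG).const_mul _)
  exact h1.inter h2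

lemma ofReal_two_zpow (j : ℤ) : ENNReal.ofReal ((2 : ℝ) ^ j) = (2 : ℝ≥0∞) ^ (j : ℝ) := by
  rw [← Real.rpow_intCast, ← ENNReal.ofReal_rpow_of_pos two_pos]
  simp

lemma min_one_le_rpow {t γ : ℝ} (h1 : 1 ≤ t) (h2 : t ≤ 2) : min 1 (2 ^ γ) ≤ t ^ γ := by
  rcases le_total 0 γ with h | h
  · exact (min_le_left _ _).trans (Real.one_le_rpow h1 h)
  · exact (min_le_right _ _).trans (Real.rpow_le_rpow_of_nonpos (by linarith) h2 h)

lemma rpow_le_max_one {t γ : ℝ} (h1 : 1 ≤ t) (h2 : t ≤ 2) : t ^ γ ≤ max 1 (2 ^ γ) := by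
  rcases le_total 0 γ with h | h
  · exact (Real.rpow_le_rpow (by linarith) h2 h).trans (le_max_right _ _)
  · exact (Real.rpow_le_one_of_one_le_of_nonpos h1 h).trans (le_max_left _ _)

lemma ofReal_pow_mul_ite_segLarge_le {n k : ℕ} (hn : 0 < n) {γ lam : ℝ} (hlam : 0 < lam)
    (G : En n → ℝ≥0∞) (x : En n) {ω : En n} (hω : 1 ≤ ‖ω‖ ∧ ‖ω‖ < 2) (j : ℤ) :
    ENNReal.ofReal (((2 : ℝ) ^ j) ^ n) * (if segLarge k γ lam G x ((2 : ℝ) ^ j • ω)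
        then ENNReal.ofReal (‖(2 : ℝ) ^ j • ω‖ ^ (γ - n)) else 0) ≤
      ENNReal.ofReal (max 1 (2 ^ (γ - n))) *
        if ENNReal.ofReal (lam * min 1 (2 ^ γ) / (n : ℝ) ^ k) * (2 : ℝ≥0∞) ^ (j * γ) <
          segInt k G x ((2 : ℝ) ^ j • ω) then (2 : ℝ≥0∞) ^ (j * γ) else 0 := by
  have h2 : (0 : ℝ) < (2 : ℝ) ^ j := by positivity
  have hω0 : 0 < ‖ω‖ := by linarith [hω.1]
  have hnk : (0 : ℝ) < (n : ℝ) ^ k := by positivity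
  have hnorm : ‖(2 : ℝ) ^ j • ω‖ = (2 : ℝ) ^ j * ‖ω‖ := by
    rw [norm_smul, Real.norm_of_nonneg h2.le]
  have hpow : ∀ a : ℝ, (2 : ℝ≥0∞) ^ (j * a) = ENNReal.ofReal (((2 : ℝ) ^ j) ^ a) := fun a => by
    rw [← ENNReal.ofReal_rpow_of_pos h2, ofReal_two_zpow, ENNReal.rpow_mul]
  split_ifs with h h' h'
  · rw [hpow, ← ENNReal.ofReal_mul (by positivity), ← ENNReal.ofReal_mul (by positivity), hnorm,
      Real.mul_rpow h2.le hω0.le]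
    refine ENNReal.ofReal_le_ofReal ?_
    have h3 : ((2 : ℝ) ^ j) ^ n * ((2 : ℝ) ^ j) ^ (γ - n) = ((2 : ℝ) ^ j) ^ γ := by
      rw [← Real.rpow_natCast, ← Real.rpow_add h2]
      congr 1
      ring
    calc _ = ((2 : ℝ) ^ j) ^ n * ((2 : ℝ) ^ j) ^ (γ - n) * ‖ω‖ ^ (γ - n) := by ring
      _ ≤ ((2 : ℝ) ^ j) ^ γ * max 1 (2 ^ (γ - n)) := by
          rw [h3]
          gcongr
          exact rpow_le_max_one hω.1 hω.2.le
      _ = _ := mul_comm _ _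
  · refine absurd ?_ h'
    have h3 := h.2
    rw [mul_comm (ENNReal.ofReal ((n : ℝ) ^ k)), ← ENNReal.div_lt_iff
      (Or.inl (ENNReal.ofReal_pos.2 hnk).ne') (Or.inl ENNReal.ofReal_ne_top),
      ← ENNReal.ofReal_div_of_pos hnk] at h3
    refine lt_of_le_of_lt ?_ h3
    rw [hpow, ← ENNReal.ofReal_mul (by positivity), hnorm, Real.mul_rpow h2.le hω0.le]
    refine ENNReal.ofReal_le_ofReal ?_
    rw [div_mul_eq_mul_div]
    gcongr ?_ / _
    calc _ = lam * (((2 : ℝ) ^ j) ^ γ * min 1 (2 ^ γ)) := by ring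
      _ ≤ _ := by
        gcongr
        exact min_one_le_rpow hω.1 hω.2.le
  · simp
  · simp

lemma exists_lintegral_segLarge_le {γ p : ℝ} (hp : 1 ≤ p) (hγ : γ ∈ Gam p 1)
    (n k : ℕ) (hn : 0 < n) (hk : 0 < k) :
    ∃ K : ℝ≥0∞, K ≠ ⊤ ∧ ∀ (G : En n → ℝ≥0∞), Measurable G → ∀ lam : ℝ, 0 < lam →
      ENNReal.ofReal lam ^ p * ∫⁻ x, (∫⁻ h, if segLarge k γ lam G x h
        then ENNReal.ofReal (‖h‖ ^ (γ - n)) else 0) ^ p ≤ K * ∫⁻ x, G x ^ p := by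
  have hp0 : 0 < p := by linarith
  obtain ⟨K, hK, H⟩ := exists_lintegral_tsum_segInt_rpow_le hp hγ n k hk
  set A : Set (En n) := {ω : En n | 1 ≤ ‖ω‖ ∧ ‖ω‖ < 2} with hA
  have hAm : MeasurableSet A :=
    (measurableSet_le measurable_const measurable_norm).inter
      (measurableSet_lt measurable_norm measurable_const)
  have hAt : volume A ≠ ⊤ := by
    refine ne_top_of_le_ne_top (measure_ball_lt_top (x := (0 : En n)) (r := 2)).ne
      (measure_mono fun ω hω => ?_)
    simpa using hω.2
  set M : ℝ≥0∞ := ENNReal.ofReal (max 1 (2 ^ (γ - n))) with hM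
  set m : ℝ := min 1 (2 ^ γ) / (n : ℝ) ^ k with hm
  have hm0 : 0 < m := by positivity
  have hmp : ENNReal.ofReal m ^ p ≠ 0 := (ENNReal.rpow_pos (by simpa) ENNReal.ofReal_ne_top).ne'
  have hmt : ENNReal.ofReal m ^ p ≠ ⊤ := ENNReal.rpow_ne_top_of_nonneg hp0.le ENNReal.ofReal_ne_top
  have hMt : M ^ p ≠ ⊤ := ENNReal.rpow_ne_top_of_nonneg hp0.le ENNReal.ofReal_ne_top
  have hAp : volume A ^ (p - 1) ≠ ⊤ := ENNReal.rpow_ne_top_of_nonneg (by linarith) hAt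
  have hMA : M ^ p * volume A ^ (p - 1) ≠ ⊤ := ENNReal.mul_ne_top hMt hAp
  refine ⟨M ^ p * volume A ^ (p - 1) * volume A * K / ENNReal.ofReal m ^ p,
    ENNReal.div_ne_top (ENNReal.mul_ne_top (ENNReal.mul_ne_top hMA hAt) hK) hmp,
    fun G hG lam hlam => ?_⟩
  let c := ENNReal.ofReal (lam * min 1 (2 ^ γ) / (n : ℝ) ^ k)
  have hc : c = ENNReal.ofReal lam * ENNReal.ofReal m := by
    rw [← ENNReal.ofReal_mul hlam.le, hm, ← mul_div_assoc]
  have hc0 : c ≠ 0 := by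
    rw [hc]
    simp [hlam, hm0]
  let T : En n → En n → ℝ≥0∞ := fun x ω => ∑' j : ℤ,
    if c * (2 : ℝ≥0∞) ^ (j * γ) < segInt k G x ((2 : ℝ) ^ j • ω) then (2 : ℝ≥0∞) ^ (j * γ) else 0
  have hterm : ∀ j : ℤ, Measurable fun z : En n × En n =>
      if c * (2 : ℝ≥0∞) ^ (j * γ) < segInt k G z.1 ((2 : ℝ) ^ j • z.2)
        then (2 : ℝ≥0∞) ^ (j * γ) else 0 := fun j =>
    Measurable.ite (measurableSet_lt measurable_const ((measurable_segInt hG).comp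
      (measurable_fst.prodMk (by fun_prop : Measurable fun z : En n × En n =>
        (2 : ℝ) ^ j • z.2)))) measurable_const measurable_const
  have hT : Measurable fun z : En n × En n => T z.1 z.2 := Measurable.tsum hterm
  have hTx : ∀ x, Measurable (T x) := fun x => hT.comp (measurable_const.prodMk measurable_id)
  have hJ : ∀ x, (∫⁻ h, if segLarge k γ lam G x h
      then ENNReal.ofReal (‖h‖ ^ (γ - n)) else 0) ≤ M * ∫⁻ ω in A, T x ω := fun x => by
    refine (lintegral_le_tsum_annulus (fun h => if segLarge k γ lam G x h
      then ENNReal.ofReal (‖h‖ ^ (γ - n)) else 0) (by simp [segLarge])).trans ?_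
    have hsum : ∫⁻ ω in A, T x ω = ∑' j : ℤ, ∫⁻ ω in A,
        if c * (2 : ℝ≥0∞) ^ (j * γ) < segInt k G x ((2 : ℝ) ^ j • ω)
          then (2 : ℝ≥0∞) ^ (j * γ) else 0 :=
      lintegral_tsum fun j => ((hterm j).comp
        (measurable_const.prodMk measurable_id : Measurable fun ω => (x, ω))).aemeasurable
    rw [hsum, ← ENNReal.tsum_mul_left]
    refine ENNReal.tsum_le_tsum fun j => ?_
    rw [← lintegral_const_mul' _ _ ENNReal.ofReal_ne_top,
      ← lintegral_const_mul' _ _ ENNReal.ofReal_ne_top]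
    exact setLIntegral_mono' hAm fun ω hω =>
      ofReal_pow_mul_ite_segLarge_le hn hlam G x hω j
  rw [← ENNReal.mul_div_right_comm, ENNReal.le_div_iff_mul_le (Or.inl hmp) (Or.inl hmt)]
  calc ENNReal.ofReal lam ^ p * (∫⁻ x, (∫⁻ h, if segLarge k γ lam G x h
        then ENNReal.ofReal (‖h‖ ^ (γ - n)) else 0) ^ p) * ENNReal.ofReal m ^ p
      = c ^ p * ∫⁻ x, (∫⁻ h, if segLarge k γ lam G x h
        then ENNReal.ofReal (‖h‖ ^ (γ - n)) else 0) ^ p := by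
        rw [hc, ENNReal.mul_rpow_of_nonneg _ _ hp0.le]
        ring
    _ ≤ c ^ p * ∫⁻ x, M ^ p * volume A ^ (p - 1) * ∫⁻ ω in A, T x ω ^ p := by
        refine mul_le_mul_right (lintegral_mono fun x => ?_) _
        refine (ENNReal.rpow_le_rpow (hJ x) hp0.le).trans ?_
        rw [ENNReal.mul_rpow_of_nonneg _ _ hp0.le, mul_assoc]
        refine mul_le_mul_right ?_ _
        simpa using lintegral_rpow_le_measure_mul (volume.restrict A) (hTx x) hp
    _ = M ^ p * volume A ^ (p - 1) * ∫⁻ ω in A, c ^ p * ∫⁻ x, T x ω ^ p := by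
        have hcp : c ^ p ≠ ⊤ := ENNReal.rpow_ne_top_of_nonneg hp0.le ENNReal.ofReal_ne_top
        rw [lintegral_const_mul' _ _ hMA, lintegral_const_mul' _ _ hcp,
          lintegral_lintegral_swap (hT.pow_const p).aemeasurable]
        ring
    _ ≤ M ^ p * volume A ^ (p - 1) * ∫⁻ ω in A, K * ∫⁻ x, G x ^ p :=
        mul_le_mul_right (lintegral_mono fun ω => H G hG ω c hc0 ENNReal.ofReal_ne_top) _
    _ = _ := by
        rw [setLIntegral_const]
        ring

lemma gradLen_eq {n : ℕ} (m : ℕ) (g : (Fin n → ℕ) → En n → ℝ) (x : En n) :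
    gradLen m g x = Real.sqrt (∑ α ∈ Finset.piAntidiag Finset.univ m, g α x ^ 2) := by
  rw [gradLen, tsum_eq_sum (s := Finset.piAntidiag Finset.univ m)]
  · congr 1
    refine Finset.sum_congr rfl fun α hα => if_pos ?_
    simpa using hα
  · intro α hα
    refine if_neg ?_
    simpa using hα

lemma abs_le_gradLen {n m : ℕ} (g : (Fin n → ℕ) → En n → ℝ) {α : Fin n → ℕ}
    (hα : ∑ i, α i = m) (x : En n) : |g α x| ≤ gradLen m g x := by
  rw [gradLen_eq]
  refine Real.abs_le_sqrt ?_
  exact Finset.single_le_sum (f := fun α => g α x ^ 2) (fun _ _ => sq_nonneg _)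
    (by simpa using hα)

lemma aemeasurable_gradLen {n m : ℕ} {f : En n → ℝ} {g : (Fin n → ℕ) → En n → ℝ}
    (hg : HasWeakDerivs m f g) : AEMeasurable (gradLen m g) := by
  have h1 : gradLen m g =
      fun x => Real.sqrt (∑ α ∈ Finset.piAntidiag Finset.univ m, g α x ^ 2) :=
    funext (gradLen_eq m g)
  rw [h1]
  refine Real.continuous_sqrt.measurable.comp_aemeasurable ?_
  refine Finset.aemeasurable_fun_sum _ fun α hα => ?_
  exact (hg.1 α (by simpa using hα)).aestronglyMeasurable.aemeasurable.pow_const 2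

lemma exists_measurable_ge_ae_eq {α : Type*} [MeasurableSpace α] {μ : Measure α} {u : α → ℝ≥0∞}
    (hu : AEMeasurable u μ) : ∃ G, Measurable G ∧ (∀ x, u x ≤ G x) ∧ G =ᵐ[μ] u := by
  obtain ⟨T, hT, hTm, hT0⟩ := exists_measurable_superset_of_null (ae_iff.1 hu.ae_eq_mk)
  refine ⟨fun x => if x ∈ T then ⊤ else hu.mk u x,
    Measurable.ite hTm measurable_const hu.measurable_mk, fun x => ?_, ?_⟩
  · by_cases hx : x ∈ T
    · simp [hx]
    · simp only [hx, if_false]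
      exact (not_not.1 fun h => hx (hT h)).le
  · filter_upwards [measure_eq_zero_iff_ae_notMem.1 hT0, hu.ae_eq_mk] with x hx hx'
    simp only [hx, if_false, hx']

lemma exists_measurable_gradient_majorant {n k : ℕ} {f : En n → ℝ}
    {g : (Fin n → ℕ) → En n → ℝ} (hg : HasWeakDerivs k f g) {p : ℝ} (hp : 0 < p) :
    ∃ G : En n → ℝ≥0∞, Measurable G ∧ (∀ α, ∑ i, α i = k → ∀ x, ‖g α x‖ₑ ≤ G x) ∧
      ∫⁻ x, G x ^ p = gradLp p k g ^ p := by
  obtain ⟨G, hG, hle, hae⟩ := exists_measurable_ge_ae_eq (aemeasurable_gradLen hg).ennreal_ofReal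
  refine ⟨G, hG, fun α hα x => ?_, ?_⟩
  · refine le_trans ?_ (hle x)
    rw [← ofReal_norm]
    exact ENNReal.ofReal_le_ofReal (abs_le_gradLen g hα x)
  · rw [gradLp, one_div, ENNReal.rpow_inv_rpow hp.ne']
    refine lintegral_congr_ae ?_
    filter_upwards [hae] with x hx
    rw [hx, ENNReal.ofReal_rpow_of_nonneg (show 0 ≤ gradLen k g x from Real.sqrt_nonneg _) hp.le]

lemma measurable_kDiff {n k : ℕ} {f : En n → ℝ} (hf : Measurable f) :
    Measurable fun z : En n × En n => kDiff k f z.2 z.1 := by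
  unfold kDiff
  fun_prop

lemma ae_ae_enorm_kDiff_le {n k : ℕ} (hk : 0 < k) {f : En n → ℝ}
    {g : (Fin n → ℕ) → En n → ℝ} {G : En n → ℝ≥0∞} (hf : LocallyIntegrable f volume)
    (hg : HasWeakDerivs k f g) (hGm : Measurable G)
    (hG : ∀ α, ∑ i, α i = k → ∀ x, ‖g α x‖ₑ ≤ G x) :
    ∀ᵐ x : En n, ∀ᵐ h : En n,
      ‖kDiff k f h x‖ₑ ≤ ENNReal.ofReal ((n * ‖h‖) ^ k) * segInt k G x h := by
  have hfm := hf.aestronglyMeasurable.aemeasurable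
  obtain ⟨N, hN, hNm, hN0⟩ := exists_measurable_superset_of_null (ae_iff.1 hfm.ae_eq_mk)
  let Q : En n → En n → Prop := fun x h => (∀ j ∈ Finset.range (k + 1), x + (j : ℝ) • h ∉ N) ∧
    ‖kDiff k (hfm.mk f) h x‖ₑ ≤ ENNReal.ofReal ((n * ‖h‖) ^ k) * segInt k G x h
  have hcongr : ∀ x h, (∀ j ∈ Finset.range (k + 1), x + (j : ℝ) • h ∉ N) →
      kDiff k f h x = kDiff k (hfm.mk f) h x := fun x h hxh => by
    unfold kDiff
    refine Finset.sum_congr rfl fun j hj => ?_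
    rw [not_not.1 fun hne => hxh j hj (hN hne)]
  have hQm : MeasurableSet {z : En n × En n | Q z.1 z.2} := by
    refine MeasurableSet.inter ?_ ?_
    · have : {z : En n × En n | ∀ j ∈ Finset.range (k + 1), z.1 + (j : ℝ) • z.2 ∉ N} =
          ⋂ j ∈ Finset.range (k + 1), (fun z : En n × En n => z.1 + (j : ℝ) • z.2) ⁻¹' Nᶜ := by
        ext z
        simp
      change MeasurableSet {z : En n × En n | ∀ j ∈ Finset.range (k + 1), z.1 + (j : ℝ) • z.2 ∉ N}
      rw [this]
      exact Finset.measurableSet_biInter _ fun j _ =>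
        (by fun_prop : Measurable fun z : En n × En n => z.1 + (j : ℝ) • z.2) hNm.compl
    · exact measurableSet_le (measurable_kDiff hfm.measurable_mk).enorm
        ((by fun_prop : Measurable fun z : En n × En n =>
          ENNReal.ofReal ((n * ‖z.2‖) ^ k)).mul (measurable_segInt hGm))
  have hQ : ∀ᵐ x : En n, ∀ᵐ h : En n, Q x h := by
    rw [Measure.ae_ae_comm hQm]
    refine Filter.Eventually.of_forall fun h => ?_
    have h1 : ∀ᵐ x : En n, ∀ j ∈ Finset.range (k + 1), x + (j : ℝ) • h ∉ N := by
      refine (Finset.eventually_all _).2 fun j _ => ?_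
      exact (measurePreserving_add_right volume ((j : ℝ) • h)).quasiMeasurePreserving.ae
        (measure_eq_zero_iff_ae_notMem.1 hN0)
    filter_upwards [h1, enorm_kDiff_le_lintegral hk hf hg hG h] with x hx hx'
    refine ⟨hx, ?_⟩
    rw [← hcongr x h hx]
    exact hx'
  filter_upwards [hQ] with x hx
  filter_upwards [hx] with h hh
  rw [hcongr x h hh.1]
  exact hh.2

lemma memE_or_segLarge {n k : ℕ} {f : En n → ℝ} {G : En n → ℝ≥0∞} {b b₀ γ η lam₀ lam₁ : ℝ}
    (hη : η ∈ Ioo (0 : ℝ) 1) (hlam₀ : 0 < lam₀) (hlam₁ : 0 < lam₁)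
    (hb : b = (1 - η) * b₀ + η * γ) {x h : En n}
    (hbound : ‖kDiff k f h x‖ₑ ≤ ENNReal.ofReal ((n * ‖h‖) ^ k) * segInt k G x h)
    (hE : memE k k (lam₀ ^ (1 - η) * lam₁ ^ η) b f x h) :
    memE k k lam₀ b₀ f x h ∨ segLarge k γ lam₁ G x h := by
  obtain ⟨hh, hE⟩ := hE
  have hh0 : 0 < ‖h‖ := norm_pos_iff.2 hh
  by_contra! hcon
  have h0 : |kDiff k f h x| ≤ lam₀ * ‖h‖ ^ ((k : ℝ) + b₀) := not_lt.1 fun hlt => hcon.1 ⟨hh, hlt⟩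
  have h1 : |kDiff k f h x| ≤ lam₁ * ‖h‖ ^ ((k : ℝ) + γ) := by
    have h2 : ENNReal.ofReal ((n : ℝ) ^ k) * segInt k G x h ≤ ENNReal.ofReal (lam₁ * ‖h‖ ^ γ) :=
      not_lt.1 fun hlt => hcon.2 ⟨hh, hlt⟩
    rw [← Real.norm_eq_abs, ← ENNReal.ofReal_le_ofReal_iff (by positivity), ofReal_norm]
    refine hbound.trans ?_
    rw [mul_pow, mul_comm ((n : ℝ) ^ k), ENNReal.ofReal_mul (by positivity), mul_assoc]
    refine (mul_le_mul_right h2 _).trans (le_of_eq ?_)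
    rw [← ENNReal.ofReal_mul (by positivity), Real.rpow_add hh0, Real.rpow_natCast]
    congr 1
    ring
  refine absurd hE (not_lt.2 ?_)
  have hη1 : 0 < 1 - η := by linarith [hη.2]
  calc |kDiff k f h x| = |kDiff k f h x| ^ (1 - η) * |kDiff k f h x| ^ η := by
        rw [← Real.rpow_add_of_nonneg (abs_nonneg _) hη1.le hη.1.le, sub_add_cancel,
          Real.rpow_one]
    _ ≤ (lam₀ * ‖h‖ ^ ((k : ℝ) + b₀)) ^ (1 - η) * (lam₁ * ‖h‖ ^ ((k : ℝ) + γ)) ^ η :=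
        mul_le_mul (Real.rpow_le_rpow (abs_nonneg _) h0 hη1.le)
          (Real.rpow_le_rpow (abs_nonneg _) h1 hη.1.le) (by positivity) (by positivity)
    _ = lam₀ ^ (1 - η) * lam₁ ^ η * ‖h‖ ^ ((k : ℝ) + b) := by
        rw [Real.mul_rpow hlam₀.le (by positivity), Real.mul_rpow hlam₁.le (by positivity),
          ← Real.rpow_mul hh0.le, ← Real.rpow_mul hh0.le, mul_mul_mul_comm,
          ← Real.rpow_add hh0, hb]
        congr 2
        ring

lemma lintegral_innerInt_rpow_le {n k : ℕ} {f : En n → ℝ} {G : En n → ℝ≥0∞}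
    (hG : Measurable G) {p b b₀ γ η lam₀ lam₁ : ℝ} (hp : 1 ≤ p)
    (hη : η ∈ Ioo (0 : ℝ) 1) (hlam₀ : 0 < lam₀) (hlam₁ : 0 < lam₁)
    (hb : b = (1 - η) * b₀ + η * γ)
    (hbound : ∀ᵐ x : En n, ∀ᵐ h : En n,
      ‖kDiff k f h x‖ₑ ≤ ENNReal.ofReal ((n * ‖h‖) ^ k) * segInt k G x h) :
    ∫⁻ x, innerInt k k (lam₀ ^ (1 - η) * lam₁ ^ η) b γ f x ^ p ≤
      2 ^ (p - 1) * ((∫⁻ x, innerInt k k lam₀ b₀ γ f x ^ p) +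
        ∫⁻ x, (∫⁻ h, if segLarge k γ lam₁ G x h
          then ENNReal.ofReal (‖h‖ ^ (γ - n)) else 0) ^ p) := by
  have hm : Measurable fun z : En n × En n => if segLarge k γ lam₁ G z.1 z.2
      then ENNReal.ofReal (‖z.2‖ ^ (γ - n)) else 0 :=
    Measurable.ite (measurableSet_segLarge hG) (by fun_prop) measurable_const
  have hJ : Measurable fun x : En n => ∫⁻ h, if segLarge k γ lam₁ G x h
      then ENNReal.ofReal (‖h‖ ^ (γ - n)) else 0 := hm.lintegral_prod_right'
  have h2 : (2 : ℝ≥0∞) ^ (p - 1) ≠ ⊤ :=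
    ENNReal.rpow_ne_top_of_nonneg (by linarith) ENNReal.ofNat_ne_top
  rw [← lintegral_add_right _ (hJ.pow_const p), ← lintegral_const_mul' _ _ h2]
  refine lintegral_mono_ae ?_
  filter_upwards [hbound] with x hx
  refine le_trans (ENNReal.rpow_le_rpow ?_ (by linarith))
    (ENNReal.rpow_add_le_mul_rpow_add_rpow _ _ hp)
  unfold innerInt
  have hmx : Measurable fun h : En n => if segLarge k γ lam₁ G x h
      then ENNReal.ofReal (‖h‖ ^ (γ - n)) else 0 :=
    hm.comp (measurable_const.prodMk measurable_id : Measurable fun h => (x, h))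
  rw [← lintegral_add_right _ hmx]
  refine lintegral_mono_ae ?_
  filter_upwards [hx] with h hh
  by_cases hE : memE k k (lam₀ ^ (1 - η) * lam₁ ^ η) b f x h
  · rw [if_pos hE]
    rcases memE_or_segLarge hη hlam₀ hlam₁ hb hh hE with h3 | h3
    · rw [if_pos h3]
      exact le_self_add
    · rw [if_pos h3]
      exact le_add_self
  · rw [if_neg hE]
    exact zero_le

lemma ofReal_mul_rpow_le_of_forall_split {A B : ℝ → ℝ≥0∞} {I K : ℝ≥0∞}
    {p q q₀ η lam x y : ℝ} (hp : 1 ≤ p) (hq0 : 0 < q) (hq₀ : 0 < q₀)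
    (hq : 1 / q = (1 - η) / q₀ + η) (hlam : 0 < lam) (hx : 0 < x) (hy : 0 < y)
    (hI : ∀ lam₀ lam₁ : ℝ, 0 < lam₀ → 0 < lam₁ → lam₀ ^ (1 - η) * lam₁ ^ η = lam →
      I ≤ 2 ^ (p - 1) * (A lam₀ + B lam₁))
    (hA : ∀ lam₀ : ℝ, 0 < lam₀ →
      ENNReal.ofReal lam₀ * A lam₀ ^ (1 / (p * q₀)) ≤ ENNReal.ofReal x)
    (hB : ∀ lam₁ : ℝ, 0 < lam₁ →
      ENNReal.ofReal lam₁ ^ p * B lam₁ ≤ K * ENNReal.ofReal y ^ p) :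
    ENNReal.ofReal lam * I ^ (1 / (p * q)) ≤
      (2 ^ (p - 1) * (1 + K)) ^ (1 / (p * q)) *
        (ENNReal.ofReal x ^ (1 - η) * ENNReal.ofReal y ^ η) := by
  have hp0 : 0 < p := by linarith
  set V : ℝ := (x ^ (1 - η) * y ^ η / lam) ^ q with hV
  have hV0 : 0 < V := by positivity
  have hVq : V ^ (1 / q) = x ^ (1 - η) * y ^ η / lam := by
    rw [hV, ← Real.rpow_mul (by positivity), mul_one_div_cancel hq0.ne', Real.rpow_one]
  set l₀ : ℝ := x / V ^ (1 / q₀) with hl₀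
  set l₁ : ℝ := y / V with hl₁
  have hl₀0 : 0 < l₀ := by positivity
  have hl₁0 : 0 < l₁ := by positivity
  have hprod : l₀ ^ (1 - η) * l₁ ^ η = lam := by
    rw [hl₀, hl₁, Real.div_rpow hx.le (by positivity), Real.div_rpow hy.le hV0.le,
      div_mul_div_comm, ← Real.rpow_mul hV0.le, ← Real.rpow_add hV0]
    have : 1 / q₀ * (1 - η) + η = 1 / q := by rw [hq]; ring
    rw [this, hVq]
    field_simp
  have hA' : A l₀ ≤ ENNReal.ofReal V ^ p := by
    have h1 := hA l₀ hl₀0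
    have h2 : ENNReal.ofReal x =
        ENNReal.ofReal l₀ * (ENNReal.ofReal V ^ p) ^ (1 / (p * q₀)) := by
      rw [← ENNReal.rpow_mul, ENNReal.ofReal_rpow_of_pos hV0, ← ENNReal.ofReal_mul hl₀0.le, hl₀]
      have : p * (1 / (p * q₀)) = 1 / q₀ := by field_simp
      rw [this, div_mul_cancel₀ _ (by positivity)]
    rw [h2, ENNReal.mul_le_mul_iff_right (by simpa using hl₀0) ENNReal.ofReal_ne_top] at h1
    exact (ENNReal.rpow_le_rpow_iff (by positivity)).1 h1
  have hB' : B l₁ ≤ K * ENNReal.ofReal V ^ p := by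
    have h1 := hB l₁ hl₁0
    have h2 : ENNReal.ofReal y = ENNReal.ofReal l₁ * ENNReal.ofReal V := by
      rw [← ENNReal.ofReal_mul hl₁0.le, hl₁, div_mul_cancel₀ _ hV0.ne']
    rw [h2, ENNReal.mul_rpow_of_nonneg _ _ hp0.le, mul_left_comm,
      ENNReal.mul_le_mul_iff_right
        (ENNReal.rpow_pos (by simpa using hl₁0) ENNReal.ofReal_ne_top).ne'
        (ENNReal.rpow_ne_top_of_nonneg hp0.le ENNReal.ofReal_ne_top)] at h1
    exact h1
  have hI' : I ≤ 2 ^ (p - 1) * (1 + K) * ENNReal.ofReal V ^ p := by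
    refine (hI l₀ l₁ hl₀0 hl₁0 hprod).trans ?_
    rw [mul_assoc, add_mul, one_mul]
    gcongr
  have hpq : 0 ≤ 1 / (p * q) := by positivity
  calc ENNReal.ofReal lam * I ^ (1 / (p * q))
      ≤ ENNReal.ofReal lam * (2 ^ (p - 1) * (1 + K) * ENNReal.ofReal V ^ p) ^ (1 / (p * q)) := by
        gcongr
    _ = (2 ^ (p - 1) * (1 + K)) ^ (1 / (p * q)) * ENNReal.ofReal (lam * V ^ (1 / q)) := by
        rw [ENNReal.mul_rpow_of_nonneg _ _ hpq, ← ENNReal.rpow_mul _ p,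
          ENNReal.ofReal_mul hlam.le, ← ENNReal.ofReal_rpow_of_pos hV0]
        have : p * (1 / (p * q)) = 1 / q := by field_simp
        rw [this]
        ring
    _ = _ := by
        rw [hVq, mul_div_cancel₀ _ hlam.ne', ENNReal.ofReal_mul (by positivity),
          ENNReal.ofReal_rpow_of_pos hx, ENNReal.ofReal_rpow_of_pos hy]

lemma innerInt_ae_eq_zero {n k : ℕ} {f : En n → ℝ} {G : En n → ℝ≥0∞} (hG : Measurable G)
    (hG0 : ∫⁻ x, G x = 0) {b γ lam : ℝ} (hlam : 0 < lam)
    (hbound : ∀ᵐ x : En n, ∀ᵐ h : En n,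
      ‖kDiff k f h x‖ₑ ≤ ENNReal.ofReal ((n * ‖h‖) ^ k) * segInt k G x h) :
    ∀ᵐ x, innerInt k k lam b γ f x = 0 := by
  have h0 : ∀ᵐ x : En n, ∀ᵐ h : En n, segInt k G x h = 0 := by
    rw [Measure.ae_ae_comm (p := fun x h => segInt k G x h = 0)
      (measurable_segInt hG (measurableSet_singleton 0))]
    refine Filter.Eventually.of_forall fun h => ?_
    refine (lintegral_eq_zero_iff (measurable_segInt_left hG h)).1 ?_
    rw [lintegral_segInt hG, hG0, mul_zero]
  filter_upwards [h0, hbound] with x hx hx'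
  unfold innerInt
  refine (lintegral_congr_ae ?_).trans lintegral_zero
  filter_upwards [hx, hx'] with h hh hh'
  refine if_neg fun hE => ?_
  rw [hh, mul_zero, nonpos_iff_eq_zero, enorm_eq_zero] at hh'
  have := hE.2
  rw [hh', abs_zero] at this
  exact absurd this (not_lt.2 (by positivity))

/-- interpolation-type inequality between two BSVY weak quantities. -/
theorem statement17 (n k : ℕ) (hn : 0 < n) (hk : 0 < k) (p γ η s₀ s q q₀ : ℝ)
    (hp : 1 ≤ p) (hγ : γ ∈ Gam p 1) (hη : η ∈ Ioo (0 : ℝ) 1)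
    (hs₀ : 0 ≤ s₀) (hs₀s : s₀ < s) (hs1 : s < 1) (h1q : 1 < q) (hqq₀ : q < q₀)
    (hs : s = (1 - η) * s₀ + η) (hq : 1 / q = (1 - η) / q₀ + η) :
    ∃ C : ℝ, 0 < C ∧
      ∀ (f : En n → ℝ) (g : (Fin n → ℕ) → En n → ℝ),
        LocallyIntegrable f volume → HasWeakDerivs k f g → gradLp p k g < ⊤ →
        (⨆ lam ∈ Ioi (0 : ℝ), ENNReal.ofReal lam *
            (∫⁻ x, (innerInt k k lam (γ / q + s - 1) γ f x) ^ p) ^ (1 / (p * q)))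
          ≤ ENNReal.ofReal C *
              (⨆ lam ∈ Ioi (0 : ℝ), ENNReal.ofReal lam *
                (∫⁻ x, (innerInt k k lam (γ / q₀ + s₀ - 1) γ f x) ^ p)
                  ^ (1 / (p * q₀))) ^ (1 - η)
              * gradLp p k g ^ η := by
  obtain ⟨K, hK, HK⟩ := exists_lintegral_segLarge_le hp hγ n k hn hk
  have hp0 : 0 < p := by linarith
  have hq0 : 0 < q := by linarith
  have hq₀0 : 0 < q₀ := by linarith
  have hη1 : 0 < 1 - η := by linarith [hη.2]
  have hpq : 0 < 1 / (p * q) := by positivity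
  set C₀ : ℝ≥0∞ := (2 ^ (p - 1) * (1 + K)) ^ (1 / (p * q)) with hC₀
  have hC₀t : C₀ ≠ ⊤ := by
    refine ENNReal.rpow_ne_top_of_nonneg hpq.le (ENNReal.mul_ne_top ?_ (by finiteness))
    exact ENNReal.rpow_ne_top_of_nonneg (by linarith) ENNReal.ofNat_ne_top
  refine ⟨C₀.toReal + 1, by positivity, fun f g hf hg hY => ?_⟩
  obtain ⟨G, hGm, hG, hGp⟩ := exists_measurable_gradient_majorant hg hp0
  have hbound := ae_ae_enorm_kDiff_le hk hf hg hGm hG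
  set X := ⨆ lam ∈ Ioi (0 : ℝ), ENNReal.ofReal lam *
    (∫⁻ x, (innerInt k k lam (γ / q₀ + s₀ - 1) γ f x) ^ p) ^ (1 / (p * q₀)) with hX
  refine iSup₂_le fun lam hlam => ?_
  replace hlam : 0 < lam := hlam
  have hb : γ / q + s - 1 = (1 - η) * (γ / q₀ + s₀ - 1) + η * γ := by
    have h1 : γ / q = γ * ((1 - η) / q₀ + η) := by rw [← hq]; ring
    rw [h1, hs]
    ring
  rcases eq_or_ne (gradLp p k g) 0 with hY0 | hY0
  · rw [hY0, ENNReal.zero_rpow_of_pos hp0] at hGp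
    have hG0 : ∫⁻ x, G x = 0 := by
      rw [lintegral_eq_zero_iff hGm]
      filter_upwards [(lintegral_eq_zero_iff (hGm.pow_const p)).1 hGp] with x hx
      exact (ENNReal.rpow_eq_zero_iff_of_pos hp0).1 hx
    have h0 : ∫⁻ x, (innerInt k k lam (γ / q + s - 1) γ f x) ^ p = 0 := by
      refine (lintegral_congr_ae ?_).trans lintegral_zero
      filter_upwards [innerInt_ae_eq_zero hGm hG0 hlam hbound] with x hx
      rw [hx, ENNReal.zero_rpow_of_pos hp0]
    rw [h0, ENNReal.zero_rpow_of_pos hpq, mul_zero]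
    exact zero_le
  have hCle : C₀ ≤ ENNReal.ofReal (C₀.toReal + 1) :=
    (ENNReal.ofReal_toReal hC₀t).symm.le.trans (ENNReal.ofReal_le_ofReal (by linarith))
  rcases eq_or_ne X ⊤ with hXt | hXt
  · rw [hXt, ENNReal.top_rpow_of_pos hη1, ENNReal.mul_top (by simp; positivity),
      ENNReal.top_mul (ENNReal.rpow_pos (pos_iff_ne_zero.2 hY0) hY.ne).ne']
    exact le_top
  have hYη : gradLp p k g ^ η ≠ ⊤ := ENNReal.rpow_ne_top_of_nonneg hη.1.le hY.ne
  have key : ∀ a, X < a → a < ⊤ → ENNReal.ofReal lam *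
      (∫⁻ x, (innerInt k k lam (γ / q + s - 1) γ f x) ^ p) ^ (1 / (p * q)) ≤
      C₀ * (a ^ (1 - η) * gradLp p k g ^ η) := by
    intro a ha hat
    have hax : 0 < a.toReal := ENNReal.toReal_pos (zero_le.trans_lt ha).ne' hat.ne
    have hyy : 0 < (gradLp p k g).toReal := ENNReal.toReal_pos hY0 hY.ne
    rw [← ENNReal.ofReal_toReal hat.ne, ← ENNReal.ofReal_toReal hY.ne]
    refine ofReal_mul_rpow_le_of_forall_split
      (A := fun l => ∫⁻ x, (innerInt k k l (γ / q₀ + s₀ - 1) γ f x) ^ p)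
      (B := fun l => ∫⁻ x, (∫⁻ h, if segLarge k γ l G x h
        then ENNReal.ofReal (‖h‖ ^ (γ - n)) else 0) ^ p)
      hp hq0 hq₀0 hq hlam hax hyy ?_ ?_ ?_
    · rintro l₀ l₁ hl₀ hl₁ rfl
      exact lintegral_innerInt_rpow_le hGm hp hη hl₀ hl₁ hb hbound
    · intro l₀ hl₀
      rw [ENNReal.ofReal_toReal hat.ne]
      refine le_trans ?_ ha.le
      exact le_iSup₂ (f := fun (lam : ℝ) (_ : lam ∈ Ioi (0 : ℝ)) => ENNReal.ofReal lam *
        (∫⁻ x, (innerInt k k lam (γ / q₀ + s₀ - 1) γ f x) ^ p) ^ (1 / (p * q₀))) l₀ hl₀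
    · intro l₁ hl₁
      rw [ENNReal.ofReal_toReal hY.ne, ← hGp]
      exact HK G hGm l₁ hl₁
  have hlim : Tendsto (fun a : ℝ≥0∞ => C₀ * (a ^ (1 - η) * gradLp p k g ^ η)) (𝓝[>] X)
      (𝓝 (C₀ * (X ^ (1 - η) * gradLp p k g ^ η))) := by
    refine ENNReal.Tendsto.const_mul (ENNReal.Tendsto.mul_const ?_ (Or.inr hYη)) (Or.inr hC₀t)
    exact (ENNReal.continuous_rpow_const.tendsto X).mono_left nhdsWithin_le_nhds
  have : (𝓝[>] X).NeBot := nhdsGT_neBot_of_exists_gt ⟨⊤, lt_top_iff_ne_top.2 hXt⟩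
  have hfin := ge_of_tendsto hlim (by
    filter_upwards [Ioo_mem_nhdsGT (lt_top_iff_ne_top.2 hXt)] with a ha using key a ha.1 ha.2)
  refine hfin.trans ?_
  rw [mul_assoc]
  gcongr
end

section
/- Let n, k ∈ ℕ, p ∈ [1,∞), q ∈ (0,∞), and γ ∈ ℝ∖{0}, and assume either n = 1 and γ ∈ (−∞, −q/p) ∪ (0,∞), or n ≥ 2 and n(1/p − 1/q) < k. Then for every infinitely differentiable f : ℝ^n → ℝ whose k-th derivative is compactly supported, limsup_{λ→L_γ} λ (∫_{ℝ^n}[∫_{ℝ^n} 1_{E_{λ,γ/q,k}[f]}(x,h) |h|^{γ−n} dh]^{p/q} dx)^{1/p} ≤ |γ|^{−1/q} (∫_{ℝ^n}[∫_{S^{n−1}} |D_ξ^k f(x)|^q dH^{n−1}(ξ)]^{p/q} dx)^{1/p}. -/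
open MeasureTheory Filter Set
open scoped ENNReal NNReal BigOperators Topology Classical

noncomputable section

open MeasureTheory Filter Set
open scoped ENNReal Topology

variable {n : ℕ}

/-- `D_ξ^k f(x)`: the `k`-th derivative at `t = 0` of `t ↦ f(x + tξ)`. -/
def dirD (k : ℕ) (f : En n → ℝ) (x ξ : En n) : ℝ :=
  iteratedDeriv k (fun t : ℝ => f (x + t • ξ)) 0

/-- `∫_{S^{n-1}} |D_ξ^k f(x)|^q dH^{n-1}(ξ)`. -/
def sphIntD (k : ℕ) (q : ℝ) (f : En n → ℝ) (x : En n) : ℝ≥0∞ :=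
  ∫⁻ ξ in Metric.sphere (0 : En n) 1, ENNReal.ofReal (|dirD k f x ξ| ^ q)
    ∂(μH[(n : ℝ) - 1])

/-- The filter describing `λ → L_γ`: `λ → ∞` if `γ > 0` and `λ → 0^+` if `γ < 0`. -/
def Lfil (γ : ℝ) : Filter ℝ := if 0 < γ then atTop else 𝓝[>] (0 : ℝ)

end

open MeasureTheory Filter Set
open scoped ENNReal

theorem exists_fwdDiff_iter_eq_iteratedDeriv (k : ℕ) :
    ∀ (φ : ℝ → ℝ), ContDiff ℝ (⊤ : ℕ∞) φ → ∀ t : ℝ,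
      ∃ c ∈ Icc t (t + k), (fwdDiff (1 : ℝ))^[k] φ t = iteratedDeriv k φ c := by
  induction k with
  | zero => intro φ _ t; exact ⟨t, by simp, by simp⟩
  | succ k ih =>
    intro φ hφ t
    have h1 : ContDiff ℝ (⊤ : ℕ∞) (fun s : ℝ => φ (s + 1)) := hφ.comp (contDiff_id.add contDiff_const)
    have hψ : fwdDiff (1 : ℝ) φ = (fun s => φ (s + 1)) - φ := by ext s; simp [fwdDiff]
    obtain ⟨c, hc, h⟩ := ih (fwdDiff (1 : ℝ) φ) (by rw [hψ]; exact h1.sub hφ) t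
    have hle : (k : WithTop ℕ∞) ≤ ((⊤ : ℕ∞) : WithTop ℕ∞) := by exact_mod_cast le_top
    have hdiff : Differentiable ℝ (iteratedDeriv k φ) :=
      hφ.differentiable_iteratedDeriv k (by exact_mod_cast WithTop.coe_lt_top k)
    obtain ⟨d, hd, h2⟩ := exists_deriv_eq_slope (iteratedDeriv k φ) (lt_add_one c)
      hdiff.continuous.continuousOn hdiff.differentiableOn
    refine ⟨d, ⟨hc.1.trans hd.1.le, ?_⟩, ?_⟩
    · push_cast; linarith [hc.2, hd.2]
    · rw [Function.iterate_succ_apply, h, iteratedDeriv_succ, h2, hψ,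
        iteratedDeriv_sub (h1.contDiffAt.of_le hle) (hφ.contDiffAt.of_le hle),
        iteratedDeriv_comp_add_const]
      simp

theorem kDiff_eq_fwdDiff_iter {n : ℕ} (k : ℕ) (f : En n → ℝ) (h x : En n) :
    kDiff k f h x = (fwdDiff (1 : ℝ))^[k] (fun t : ℝ => f (x + t • h)) 0 := by
  rw [fwdDiff_iter_eq_sum_shift, kDiff]
  refine Finset.sum_congr rfl fun j _ => ?_
  simp [zsmul_eq_mul]

theorem iteratedDeriv_comp_line {n : ℕ} (k : ℕ) {f : En n → ℝ} (hf : ContDiff ℝ (⊤ : ℕ∞) f)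
    (x h : En n) (t : ℝ) :
    iteratedDeriv k (fun t : ℝ => f (x + t • h)) t
      = iteratedFDeriv ℝ k f (x + t • h) (fun _ => h) := by
  have hg : ContDiff ℝ (⊤ : ℕ∞) (fun z => f (x + z)) := hf.comp (contDiff_const.add contDiff_id)
  have := (ContinuousLinearMap.toSpanSingleton ℝ h).iteratedFDeriv_comp_right hg t
    (i := k) (by exact_mod_cast le_top)
  rw [iteratedDeriv_eq_iteratedFDeriv]
  have e : (fun t : ℝ => f (x + t • h))
      = (fun z => f (x + z)) ∘ (ContinuousLinearMap.toSpanSingleton ℝ h) := by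
    ext; simp
  rw [e, this, iteratedFDeriv_comp_add_left]
  simp

theorem exists_kDiff_eq {n : ℕ} (k : ℕ) {f : En n → ℝ} (hf : ContDiff ℝ (⊤ : ℕ∞) f) (h x : En n) :
    ∃ c ∈ Icc (0 : ℝ) k, kDiff k f h x = iteratedFDeriv ℝ k f (x + c • h) (fun _ => h) := by
  have hl : ContDiff ℝ (⊤ : ℕ∞) (fun t : ℝ => f (x + t • h)) :=
    hf.comp (contDiff_const.add (contDiff_id.smul contDiff_const))
  obtain ⟨c, hc, e⟩ := exists_fwdDiff_iter_eq_iteratedDeriv k _ hl 0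
  exact ⟨c, by simpa using hc, by rw [kDiff_eq_fwdDiff_iter, e, iteratedDeriv_comp_line k hf]⟩

theorem dirD_eq {n : ℕ} (k : ℕ) {f : En n → ℝ} (hf : ContDiff ℝ (⊤ : ℕ∞) f) (x ξ : En n) :
    dirD k f x ξ = iteratedFDeriv ℝ k f x (fun _ => ξ) := by
  simp [dirD, iteratedDeriv_comp_line k hf]

theorem continuous_iteratedFDeriv_diag {n : ℕ} (k : ℕ) {f : En n → ℝ}
    (hf : ContDiff ℝ (⊤ : ℕ∞) f) :
    Continuous (fun z : En n × En n => iteratedFDeriv ℝ k f z.1 (fun _ => z.2)) := by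
  have h1 := hf.continuous_iteratedFDeriv (m := k) (by exact_mod_cast le_top)
  exact (h1.comp continuous_fst).eval (continuous_pi fun _ => continuous_snd)

theorem kDiff_sub {n : ℕ} (k : ℕ) (f g : En n → ℝ) (h x : En n) :
    kDiff k (fun y => f y - g y) h x = kDiff k f h x - kDiff k g h x := by
  simp [kDiff, mul_sub, Finset.sum_sub_distrib]

theorem continuous_kDiff {n : ℕ} (k : ℕ) {f : En n → ℝ} (hf : Continuous f) :
    Continuous (fun z : En n × En n => kDiff k f z.2 z.1) := by
  unfold kDiff
  fun_prop

theorem tendsto_kDiff_div {n : ℕ} (k : ℕ) {f : En n → ℝ} (hf : ContDiff ℝ (⊤ : ℕ∞) f)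
    (x u : En n) :
    Tendsto (fun τ : ℝ => kDiff k f (τ • u) x / τ ^ k) (𝓝[>] 0)
      (𝓝 (iteratedFDeriv ℝ k f x (fun _ => u))) := by
  choose c hc e using fun τ : ℝ => exists_kDiff_eq k hf (τ • u) x
  have h0 : Tendsto (fun τ : ℝ => x + c τ • τ • u) (𝓝[>] 0) (𝓝 x) := by
    have : Tendsto (fun τ : ℝ => c τ * τ) (𝓝[>] 0) (𝓝 0) := by
      have h1 : Tendsto (fun τ : ℝ => (k : ℝ) * τ) (𝓝[>] 0) (𝓝 0) := by
        have : Tendsto (fun τ : ℝ => (k : ℝ) * τ) (𝓝 0) (𝓝 ((k : ℝ) * 0)) :=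
          (continuous_const.mul continuous_id).tendsto 0
        rw [mul_zero] at this
        exact this.mono_left nhdsWithin_le_nhds
      refine squeeze_zero' ?_ ?_ h1
      · filter_upwards [self_mem_nhdsWithin] with τ hτ
        exact mul_nonneg (hc τ).1 (le_of_lt hτ)
      · filter_upwards [self_mem_nhdsWithin] with τ hτ
        exact mul_le_mul_of_nonneg_right (hc τ).2 (le_of_lt hτ)
    have h2 := (tendsto_const_nhds (x := x)).add (this.smul_const u)
    simpa [smul_smul] using h2
  have h3 := ((continuous_iteratedFDeriv_diag k hf).tendsto (x, u)).comp
    (h0.prodMk_nhds (tendsto_const_nhds (x := u)))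
  refine h3.congr' ?_
  filter_upwards [self_mem_nhdsWithin] with τ hτ
  have hτ0 : τ ≠ 0 := ne_of_gt hτ
  have := (iteratedFDeriv ℝ k f (x + c τ • τ • u)).map_smul_univ (fun _ => τ) (fun _ => u)
  simp only [Finset.prod_const, Finset.card_univ, Fintype.card_fin] at this
  rw [e τ, this]
  simp [hτ0]

theorem abs_kDiff_le {n : ℕ} (k : ℕ) {f : En n → ℝ} (hf : ContDiff ℝ (⊤ : ℕ∞) f) {M : ℝ}
    (hM : ∀ y, ‖iteratedFDeriv ℝ k f y‖ ≤ M) (h x : En n) :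
    |kDiff k f h x| ≤ M * ‖h‖ ^ k := by
  obtain ⟨c, -, e⟩ := exists_kDiff_eq k hf h x
  rw [e, ← Real.norm_eq_abs]
  refine ((iteratedFDeriv ℝ k f (x + c • h)).le_opNorm _).trans ?_
  simp only [Finset.prod_const, Finset.card_univ, Fintype.card_fin]
  gcongr
  exact hM _

theorem kDiff_eq_zero_of_far {n : ℕ} (k : ℕ) {f : En n → ℝ} (hf : ContDiff ℝ (⊤ : ℕ∞) f) {R : ℝ}
    (hR : ∀ y, R < ‖y‖ → iteratedFDeriv ℝ k f y = 0) {h x : En n} (hx : R + k * ‖h‖ < ‖x‖) :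
    kDiff k f h x = 0 := by
  obtain ⟨c, hc, e⟩ := exists_kDiff_eq k hf h x
  rw [e, hR]
  · simp
  · have h1 : ‖x‖ ≤ ‖x + c • h‖ + ‖c • h‖ := by
      simpa using norm_sub_le (x + c • h) (c • h)
    have h2 : ‖c • h‖ ≤ k * ‖h‖ := by
      rw [norm_smul, Real.norm_of_nonneg hc.1]
      exact mul_le_mul_of_nonneg_right hc.2 (norm_nonneg _)
    linarith

/-- The Taylor polynomial of `f` at `x₀` of degree less than `k`. -/
noncomputable def taylorPoly {n : ℕ} (k : ℕ) (f : En n → ℝ) (x₀ : En n) : En n → ℝ := fun y =>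
  ∑ j ∈ Finset.range k, (j.factorial : ℝ)⁻¹ * iteratedFDeriv ℝ j f x₀ (fun _ => y - x₀)

theorem contDiff_taylorPoly {n : ℕ} (k : ℕ) (f : En n → ℝ) (x₀ : En n) (m : WithTop ℕ∞) :
    ContDiff ℝ m (taylorPoly k f x₀) := by
  unfold taylorPoly
  refine ContDiff.sum fun j _ => contDiff_const.mul ?_
  exact (iteratedFDeriv ℝ j f x₀).contDiff.comp
    (contDiff_pi.2 fun _ => contDiff_id.sub contDiff_const)

theorem eq_taylorPoly_of_ball {n k : ℕ} (hk : 0 < k) {f : En n → ℝ}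
    (hf : ContDiff ℝ (⊤ : ℕ∞) f) {x₀ : En n} {r : ℝ}
    (h0 : ∀ y ∈ Metric.ball x₀ r, iteratedFDeriv ℝ k f y = 0) :
    ∀ y ∈ Metric.ball x₀ r, f y = taylorPoly k f x₀ y := by
  intro y hy
  obtain ⟨m, rfl⟩ : ∃ m, k = m + 1 := ⟨k - 1, by omega⟩
  set φ : ℝ → ℝ := fun t => f (x₀ + t • (y - x₀)) with hφ
  have hl : ContDiff ℝ (⊤ : ℕ∞) φ :=
    hf.comp (contDiff_const.add (contDiff_id.smul contDiff_const))
  have hder : ∀ j t, iteratedDeriv j φ t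
      = iteratedFDeriv ℝ j f (x₀ + t • (y - x₀)) (fun _ => y - x₀) :=
    fun j t => iteratedDeriv_comp_line j hf x₀ (y - x₀) t
  obtain ⟨c, hc, e⟩ := taylor_mean_remainder_lagrange_iteratedDeriv (f := φ) (n := m)
    (zero_ne_one' ℝ) (hl.contDiffOn.of_le (by exact_mod_cast le_top))
  rw [uIoo_of_le zero_le_one] at hc
  rw [uIcc_of_le zero_le_one] at e
  have hz : iteratedDeriv (m + 1) φ c = 0 := by
    rw [hder, h0]
    · simp
    · rw [Metric.mem_ball, dist_eq_norm] at hy ⊢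
      rw [add_sub_cancel_left, norm_smul, Real.norm_of_nonneg hc.1.le]
      refine lt_of_le_of_lt ?_ hy
      exact mul_le_of_le_one_left (norm_nonneg _) hc.2.le
  rw [hz, taylor_within_apply] at e
  have h1 : φ 1 = f y := by simp [hφ]
  rw [h1] at e
  simp only [zero_div, sub_zero, one_pow, mul_one] at e
  rw [sub_eq_zero.1 e, taylorPoly]
  refine Finset.sum_congr rfl fun j _ => ?_
  rw [iteratedDerivWithin_eq_iteratedDeriv (uniqueDiffOn_Icc zero_lt_one)
    (hl.contDiffAt.of_le (by exact_mod_cast le_top)) (by simp), hder]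
  simp

theorem exists_kDiff_eq_of_preconnected {n k : ℕ} (hk : 0 < k) {f : En n → ℝ}
    (hf : ContDiff ℝ (⊤ : ℕ∞) f) {U : Set (En n)} (hU : IsOpen U) (hU' : IsPreconnected U)
    (hne : U.Nonempty) (h0 : ∀ y ∈ U, iteratedFDeriv ℝ k f y = 0) :
    ∃ g : En n → ℝ, Continuous g ∧ (∀ y ∈ U, g y = 0) ∧ ∀ h x, kDiff k f h x = kDiff k g h x := by
  obtain ⟨x₀, hx₀⟩ := hne
  set T := taylorPoly k f x₀ with hT
  have hloc : ∀ z ∈ U, f =ᶠ[𝓝 z] taylorPoly k f z := by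
    intro z hz
    obtain ⟨r, hr, hrU⟩ := Metric.isOpen_iff.1 hU z hz
    filter_upwards [Metric.ball_mem_nhds z hr] with y hy
    exact eq_taylorPoly_of_ball hk hf (fun y hy => h0 y (hrU hy)) y hy
  have hTan : ∀ z s, AnalyticOnNhd ℝ (taylorPoly k f z) s := fun z s =>
    (contDiff_taylorPoly k f z _).analyticOnNhd
  have hfan : AnalyticOnNhd ℝ f U := fun z hz => (hTan z univ z trivial).congr (hloc z hz).symm
  have hEq : EqOn f T U :=
    hfan.eqOn_of_preconnected_of_eventuallyEq (hTan x₀ U) hU' hx₀ (hloc x₀ hx₀)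
  have hDT : iteratedFDeriv ℝ k T = fun _ => 0 := by
    refine ((hTan x₀ univ).iteratedFDeriv k).eq_of_eventuallyEq analyticOnNhd_const (z₀ := x₀) ?_
    filter_upwards [hU.mem_nhds hx₀, (hloc x₀ hx₀).iteratedFDeriv ℝ k] with y hy hy2
    rw [← hy2, h0 y hy]
  refine ⟨fun y => f y - T y, hf.continuous.sub (contDiff_taylorPoly k f x₀ 0).continuous,
    fun y hy => sub_eq_zero.2 (hEq hy), fun h x => ?_⟩
  obtain ⟨c, -, e⟩ := exists_kDiff_eq k (contDiff_taylorPoly k f x₀ _) h x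
  rw [kDiff_sub, e, ← hT, hDT]
  simp

theorem isPreconnected_norm_gt {n : ℕ} (hn : 2 ≤ n) {R : ℝ} (hR : 0 ≤ R) :
    IsPreconnected {x : En n | R < ‖x‖} := by
  have h1 : IsPreconnected (Metric.sphere (0 : En n) 1) := by
    refine isPreconnected_sphere ?_ 0 1
    rw [← Module.finrank_eq_rank]
    simp only [finrank_euclideanSpace, Fintype.card_fin]
    exact_mod_cast hn
  have h2 := (isPreconnected_Ioi (a := R)).prod h1
  have h3 := h2.image (fun z : ℝ × En n => z.1 • z.2) (by fun_prop)
  convert h3 using 1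
  ext x
  simp only [mem_ofPred_eq, mem_image, Prod.exists, mem_prod, mem_Ioi, mem_sphere_zero_iff_norm]
  constructor
  · intro hx
    have : ‖x‖ ≠ 0 := by linarith
    exact ⟨‖x‖, ‖x‖⁻¹ • x, ⟨hx, by simp [norm_smul, this]⟩, by simp [smul_smul, this]⟩
  · rintro ⟨r, ξ, ⟨hr, hξ⟩, rfl⟩
    rw [norm_smul, hξ, mul_one]
    exact hr.trans_le (le_abs_self r)

/-- The open cone with apex `0` over the copy of `B` placed at height one. -/
def heightOneCone {m : ℕ} (B : Set (Fin m → ℝ)) : Set (ℝ × (Fin m → ℝ)) :=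
  {z | z.1 ∈ Ioo (0 : ℝ) 1 ∧ z.1⁻¹ • z.2 ∈ B}

theorem measurableSet_heightOneCone {m : ℕ} {B : Set (Fin m → ℝ)} (hB : MeasurableSet B) :
    MeasurableSet (heightOneCone B) := by
  have h : Measurable (fun z : ℝ × (Fin m → ℝ) => z.1⁻¹ • z.2) := by fun_prop
  exact (measurable_fst measurableSet_Ioo).inter (h hB)

theorem succ_mul_volume_heightOneCone {m : ℕ} {B : Set (Fin m → ℝ)} (hB : MeasurableSet B) :
    ((m : ℝ≥0∞) + 1) * volume (heightOneCone B) = volume B := by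
  rw [Measure.volume_eq_prod, Measure.prod_apply (measurableSet_heightOneCone hB)]
  have h1 : ∀ t : ℝ, volume (Prod.mk t ⁻¹' heightOneCone B)
      = (Ioo (0 : ℝ) 1).indicator (fun t => ENNReal.ofReal (t ^ m) * volume B) t := by
    intro t
    by_cases ht : t ∈ Ioo (0 : ℝ) 1
    · rw [indicator_of_mem ht]
      have : Prod.mk t ⁻¹' heightOneCone B = (t⁻¹ • ·) ⁻¹' B := by
        ext w; simp only [heightOneCone, mem_preimage, mem_ofPred_eq, ht, true_and]
      rw [this, Measure.addHaar_preimage_smul _ (inv_ne_zero ht.1.ne')]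
      congr 2
      simp [abs_of_pos ht.1]
    · rw [indicator_of_notMem ht]
      have : Prod.mk t ⁻¹' heightOneCone B = ∅ := by
        ext w; simp only [heightOneCone, mem_preimage, mem_ofPred_eq, ht, false_and, mem_empty_iff_false]
      rw [this, measure_empty]
  simp_rw [h1]
  rw [lintegral_indicator measurableSet_Ioo, lintegral_mul_const _ (by fun_prop),
    restrict_Ioo_eq_restrict_Ioc,
    ← ofReal_integral_eq_lintegral_ofReal, ← intervalIntegral.integral_of_le zero_le_one,
    integral_pow, ← mul_assoc]
  · have : (m : ℝ≥0∞) + 1 = ENNReal.ofReal ((m : ℝ) + 1) := by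
      rw [ENNReal.ofReal_add (by positivity) (by positivity)]; simp
    rw [this, ← ENNReal.ofReal_mul (by positivity)]
    have h2 : ((m : ℝ) + 1) * ((1 ^ (m + 1) - 0 ^ (m + 1)) / ((m : ℝ) + 1)) = 1 := by
      field_simp; simp
    rw [h2]; simp
  · exact (intervalIntegral.intervalIntegrable_pow m).1
  · filter_upwards [ae_restrict_mem measurableSet_Ioc] with t ht
    exact pow_nonneg ht.1.le _

/-- Splitting off the first coordinate with respect to an orthonormal basis. -/
noncomputable def coordSplit {m : ℕ} (b : OrthonormalBasis (Fin (m + 1)) ℝ (En (m + 1)))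
    (x : En (m + 1)) :
    ℝ × (Fin m → ℝ) :=
  (b.repr x 0, fun i => b.repr x i.succ)

theorem measurePreserving_coordSplit {m : ℕ}
    (b : OrthonormalBasis (Fin (m + 1)) ℝ (En (m + 1))) :
    MeasurePreserving (coordSplit b) volume volume := by
  have h := ((volume_preserving_piFinSuccAbove (fun _ : Fin (m + 1) => ℝ) 0).comp
    (PiLp.volume_preserving_ofLp (Fin (m + 1)))).comp b.measurePreserving_repr
  exact h

theorem abs_div_sub_div_le {u v s t d δ : ℝ} (hs : 1 - δ ≤ s) (ht : 1 - δ ≤ t)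
    (ht1 : t ≤ 1) (hδ : δ < 1) (hδ0 : 0 ≤ δ) (hd : 0 ≤ d) (huv : |u - v| ≤ d) (hst : |s - t| ≤ d)
    (hv : |v| ≤ δ) : |u / s - v / t| ≤ (1 + δ) / (1 - δ) ^ 2 * d := by
  have hs0 : 0 < s := by linarith
  have ht0 : 0 < t := by linarith
  have e : u / s - v / t = ((u - v) * t + v * (t - s)) / (s * t) := by
    field_simp; ring
  rw [e, abs_div, abs_of_pos (mul_pos hs0 ht0)]
  have h1 : |(u - v) * t + v * (t - s)| ≤ (1 + δ) * d := by
    refine (abs_add_le _ _).trans ?_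
    rw [abs_mul, abs_mul, abs_of_pos ht0, abs_sub_comm t s]
    have := mul_le_mul huv ht1 ht0.le hd
    have := mul_le_mul hv hst (abs_nonneg _) hδ0
    linarith
  have h2 : (1 - δ) ^ 2 ≤ s * t := by
    rw [sq]; exact mul_le_mul hs ht (by linarith) hs0.le
  have h3 : 0 < (1 - δ) ^ 2 := by have : 0 < 1 - δ := by linarith
                                  positivity
  rw [div_mul_eq_mul_div]
  exact div_le_div₀ (by positivity) h1 h3 h2

open scoped Pointwise in
theorem toSphere_le_ediam_pow {m : ℕ} {δ : ℝ} (hδ0 : 0 < δ) (hδ : δ < 1)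
    {A : Set (Metric.sphere (0 : En (m + 1)) 1)} (hAm : MeasurableSet A)
    (hA : Metric.ediam A ≤ ENNReal.ofReal δ) :
    (volume : Measure (En (m + 1))).toSphere A
      ≤ ENNReal.ofReal ((1 + δ) / (1 - δ) ^ 2) ^ m * Metric.ediam A ^ m := by
  rcases A.eq_empty_or_nonempty with rfl | ⟨a, ha⟩
  · simp
  set d := (Metric.ediam A).toReal with hd
  have hfin : Metric.ediam A ≠ ∞ := ne_top_of_le_ne_top ENNReal.ofReal_ne_top hA
  have hd0 : 0 ≤ d := ENNReal.toReal_nonneg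
  have hdδ : d ≤ δ := ENNReal.toReal_le_of_le_ofReal hδ0.le hA
  have hdist : ∀ y ∈ A, ∀ z ∈ A, ‖(y : En (m + 1)) - z‖ ≤ d := by
    intro y hy z hz
    rw [← dist_eq_norm]
    exact Metric.dist_le_diam_of_mem' hfin hy hz
  have hnorm : ∀ y : Metric.sphere (0 : En (m + 1)) 1, ‖(y : En (m + 1))‖ = 1 := fun y => by simp
  have hon : Orthonormal ℝ (({0} : Set (Fin (m + 1))).domRestrict fun _ => (a : En (m + 1))) := by
    refine ⟨fun _ => hnorm a, fun i j hij => ?_⟩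
    exact absurd (Subtype.ext (i.2.trans j.2.symm)) hij
  obtain ⟨b, hb⟩ := hon.exists_orthonormalBasis_extension_of_card_eq (by simp)
  have hb0 : b 0 = (a : En (m + 1)) := hb 0 rfl
  have hcoord : ∀ (i) (y z : En (m + 1)), |b.repr y i - b.repr z i| ≤ ‖y - z‖ := by
    intro i y z
    have : b.repr y i - b.repr z i = inner ℝ (b i) (y - z) := by
      rw [inner_sub_right, b.repr_apply_apply, b.repr_apply_apply]
    rw [this]
    simpa using abs_real_inner_le_norm (b i) (y - z)
  have hcoord0 : ∀ i : Fin m, b.repr (a : En (m + 1)) i.succ = 0 := by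
    intro i
    rw [b.repr_apply_apply, ← hb0]
    exact b.orthonormal.2 (Fin.succ_ne_zero i)
  have hs1 : ∀ y : Metric.sphere (0 : En (m + 1)) 1, b.repr (y : En (m + 1)) 0 ≤ 1 := by
    intro y
    rw [b.repr_apply_apply]
    simpa using real_inner_le_norm (b 0) (y : En (m + 1))
  have hs : ∀ y ∈ A, 1 - δ ≤ b.repr (y : En (m + 1)) 0 := by
    intro y hy
    have h1 := hcoord 0 a y
    have h2 : b.repr (a : En (m + 1)) 0 = 1 := by
      rw [b.repr_apply_apply, hb0, real_inner_self_eq_norm_sq]; simp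
    have h3 := hdist a ha y hy
    rw [h2] at h1
    have := (abs_le.1 h1).2
    linarith
  set P : Metric.sphere (0 : En (m + 1)) 1 → (Fin m → ℝ) :=
    fun y i => b.repr (y : En (m + 1)) i.succ / b.repr (y : En (m + 1)) 0 with hP
  set K := (1 + δ) / (1 - δ) ^ 2 with hK
  have hK0 : 0 ≤ K := by positivity
  have hdiam : Metric.ediam (closure (P '' A)) ≤ ENNReal.ofReal K * Metric.ediam A := by
    rw [Metric.ediam_closure]
    refine Metric.ediam_le ?_
    rintro _ ⟨y, hy, rfl⟩ _ ⟨z, hz, rfl⟩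
    rw [← ENNReal.ofReal_toReal hfin, ← ENNReal.ofReal_mul hK0, edist_dist]
    refine ENNReal.ofReal_le_ofReal ((dist_pi_le_iff (by positivity)).2 fun i => ?_)
    rw [Real.dist_eq]
    refine abs_div_sub_div_le (hs y hy) (hs z hz) (hs1 z) hδ hδ0.le hd0
      ((hcoord _ _ _).trans (hdist y hy z hz)) ((hcoord _ _ _).trans (hdist y hy z hz)) ?_
    have h1 := hcoord i.succ z a
    rw [hcoord0, sub_zero] at h1
    exact h1.trans ((hdist z hz a ha).trans hdδ)
  have hsub : Ioo (0 : ℝ) 1 • ((↑) '' A : Set (En (m + 1)))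
      ⊆ coordSplit b ⁻¹' heightOneCone (closure (P '' A)) := by
    rintro _ ⟨r, hr, _, ⟨y, hy, rfl⟩, rfl⟩
    have hy0 : 0 < b.repr (y : En (m + 1)) 0 := by linarith [hs y hy]
    have e0 : b.repr (r • (y : En (m + 1))) 0 = r * b.repr (y : En (m + 1)) 0 := by simp
    refine ⟨?_, subset_closure ⟨y, hy, ?_⟩⟩
    · change b.repr (r • (y : En (m + 1))) 0 ∈ _
      rw [e0]
      exact ⟨mul_pos hr.1 hy0, lt_of_le_of_lt (mul_le_of_le_one_right hr.1.le (hs1 y)) hr.2⟩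
    · ext i
      have hr0 := hr.1.ne'
      simp only [hP, coordSplit, Pi.smul_apply, smul_eq_mul, map_smul, PiLp.smul_apply]
      field_simp
  have hcl : MeasurableSet (closure (P '' A)) := isClosed_closure.measurableSet
  rw [Measure.toSphere_apply' _ hAm]
  calc _ ≤ ((m : ℝ≥0∞) + 1) * volume (heightOneCone (closure (P '' A))) := by
        rw [← (measurePreserving_coordSplit b).measure_preimage
          (measurableSet_heightOneCone hcl).nullMeasurableSet]
        refine mul_le_mul' (by simp) (measure_mono hsub)
    _ = volume (closure (P '' A)) := succ_mul_volume_heightOneCone hcl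
    _ ≤ Metric.ediam (closure (P '' A)) ^ m := by
        simpa using Real.volume_pi_le_diam_pow (closure (P '' A))
    _ ≤ _ := by rw [← mul_pow]; gcongr

theorem toSphere_le_hausdorffMeasure (m : ℕ) :
    (volume : Measure (En (m + 1))).toSphere ≤ μH[(m : ℝ)] := by
  set σ := (volume : Measure (En (m + 1))).toSphere with hσ
  have key : ∀ δ : ℝ, 0 < δ → δ < 1 → ∀ S : Set (Metric.sphere (0 : En (m + 1)) 1),
      σ S ≤ ENNReal.ofReal ((1 + δ) / (1 - δ) ^ 2) ^ m * μH[(m : ℝ)] S := by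
    intro δ h0 h1 S
    set c := ENNReal.ofReal ((1 + δ) / (1 - δ) ^ 2) ^ m with hc
    have hc0 : c ≠ 0 := by
      have : 0 < 1 - δ := by linarith
      have : 0 < (1 + δ) / (1 - δ) ^ 2 := by positivity
      exact pow_ne_zero _ (by simpa using this)
    have hct : c ≠ ∞ := ENNReal.pow_ne_top ENNReal.ofReal_ne_top
    have h : c⁻¹ • σ ≤ μH[(m : ℝ)] := by
      refine Measure.le_hausdorffMeasure _ _ (ENNReal.ofReal δ) (by simpa using h0) fun A hA => ?_
      rw [Measure.smul_apply, smul_eq_mul, ENNReal.rpow_natCast, mul_comm, ← div_eq_mul_inv]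
      refine ENNReal.div_le_of_le_mul' ?_
      refine (measure_mono subset_closure).trans ?_
      rw [← Metric.ediam_closure] at hA ⊢
      exact toSphere_le_ediam_pow h0 h1 isClosed_closure.measurableSet hA
    have := h S
    rw [Measure.smul_apply, smul_eq_mul, mul_comm, ← div_eq_mul_inv] at this
    exact (ENNReal.div_le_iff' hc0 hct).1 this
  refine Measure.le_iff'.2 fun S => ?_
  have hreal : Tendsto (fun δ : ℝ => (1 + δ) / (1 - δ) ^ 2) (𝓝[>] 0) (𝓝 1) := by
    have : ContinuousAt (fun δ : ℝ => (1 + δ) / (1 - δ) ^ 2) 0 := by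
      refine ContinuousAt.div (by fun_prop) (by fun_prop) (by norm_num)
    have h := this.tendsto
    norm_num at h
    exact h.mono_left nhdsWithin_le_nhds
  have hl := ((ENNReal.continuous_pow m).tendsto _).comp (ENNReal.tendsto_ofReal hreal)
  have hl2 := ENNReal.Tendsto.mul_const (b := μH[(m : ℝ)] S) hl (Or.inl (by simp))
  simp only [ENNReal.ofReal_one, one_pow, one_mul] at hl2
  refine ge_of_tendsto hl2 ?_
  filter_upwards [Ioo_mem_nhdsGT (zero_lt_one' ℝ)] with δ hδ
  exact key δ hδ.1 hδ.2 S

theorem lintegral_eq_lintegral_toSphere {n : ℕ} (hn : 0 < n) {Φ : En n → ℝ≥0∞}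
    (hΦ : Measurable Φ) :
    ∫⁻ x, Φ x = ∫⁻ ξ : Metric.sphere (0 : En n) 1, ∫⁻ r in Ioi (0 : ℝ),
      ENNReal.ofReal (r ^ (n - 1)) * Φ (r • (ξ : En n))
        ∂volume ∂(volume : Measure (En n)).toSphere := by
  have : Nonempty (Fin n) := ⟨⟨0, hn⟩⟩
  have hm := (volume : Measure (En n)).measurePreserving_homeomorphUnitSphereProd
  have hΨ : Measurable (fun z : Metric.sphere (0 : En n) 1 × Ioi (0 : ℝ) =>
      Φ ((z.2 : ℝ) • (z.1 : En n))) := hΦ.comp (by fun_prop)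
  have h1 : ∫⁻ x, Φ x = ∫⁻ x : ({(0 : En n)}ᶜ : Set (En n)), Φ x
      ∂(Measure.comap (↑) (volume : Measure (En n))) := by
    rw [lintegral_subtype_comap (measurableSet_singleton (0 : En n)).compl, restrict_compl_singleton]
  rw [h1]
  have h2 := hm.lintegral_comp hΨ
  rw [lintegral_prod _ hΨ.aemeasurable] at h2
  have h3 : ∀ x : ({(0 : En n)}ᶜ : Set (En n)),
      Φ ((((homeomorphUnitSphereProd (En n)) x).2 : ℝ) •
        (((homeomorphUnitSphereProd (En n)) x).1 : En n)) = Φ x := by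
    intro x
    congr 1
    have : ‖(x : En n)‖ ≠ 0 := norm_ne_zero_iff.2 x.2
    simp [smul_smul, this]
  simp_rw [h3] at h2
  rw [h2]
  refine lintegral_congr fun ξ => ?_
  have hξ : Measurable (fun r : Ioi (0 : ℝ) => Φ ((r : ℝ) • (ξ : En n))) := hΦ.comp (by fun_prop)
  rw [Measure.volumeIoiPow, lintegral_withDensity_eq_lintegral_mul _ (by fun_prop) hξ,
    finrank_euclideanSpace, Fintype.card_fin]
  exact lintegral_subtype_comap measurableSet_Ioi
    (fun r : ℝ => ENNReal.ofReal (r ^ (n - 1)) * Φ (r • (ξ : En n)))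

theorem volume_eq_zero_of_rays {n : ℕ} (hn : 0 < n) {N : Set (En n)} (hN : MeasurableSet N)
    (h : ∀ ξ : Metric.sphere (0 : En n) 1, volume {r : ℝ | 0 < r ∧ r • (ξ : En n) ∈ N} = 0) :
    volume N = 0 := by
  rw [← lintegral_indicator_one hN, lintegral_eq_lintegral_toSphere hn
    (measurable_one.indicator hN)]
  refine (lintegral_congr fun ξ => ?_).trans lintegral_zero
  rw [lintegral_eq_zero_iff' (by
    refine Measurable.aemeasurable ?_
    have : Measurable (N.indicator (1 : En n → ℝ≥0∞)) := measurable_one.indicator hN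
    fun_prop), Filter.EventuallyEq, ae_restrict_iff' measurableSet_Ioi, ae_iff]
  refine measure_mono_null (fun r hr => ?_) (h ξ)
  simp only [mem_ofPred_eq, mem_Ioi, Classical.not_imp] at hr
  refine ⟨hr.1, ?_⟩
  by_contra hh
  exact hr.2 (by simp [hh])

theorem lintegral_Ioi_rpow_lt {q γ c : ℝ} (hq : 0 < q) (hγ : γ ≠ 0) (hc : 0 ≤ c) :
    ∫⁻ r in Ioi (0 : ℝ), (if r ^ (γ / q) < c then ENNReal.ofReal (r ^ (γ - 1)) else 0)
      = ENNReal.ofReal (c ^ q / |γ|) := by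
  rcases hc.eq_or_lt with rfl | hc
  · rw [Real.zero_rpow hq.ne', zero_div, ENNReal.ofReal_zero]
    refine (setLIntegral_congr_fun measurableSet_Ioi fun r hr => ?_).trans lintegral_zero
    exact if_neg (not_lt.2 (Real.rpow_nonneg (le_of_lt hr) _))
  set T := c ^ (q / γ) with hT
  have hT0 : 0 < T := Real.rpow_pos_of_pos hc _
  have hTc : T ^ (γ / q) = c := by
    rw [hT, ← Real.rpow_mul hc.le]
    have : q / γ * (γ / q) = 1 := by field_simp
    rw [this, Real.rpow_one]
  have hTq : T ^ γ = c ^ q := by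
    rw [hT, ← Real.rpow_mul hc.le]
    congr 1; field_simp
  rcases lt_or_gt_of_ne hγ with hneg | hpos
  · have hiff : ∀ r ∈ Ioi (0 : ℝ), (r ^ (γ / q) < c ↔ r ∈ Ioi T) := by
      intro r hr
      rw [← hTc, mem_Ioi]
      exact Real.rpow_lt_rpow_iff_of_neg hr hT0 (div_neg_of_neg_of_pos hneg hq)
    have e1 : ∫⁻ r in Ioi (0 : ℝ), (if r ^ (γ / q) < c then ENNReal.ofReal (r ^ (γ - 1)) else 0)
        = ∫⁻ r in Ioi (0 : ℝ), (Ioi T).indicator (fun r => ENNReal.ofReal (r ^ (γ - 1))) r :=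
      setLIntegral_congr_fun measurableSet_Ioi fun r hr => by
        simp only [indicator, hiff r hr]
    rw [e1, setLIntegral_indicator measurableSet_Ioi,
      inter_eq_self_of_subset_left (Ioi_subset_Ioi hT0.le),
      ← ofReal_integral_eq_lintegral_ofReal, integral_Ioi_rpow_of_lt (by linarith) hT0,
      abs_of_neg hneg, sub_add_cancel, hTq, neg_div, div_neg]
    · exact integrableOn_Ioi_rpow_of_lt (by linarith) hT0
    · filter_upwards [ae_restrict_mem measurableSet_Ioi] with r hr
      exact Real.rpow_nonneg (hT0.trans hr).le _
  · have hiff : ∀ r ∈ Ioi (0 : ℝ), (r ^ (γ / q) < c ↔ r ∈ Iio T) := by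
      intro r hr
      rw [← hTc, mem_Iio]
      exact Real.rpow_lt_rpow_iff (le_of_lt hr) hT0.le (div_pos hpos hq)
    have e1 : ∫⁻ r in Ioi (0 : ℝ), (if r ^ (γ / q) < c then ENNReal.ofReal (r ^ (γ - 1)) else 0)
        = ∫⁻ r in Ioi (0 : ℝ), (Iio T).indicator (fun r => ENNReal.ofReal (r ^ (γ - 1))) r :=
      setLIntegral_congr_fun measurableSet_Ioi fun r hr => by
        simp only [indicator, hiff r hr]
    have hs : Iio T ∩ Ioi 0 = Ioo 0 T := by ext r; simp [and_comm]
    rw [e1, setLIntegral_indicator measurableSet_Iio, hs, restrict_Ioo_eq_restrict_Ioc,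
      ← ofReal_integral_eq_lintegral_ofReal, ← intervalIntegral.integral_of_le hT0.le,
      integral_rpow (Or.inl (by linarith)), sub_add_cancel, hTq, Real.zero_rpow hγ, sub_zero,
      abs_of_pos hpos]
    · exact (intervalIntegral.intervalIntegrable_rpow' (by linarith)).1
    · filter_upwards [ae_restrict_mem measurableSet_Ioc] with r hr
      exact Real.rpow_nonneg hr.1.le _

theorem norm_rpow_lt_iff_on_ray {n k : ℕ} {s r : ℝ} (hr : 0 < r) {D : En n → ℝ}
    (hD : ∀ r : ℝ, 0 < r → ∀ u, D (r • u) = r ^ k * D u) (ξ : Metric.sphere (0 : En n) 1) :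
    ‖r • (ξ : En n)‖ ^ ((k : ℝ) + s) < |D (r • (ξ : En n))| ↔ r ^ s < |D ξ| := by
  have h1 : ‖r • (ξ : En n)‖ = r := by rw [norm_smul]; simp [abs_of_pos hr]
  rw [h1, hD r hr, abs_mul, abs_of_pos (pow_pos hr k), Real.rpow_add hr, Real.rpow_natCast,
    mul_lt_mul_iff_right₀ (pow_pos hr k)]

theorem measurable_norm_rpow {n : ℕ} (s : ℝ) : Measurable (fun u : En n => ‖u‖ ^ s) := by
  fun_prop

theorem lintegral_norm_rpow_lt_homogeneous {n k : ℕ} (hn : 0 < n) {q γ : ℝ} (hq : 0 < q)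
    (hγ : γ ≠ 0) {D : En n → ℝ} (hDm : Measurable D)
    (hD : ∀ r : ℝ, 0 < r → ∀ u, D (r • u) = r ^ k * D u) :
    ∫⁻ u : En n, (if u ≠ 0 ∧ ‖u‖ ^ ((k : ℝ) + γ / q) < |D u| then
        ENNReal.ofReal (‖u‖ ^ (γ - (n : ℝ))) else 0)
      = ∫⁻ ξ : Metric.sphere (0 : En n) 1, ENNReal.ofReal (|D ξ| ^ q / |γ|)
          ∂(volume : Measure (En n)).toSphere := by
  have hset : MeasurableSet {u : En n | u ≠ 0 ∧ ‖u‖ ^ ((k : ℝ) + γ / q) < |D u|} :=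
    (measurableSet_singleton (0 : En n)).compl.inter
      (measurableSet_lt (measurable_norm_rpow _) hDm.abs)
  rw [lintegral_eq_lintegral_toSphere hn
    (Measurable.ite hset (measurable_norm_rpow _).ennreal_ofReal measurable_const)]
  refine lintegral_congr fun ξ => ?_
  rw [← lintegral_Ioi_rpow_lt hq hγ (abs_nonneg (D ξ))]
  refine setLIntegral_congr_fun measurableSet_Ioi fun r (hr : 0 < r) => ?_
  have h1 : ‖r • (ξ : En n)‖ = r := by rw [norm_smul]; simp [abs_of_pos hr]
  have h0 : r • (ξ : En n) ≠ 0 := by rw [← norm_ne_zero_iff, h1]; exact hr.ne'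
  simp only [norm_rpow_lt_iff_on_ray hr hD ξ, h0, ne_eq, not_false_eq_true, true_and]
  split_ifs
  · rw [h1, ← ENNReal.ofReal_mul (by positivity), ← Real.rpow_natCast, ← Real.rpow_add hr]
    congr 2
    rw [Nat.cast_sub hn]; push_cast; ring
  · simp

theorem volume_norm_rpow_eq_homogeneous {n k : ℕ} (hn : 0 < n) {s : ℝ} (hs : s ≠ 0)
    {D : En n → ℝ} (hDm : Measurable D)
    (hD : ∀ r : ℝ, 0 < r → ∀ u, D (r • u) = r ^ k * D u) :
    volume {u : En n | ‖u‖ ^ ((k : ℝ) + s) = |D u|} = 0 := by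
  refine volume_eq_zero_of_rays hn (measurableSet_eq_fun (measurable_norm_rpow _) hDm.abs)
    fun ξ => ?_
  refine Set.Subsingleton.measure_zero ?_ _
  have key : ∀ r : ℝ, 0 < r → ‖r • (ξ : En n)‖ ^ ((k : ℝ) + s) = |D (r • (ξ : En n))| →
      r ^ s = |D ξ| := by
    intro r hr h
    have h1 : ‖r • (ξ : En n)‖ = r := by rw [norm_smul]; simp [abs_of_pos hr]
    rw [h1, hD r hr, abs_mul, abs_of_pos (pow_pos hr k), Real.rpow_add hr, Real.rpow_natCast] at h
    exact mul_left_cancel₀ (pow_pos hr k).ne' h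
  rintro r ⟨hr, hr'⟩ t ⟨ht, ht'⟩
  exact (Real.rpow_left_inj hr.le ht.le hs).1 ((key r hr hr').trans (key t ht ht').symm)

theorem lintegral_norm_rpow_lt_const {n : ℕ} (hn : 0 < n) {q γ : ℝ} (hq : 0 < q)
    (hγ : γ ≠ 0) {c : ℝ} (hc : 0 ≤ c) :
    ∫⁻ u : En n, (if u ≠ 0 ∧ ‖u‖ ^ (γ / q) < c then
        ENNReal.ofReal (‖u‖ ^ (γ - (n : ℝ))) else 0)
      = ENNReal.ofReal (c ^ q / |γ|) * (volume : Measure (En n)).toSphere univ := by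
  have h := lintegral_norm_rpow_lt_homogeneous (k := 0) hn hq hγ (D := fun _ => c)
    measurable_const (fun r _ u => by simp)
  simpa [abs_of_nonneg hc] using h

/-- The inner integral after the change of variables `h = τ u`. -/
noncomputable def rescaledInnerInt {n : ℕ} (k : ℕ) (q γ : ℝ) (f : En n → ℝ) (τ : ℝ) (x : En n) :
    ℝ≥0∞ :=
  ∫⁻ u, if u ≠ 0 ∧ ‖u‖ ^ ((k : ℝ) + γ / q) < |kDiff k f (τ • u) x / τ ^ k| then
    ENNReal.ofReal (‖u‖ ^ (γ - (n : ℝ))) else 0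

theorem ofReal_rpow_mul_innerInt {n : ℕ} (k : ℕ) {q γ τ : ℝ} (f : En n → ℝ)
    (hτ : 0 < τ) (x : En n) :
    ENNReal.ofReal (τ ^ (-γ)) * innerInt k k (τ ^ (-(γ / q))) (γ / q) γ f x
      = rescaledInnerInt k q γ f τ x := by
  set F : En n → ℝ≥0∞ := fun h => if memE k k (τ ^ (-(γ / q))) (γ / q) f x h then
    ENNReal.ofReal (‖h‖ ^ (γ - (n : ℝ))) else 0 with hF
  have hn : ∀ u : En n, ‖τ • u‖ = τ * ‖u‖ := fun u => by
    rw [norm_smul, Real.norm_of_nonneg hτ.le]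
  have h1 : ∀ u : En n, (if u ≠ 0 ∧ ‖u‖ ^ ((k : ℝ) + γ / q) < |kDiff k f (τ • u) x / τ ^ k| then
      ENNReal.ofReal (‖u‖ ^ (γ - (n : ℝ))) else 0) = ENNReal.ofReal (τ ^ ((n : ℝ) - γ)) * F (τ • u) := by
    intro u
    have hiff : memE k k (τ ^ (-(γ / q))) (γ / q) f x (τ • u) ↔
        (u ≠ 0 ∧ ‖u‖ ^ ((k : ℝ) + γ / q) < |kDiff k f (τ • u) x / τ ^ k|) := by
      unfold memE
      have e : τ ^ (-(γ / q)) * (τ * ‖u‖) ^ ((k : ℝ) + γ / q)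
          = ‖u‖ ^ ((k : ℝ) + γ / q) * τ ^ k := by
        rw [Real.mul_rpow hτ.le (norm_nonneg _), ← mul_assoc, ← Real.rpow_add hτ,
          ← Real.rpow_natCast τ k, mul_comm]
        congr 2; ring
      rw [hn, e, abs_div, abs_of_pos (pow_pos hτ k), lt_div_iff₀ (pow_pos hτ k)]
      simp [hτ.ne']
    simp only [hF, hiff]
    split_ifs
    · rw [← ENNReal.ofReal_mul (by positivity), hn, Real.mul_rpow hτ.le (norm_nonneg _),
        ← mul_assoc, ← Real.rpow_add hτ]
      simp
    · simp
  rw [rescaledInnerInt, lintegral_congr h1, lintegral_const_mul' _ _ ENNReal.ofReal_ne_top]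
  have h2 : ∫⁻ u, F (τ • u) = ENNReal.ofReal (τ ^ (-(n : ℝ))) * ∫⁻ h, F h := by
    have e : (∫⁻ h, F h ∂(Measure.map (fun u : En n => τ • u) volume)) = ∫⁻ u, F (τ • u) :=
      (Homeomorph.smulOfNeZero τ hτ.ne').measurableEmbedding.lintegral_map F
    rw [← e, Measure.map_addHaar_smul volume hτ.ne', lintegral_smul_measure,
      finrank_euclideanSpace, Fintype.card_fin, abs_of_pos (by positivity), Real.rpow_neg hτ.le,
      Real.rpow_natCast, smul_eq_mul]
  rw [h2, ← mul_assoc, ← ENNReal.ofReal_mul (by positivity), ← Real.rpow_add hτ, innerInt]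
  congr 3
  ring

theorem bsvy_eq_rescaled {n : ℕ} (k : ℕ) {p q γ τ : ℝ} (hp : 0 < p) (hq : 0 < q) (f : En n → ℝ)
    (hτ : 0 < τ) :
    bsvy k k p q (γ / q) γ f (τ ^ (-(γ / q)))
      = (∫⁻ x, rescaledInnerInt k q γ f τ x ^ (p / q)) ^ (1 / p) := by
  have e : ENNReal.ofReal (τ ^ (-(γ / q)))
      = (ENNReal.ofReal (τ ^ (-γ)) ^ (p / q)) ^ (1 / p) := by
    rw [← ENNReal.rpow_mul, ENNReal.ofReal_rpow_of_pos (by positivity), ← Real.rpow_mul hτ.le]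
    congr 2; field_simp
  rw [bsvy, e, ← ENNReal.mul_rpow_of_nonneg _ _ (by positivity), ← lintegral_const_mul']
  · simp_rw [← ENNReal.mul_rpow_of_nonneg _ _ (show 0 ≤ p / q by positivity),
      ofReal_rpow_mul_innerInt k f hτ]
  · exact ENNReal.rpow_ne_top_of_nonneg (by positivity) ENNReal.ofReal_ne_top

theorem tendsto_rpow_Lfil {q γ : ℝ} (hq : 0 < q) (hγ : γ ≠ 0) :
    Tendsto (fun lam : ℝ => lam ^ (-(q / γ))) (Lfil γ) (𝓝[>] 0) := by
  unfold Lfil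
  refine tendsto_nhdsWithin_iff.2 ?_
  split_ifs with h
  · refine ⟨tendsto_rpow_neg_atTop (div_pos hq h), ?_⟩
    filter_upwards [eventually_gt_atTop 0] with l hl
    exact Real.rpow_pos_of_pos hl _
  · have hneg : γ < 0 := lt_of_le_of_ne (not_lt.1 h) hγ
    have hpos : 0 < -(q / γ) := by rw [← div_neg]; exact div_pos hq (by linarith)
    refine ⟨?_, ?_⟩
    · have := (Real.continuousAt_rpow_const 0 (-(q / γ)) (Or.inr hpos.le)).tendsto
      rw [Real.zero_rpow hpos.ne'] at this
      exact this.mono_left nhdsWithin_le_nhds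
    · filter_upwards [self_mem_nhdsWithin] with l hl
      exact Real.rpow_pos_of_pos hl _

theorem eventually_pos_Lfil (γ : ℝ) : ∀ᶠ lam in Lfil γ, 0 < lam := by
  unfold Lfil
  split_ifs
  · exact eventually_gt_atTop 0
  · exact self_mem_nhdsWithin

instance neBot_Lfil (γ : ℝ) : (Lfil γ).NeBot := by
  unfold Lfil
  split_ifs <;> infer_instance

theorem limsup_bsvy_eq {n k : ℕ} {p q γ : ℝ} (hp : 0 < p) (hq : 0 < q) (hγ : γ ≠ 0)
    {f : En n → ℝ} {L : ℝ≥0∞}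
    (h : Tendsto (fun τ => ∫⁻ x, rescaledInnerInt k q γ f τ x ^ (p / q)) (𝓝[>] 0) (𝓝 L)) :
    Filter.limsup (fun lam => bsvy k k p q (γ / q) γ f lam) (Lfil γ) = L ^ (1 / p) := by
  refine Tendsto.limsup_eq ?_
  refine (((ENNReal.continuous_rpow_const.tendsto _).comp
    (h.comp (tendsto_rpow_Lfil hq hγ))).congr' ?_)
  filter_upwards [eventually_pos_Lfil γ] with lam hl
  have e : (lam ^ (-(q / γ))) ^ (-(γ / q)) = lam := by
    rw [← Real.rpow_mul hl.le]
    have : -(q / γ) * -(γ / q) = 1 := by field_simp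
    rw [this, Real.rpow_one]
  have := bsvy_eq_rescaled k (γ := γ) hp hq f (Real.rpow_pos_of_pos hl (-(q / γ)))
  rw [e] at this
  exact this.symm

theorem rpow_lt_of_lt_kDiff_div {n k : ℕ} {s τ M : ℝ} {f : En n → ℝ} (hf : ContDiff ℝ (⊤ : ℕ∞) f)
    (hM : ∀ y, ‖iteratedFDeriv ℝ k f y‖ ≤ M) (hτ : 0 < τ) {x u : En n} (hu : u ≠ 0)
    (h : ‖u‖ ^ ((k : ℝ) + s) < |kDiff k f (τ • u) x / τ ^ k|) : ‖u‖ ^ s < M := by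
  have hu' : 0 < ‖u‖ := norm_pos_iff.2 hu
  have h1 := abs_kDiff_le k hf hM (τ • u) x
  rw [norm_smul, Real.norm_of_nonneg hτ.le, mul_pow] at h1
  rw [abs_div, abs_of_pos (pow_pos hτ k), lt_div_iff₀ (pow_pos hτ k), Real.rpow_add hu',
    Real.rpow_natCast] at h
  have h2 : ‖u‖ ^ s * (‖u‖ ^ k * τ ^ k) < M * (‖u‖ ^ k * τ ^ k) := by linarith
  exact lt_of_mul_lt_mul_right h2 (by positivity)

theorem rescaledInnerInt_le_of_forall {n k : ℕ} (hn : 0 < n) {q γ τ c : ℝ} (hq : 0 < q)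
    (hγ : γ ≠ 0) (hc : 0 ≤ c) {f : En n → ℝ} {x : En n}
    (h : ∀ u ≠ 0, ‖u‖ ^ ((k : ℝ) + γ / q) < |kDiff k f (τ • u) x / τ ^ k| → ‖u‖ ^ (γ / q) < c) :
    rescaledInnerInt k q γ f τ x
      ≤ ENNReal.ofReal (c ^ q / |γ|) * (volume : Measure (En n)).toSphere univ := by
  rw [← lintegral_norm_rpow_lt_const hn hq hγ hc]
  refine lintegral_mono fun u => ?_
  by_cases hu : u ≠ 0 ∧ ‖u‖ ^ ((k : ℝ) + γ / q) < |kDiff k f (τ • u) x / τ ^ k|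
  · simp only [hu, h u hu.1 hu.2, ne_eq, not_false_eq_true, true_and, if_true]
    exact le_rfl
  · simp only [hu, if_false, zero_le]

theorem measurable_rescaledIntegrand {n : ℕ} (k : ℕ) (q γ τ : ℝ) {f : En n → ℝ}
    (hf : Continuous f) :
    Measurable (fun z : En n × En n => if z.2 ≠ 0 ∧
      ‖z.2‖ ^ ((k : ℝ) + γ / q) < |kDiff k f (τ • z.2) z.1 / τ ^ k| then
      ENNReal.ofReal (‖z.2‖ ^ (γ - (n : ℝ))) else 0) := by
  have hk : Measurable (fun z : En n × En n => kDiff k f (τ • z.2) z.1) :=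
    ((continuous_kDiff k hf).comp
      (continuous_fst.prodMk (continuous_snd.const_smul τ))).measurable
  refine Measurable.ite ?_ (((measurable_norm_rpow _).comp measurable_snd).ennreal_ofReal)
    measurable_const
  exact ((measurableSet_singleton (0 : En n)).compl.preimage measurable_snd).inter
    (measurableSet_lt ((measurable_norm_rpow _).comp measurable_snd)
      (hk.div_const _).abs)

theorem measurable_rescaledInnerInt {n : ℕ} (k : ℕ) (q γ τ : ℝ) {f : En n → ℝ}
    (hf : Continuous f) : Measurable (rescaledInnerInt k q γ f τ) :=
  (measurable_rescaledIntegrand k q γ τ hf).lintegral_prod_right'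

theorem tendsto_rescaledInnerInt {n k : ℕ} (hn : 0 < n) {q γ M : ℝ} (hq : 0 < q) (hγ : γ ≠ 0)
    {f : En n → ℝ} (hf : ContDiff ℝ (⊤ : ℕ∞) f) (hM : ∀ y, ‖iteratedFDeriv ℝ k f y‖ ≤ M)
    (x : En n) :
    Tendsto (fun τ => rescaledInnerInt k q γ f τ x) (𝓝[>] 0)
      (𝓝 (∫⁻ ξ : Metric.sphere (0 : En n) 1,
        ENNReal.ofReal (|iteratedFDeriv ℝ k f x (fun _ => (ξ : En n))| ^ q / |γ|)
          ∂(volume : Measure (En n)).toSphere)) := by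
  have hM0 : 0 ≤ M := (norm_nonneg _).trans (hM 0)
  set D : En n → ℝ := fun u => iteratedFDeriv ℝ k f x (fun _ => u) with hDdef
  have hDm : Measurable D := ((continuous_iteratedFDeriv_diag k hf).comp
    (Continuous.prodMk_right x)).measurable
  have hD : ∀ r : ℝ, 0 < r → ∀ u, D (r • u) = r ^ k * D u := fun r _ u => by
    have := (iteratedFDeriv ℝ k f x).map_smul_univ (fun _ => r) (fun _ => u)
    simpa using this
  rw [← lintegral_norm_rpow_lt_homogeneous hn hq hγ hDm hD]
  refine tendsto_lintegral_filter_of_dominated_convergence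
    (fun u : En n => if u ≠ 0 ∧ ‖u‖ ^ (γ / q) < M then
        ENNReal.ofReal (‖u‖ ^ (γ - (n : ℝ))) else 0) ?_ ?_ ?_ ?_
  · exact Eventually.of_forall fun τ =>
      (measurable_rescaledIntegrand k q γ τ hf.continuous).comp measurable_prodMk_left
  · filter_upwards [self_mem_nhdsWithin] with τ hτ
    refine Eventually.of_forall fun u => ?_
    by_cases hu : u ≠ 0 ∧ ‖u‖ ^ ((k : ℝ) + γ / q) < |kDiff k f (τ • u) x / τ ^ k|
    · simp only [hu, rpow_lt_of_lt_kDiff_div hf hM hτ hu.1 hu.2, ne_eq, not_false_eq_true,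
        true_and, if_true]
      exact le_rfl
    · simp only [hu, if_false, zero_le]
  · rw [lintegral_norm_rpow_lt_const hn hq hγ hM0]
    exact ENNReal.mul_ne_top ENNReal.ofReal_ne_top (measure_ne_top _ _)
  · have hnull : ∀ᵐ u : En n, ¬ ‖u‖ ^ ((k : ℝ) + γ / q) = |D u| := by
      rw [ae_iff]
      simpa using volume_norm_rpow_eq_homogeneous hn (div_ne_zero hγ hq.ne') hDm hD
    filter_upwards [hnull] with u hu
    have ht := (tendsto_kDiff_div k hf x u).abs
    refine tendsto_const_nhds.congr' ?_
    rcases lt_or_gt_of_ne hu with h | h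
    · filter_upwards [ht.eventually_const_lt h] with τ hτ
      simp only [hτ, h]
    · filter_upwards [ht.eventually_lt_const h] with τ hτ
      simp only [not_lt.2 hτ.le, not_lt.2 h.le]

theorem rescaledInnerInt_eq_zero_of_far {n k : ℕ} {q γ τ M R : ℝ} (hq : 0 < q) (hγ : 0 < γ)
    {f : En n → ℝ} (hf : ContDiff ℝ (⊤ : ℕ∞) f) (hM : ∀ y, ‖iteratedFDeriv ℝ k f y‖ ≤ M)
    (hR : ∀ y, R < ‖y‖ → iteratedFDeriv ℝ k f y = 0) (hτ : 0 < τ) (hτ1 : τ ≤ 1) {x : En n}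
    (hx : R + k * M ^ (q / γ) < ‖x‖) : rescaledInnerInt k q γ f τ x = 0 := by
  have hM0 : 0 ≤ M := (norm_nonneg _).trans (hM 0)
  refine (lintegral_congr fun u => if_neg ?_).trans lintegral_zero
  rintro ⟨hu, h⟩
  have h1 : ‖u‖ < M ^ (q / γ) := by
    have h2 := Real.rpow_lt_rpow (by positivity) (rpow_lt_of_lt_kDiff_div hf hM hτ hu h)
      (div_pos hq hγ)
    rwa [← Real.rpow_mul (norm_nonneg _), show γ / q * (q / γ) = 1 by field_simp,
      Real.rpow_one] at h2
  have h3 : ‖τ • u‖ ≤ M ^ (q / γ) := by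
    rw [norm_smul, Real.norm_of_nonneg hτ.le]
    exact (mul_le_of_le_one_left (norm_nonneg _) hτ1).trans h1.le
  rw [kDiff_eq_zero_of_far k hf hR (lt_of_le_of_lt (by gcongr) hx), zero_div, abs_zero] at h
  exact not_le.2 h (by positivity)

theorem rescaledInnerInt_le_norm_rpow {n k : ℕ} (hn : 0 < n) (hk : 0 < k) {q γ τ R : ℝ}
    (hq : 0 < q) (hγ : γ < 0) {f : En n → ℝ} (hf : ContDiff ℝ (⊤ : ℕ∞) f) (hR0 : 0 ≤ R)
    (hR : ∀ y, R < ‖y‖ → iteratedFDeriv ℝ k f y = 0) (hτ : 0 < τ) (hτ1 : τ ≤ 1) {x : En n}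
    (hx : 2 * R < ‖x‖) :
    rescaledInnerInt k q γ f τ x
      ≤ ENNReal.ofReal (2 ^ q * (2 * k : ℝ) ^ (-γ) / |γ| * ‖x‖ ^ γ)
        * (volume : Measure (En n)).toSphere univ := by
  have hx0 : 0 < ‖x‖ := by linarith
  have hk' : (0 : ℝ) < k := by exact_mod_cast hk
  have hA : 0 < ‖x‖ / (2 * k) := by positivity
  have key : 2 ^ q * (2 * k : ℝ) ^ (-γ) / |γ| * ‖x‖ ^ γ
      = (2 * (‖x‖ / (2 * k)) ^ (γ / q)) ^ q / |γ| := by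
    rw [Real.mul_rpow (y := (‖x‖ / (2 * k)) ^ (γ / q)) (by norm_num) (by positivity),
      ← Real.rpow_mul hA.le,
      div_mul_cancel₀ _ hq.ne', Real.div_rpow hx0.le (by positivity),
      Real.rpow_neg (by positivity)]
    ring
  rw [key]
  refine rescaledInnerInt_le_of_forall hn hq hγ.ne (by positivity) fun u hu h => ?_
  have h1 : ‖x‖ / (2 * k) ≤ ‖u‖ := by
    by_contra! hlt
    have h3 : ‖τ • u‖ ≤ ‖x‖ / (2 * k) := by
      rw [norm_smul, Real.norm_of_nonneg hτ.le]
      exact (mul_le_of_le_one_left (norm_nonneg _) hτ1).trans hlt.le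
    have h4 : (k : ℝ) * ‖τ • u‖ ≤ ‖x‖ / 2 := by
      calc (k : ℝ) * ‖τ • u‖ ≤ k * (‖x‖ / (2 * k)) := by gcongr
        _ = ‖x‖ / 2 := by field_simp
    rw [kDiff_eq_zero_of_far k hf hR (by linarith), zero_div, abs_zero] at h
    exact not_le.2 h (by positivity)
  have h2 := Real.rpow_le_rpow_of_nonpos hA h1 (div_neg_of_neg_of_pos hγ hq).le
  have := Real.rpow_pos_of_pos hA (γ / q)
  linarith

theorem abs_kDiff_le_two_pow {n k : ℕ} {g : En n → ℝ} {B : ℝ} (hB : ∀ y, |g y| ≤ B)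
    (h x : En n) : |kDiff k g h x| ≤ 2 ^ k * B := by
  calc |kDiff k g h x| ≤ ∑ j ∈ Finset.range (k + 1), (k.choose j : ℝ) * B := by
        refine (Finset.abs_sum_le_sum_abs _ _).trans (Finset.sum_le_sum fun j _ => ?_)
        rw [abs_mul, abs_mul, abs_pow, abs_neg, abs_one, one_pow, one_mul, Nat.abs_cast]
        gcongr
        exact hB _
    _ = 2 ^ k * B := by
        rw [← Finset.sum_mul]
        congr 1
        exact_mod_cast Nat.sum_range_choose k

theorem volume_setOf_norm_add_smul_le {n : ℕ} {r R : ℝ} (hr : 0 < r) (hR : 0 ≤ R) (x : En n) :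
    volume {u : En n | ‖x + r • u‖ ≤ R}
      = ENNReal.ofReal ((R / r) ^ n) * volume (Metric.closedBall (0 : En n) 1) := by
  have e : {u : En n | ‖x + r • u‖ ≤ R} = Metric.closedBall (-(r⁻¹ • x)) (R / r) := by
    ext u
    have : x + r • u = r • (u - -(r⁻¹ • x)) := by
      rw [sub_neg_eq_add, smul_add, smul_smul, mul_inv_cancel₀ hr.ne', one_smul, add_comm]
    rw [mem_ofPred_eq, Metric.mem_closedBall, dist_eq_norm, this, norm_smul,
      Real.norm_of_nonneg hr.le, le_div_iff₀ hr, mul_comm]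
  rw [e, Measure.addHaar_closedBall' _ _ (by positivity), finrank_euclideanSpace, Fintype.card_fin]

theorem rescaledInnerInt_le_of_kDiff_eq {n k : ℕ} (hk : 0 < k) {q γ τ R B : ℝ} (hq : 0 < q)
    {f g : En n → ℝ} (hR0 : 0 ≤ R) (hg0 : ∀ y, R < ‖y‖ → g y = 0)
    (hgB : ∀ y, |g y| ≤ B) (hfg : ∀ h x, kDiff k f h x = kDiff k g h x) (hτ : 0 < τ) {x : En n}
    (hx : 2 * R < ‖x‖) :
    rescaledInnerInt k q γ f τ x
      ≤ ENNReal.ofReal ((2 ^ k * B) ^ q * (2 * k : ℝ) ^ (k * q + n) * (k * R ^ n)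
          * ‖x‖ ^ (-(k * q + n)))
        * volume (Metric.closedBall (0 : En n) 1) := by
  have hx0 : 0 < ‖x‖ := by linarith
  have hB0 : 0 ≤ B := (abs_nonneg _).trans (hgB 0)
  have hk' : (0 : ℝ) < k := by exact_mod_cast hk
  have hA : 0 < ‖x‖ / (2 * k) := by positivity
  set c : ℝ := (2 ^ k * B) ^ q * (‖x‖ / (2 * k)) ^ (-(k * q + n)) * τ ^ n with hc
  set S : Set (En n) := ⋃ j ∈ Finset.Icc 1 k, {u : En n | ‖x + ((j : ℝ) * τ) • u‖ ≤ R} with hS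
  have hSm : MeasurableSet S := by
    refine Finset.measurableSet_biUnion _ fun j _ => ?_
    exact measurableSet_le (by fun_prop) measurable_const
  have hpt : ∀ u : En n, (if u ≠ 0 ∧ ‖u‖ ^ ((k : ℝ) + γ / q) < |kDiff k f (τ • u) x / τ ^ k| then
      ENNReal.ofReal (‖u‖ ^ (γ - (n : ℝ))) else 0) ≤ S.indicator (fun _ => ENNReal.ofReal c) u := by
    intro u
    by_cases hu : u ≠ 0 ∧ ‖u‖ ^ ((k : ℝ) + γ / q) < |kDiff k f (τ • u) x / τ ^ k|
    swap
    · simp only [hu, if_false, zero_le]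
    rw [if_pos hu]
    obtain ⟨hu0, h⟩ := hu
    have hu' : 0 < ‖u‖ := norm_pos_iff.2 hu0
    obtain ⟨j, hj, hjR⟩ : ∃ j ∈ Finset.Icc 1 k, ‖x + ((j : ℝ) * τ) • u‖ ≤ R := by
      by_contra! hcon
      have : kDiff k f (τ • u) x = 0 := by
        rw [hfg]
        refine Finset.sum_eq_zero fun j hj => ?_
        rw [hg0, mul_zero]
        rcases Nat.eq_zero_or_pos j with rfl | hj0
        · simp; linarith
        · rw [smul_smul]
          exact hcon j (Finset.mem_Icc.2 ⟨hj0, by simpa [Nat.lt_succ_iff] using hj⟩)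
      rw [this, zero_div, abs_zero] at h
      exact not_le.2 h (by positivity)
    have huS : u ∈ S := mem_biUnion hj hjR
    rw [indicator_of_mem huS]
    refine ENNReal.ofReal_le_ofReal ?_
    have hjk : (j : ℝ) ≤ k := by exact_mod_cast (Finset.mem_Icc.1 hj).2
    have hlow : ‖x‖ / (2 * k) ≤ τ * ‖u‖ := by
      have h1 : ‖x‖ ≤ ‖x + ((j : ℝ) * τ) • u‖ + ‖((j : ℝ) * τ) • u‖ := by
        simpa using norm_sub_le (x + ((j : ℝ) * τ) • u) (((j : ℝ) * τ) • u)
      rw [norm_smul, Real.norm_of_nonneg (by positivity), mul_assoc] at h1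
      have h2 : (j : ℝ) * (τ * ‖u‖) ≤ k * (τ * ‖u‖) := by gcongr
      rw [div_le_iff₀ (by positivity)]
      linarith
    have hup : ‖u‖ ^ (γ / q) ≤ 2 ^ k * B * (τ * ‖u‖) ^ (-(k : ℝ)) := by
      have h1 := abs_kDiff_le_two_pow (k := k) hgB (τ • u) x
      rw [hfg, abs_div, abs_of_pos (pow_pos hτ k), lt_div_iff₀ (pow_pos hτ k), Real.rpow_add hu',
        Real.rpow_natCast] at h
      rw [Real.rpow_neg (by positivity), Real.rpow_natCast, ← div_eq_mul_inv,
        le_div_iff₀ (by positivity), mul_pow]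
      linarith
    have hup2 : ‖u‖ ^ γ ≤ (2 ^ k * B) ^ q * (τ * ‖u‖) ^ (-(k * q) : ℝ) := by
      have h1 := Real.rpow_le_rpow (by positivity) hup hq.le
      rwa [Real.mul_rpow (by positivity) (by positivity), ← Real.rpow_mul hu'.le,
        ← Real.rpow_mul (by positivity), div_mul_cancel₀ _ hq.ne', neg_mul] at h1
    calc ‖u‖ ^ (γ - (n : ℝ)) = ‖u‖ ^ γ * ‖u‖ ^ (-(n : ℝ)) := by
          rw [← Real.rpow_add hu', sub_eq_add_neg]
      _ ≤ (2 ^ k * B) ^ q * (τ * ‖u‖) ^ (-(k * q) : ℝ) * ‖u‖ ^ (-(n : ℝ)) := by gcongr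
      _ = (2 ^ k * B) ^ q * (τ * ‖u‖) ^ (-(k * q + n) : ℝ) * τ ^ n := by
          rw [neg_add, Real.rpow_add (by positivity) (-(k * q) : ℝ),
            Real.mul_rpow hτ.le hu'.le (z := -(n : ℝ)), Real.rpow_neg hτ.le, Real.rpow_natCast]
          field_simp
      _ ≤ c := by
          have h1 : (0 : ℝ) ≤ k * q + n := by positivity
          have h2 := Real.rpow_le_rpow_of_nonpos hA hlow (neg_nonpos.2 h1)
          rw [hc]
          exact mul_le_mul_of_nonneg_right (mul_le_mul_of_nonneg_left h2 (by positivity))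
            (by positivity)
  have hvol : volume S ≤ ENNReal.ofReal (k * (R / τ) ^ n)
      * volume (Metric.closedBall (0 : En n) 1) := by
    calc volume S ≤ ∑ j ∈ Finset.Icc 1 k, volume {u : En n | ‖x + ((j : ℝ) * τ) • u‖ ≤ R} :=
          measure_biUnion_finset_le _ _
      _ ≤ ∑ j ∈ Finset.Icc 1 k, ENNReal.ofReal ((R / τ) ^ n)
          * volume (Metric.closedBall (0 : En n) 1) := by
          refine Finset.sum_le_sum fun j hj => ?_
          have hj1 : (1 : ℝ) ≤ j := by exact_mod_cast (Finset.mem_Icc.1 hj).1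
          rw [volume_setOf_norm_add_smul_le (by positivity) hR0]
          gcongr
          exact le_mul_of_one_le_left hτ.le hj1
      _ = _ := by
          rw [Finset.sum_const, Nat.card_Icc, nsmul_eq_mul, ENNReal.ofReal_mul (by positivity),
            ENNReal.ofReal_natCast, Nat.add_sub_cancel, mul_assoc]
  calc rescaledInnerInt k q γ f τ x ≤ ∫⁻ u, S.indicator (fun _ => ENNReal.ofReal c) u :=
        lintegral_mono hpt
    _ = ENNReal.ofReal c * volume S := by rw [lintegral_indicator_const hSm]
    _ ≤ ENNReal.ofReal c * (ENNReal.ofReal (k * (R / τ) ^ n)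
      * volume (Metric.closedBall (0 : En n) 1)) := by gcongr
    _ = _ := by
        rw [← mul_assoc, ← ENNReal.ofReal_mul (by positivity)]
        congr 2
        rw [hc, Real.div_rpow hx0.le (by positivity), Real.rpow_neg (x := 2 * (k : ℝ)) (by positivity),
          div_pow]
        field_simp

theorem lintegral_toSphere_le_sphIntD {n : ℕ} (hn : 0 < n) (k : ℕ) (q : ℝ) {f : En n → ℝ}
    (hf : ContDiff ℝ (⊤ : ℕ∞) f) (x : En n) :
    ∫⁻ ξ : Metric.sphere (0 : En n) 1,
        ENNReal.ofReal (|iteratedFDeriv ℝ k f x (fun _ => (ξ : En n))| ^ q)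
          ∂(volume : Measure (En n)).toSphere ≤ sphIntD k q f x := by
  obtain ⟨m, rfl⟩ : ∃ m, n = m + 1 := ⟨n - 1, by omega⟩
  have hm : ((m + 1 : ℕ) : ℝ) - 1 = m := by push_cast; ring
  rw [sphIntD, hm]
  simp_rw [dirD_eq k hf]
  have e := (isometry_subtype_coe (s := Metric.sphere (0 : En (m + 1)) 1)).map_hausdorffMeasure
    (d := (m : ℝ)) (Or.inl (Nat.cast_nonneg m))
  rw [Subtype.range_coe] at e
  rw [← e, (MeasurableEmbedding.subtype_coe Metric.isClosed_sphere.measurableSet).lintegral_map]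
  exact lintegral_mono' (toSphere_le_hausdorffMeasure m) le_rfl

theorem rpow_lintegral_const_mul_rpow {α : Type*} [MeasurableSpace α] {μ : Measure α} {p q γ : ℝ}
    (hp : 0 < p) (hq : 0 < q) (hγ : γ ≠ 0) (S : α → ℝ≥0∞) :
    (∫⁻ x, (ENNReal.ofReal |γ|⁻¹ * S x) ^ (p / q) ∂μ) ^ (1 / p)
      = ENNReal.ofReal (|γ| ^ (-(1 / q))) * (∫⁻ x, S x ^ (p / q) ∂μ) ^ (1 / p) := by
  have hγ' : 0 < |γ| := abs_pos.2 hγ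
  simp_rw [ENNReal.mul_rpow_of_nonneg _ _ (show 0 ≤ p / q by positivity)]
  rw [lintegral_const_mul' _ _ (ENNReal.rpow_ne_top_of_nonneg (by positivity)
      ENNReal.ofReal_ne_top), ENNReal.mul_rpow_of_nonneg _ _ (by positivity), ← ENNReal.rpow_mul,
    ENNReal.ofReal_rpow_of_pos (by positivity), Real.inv_rpow hγ'.le, ← Real.rpow_neg hγ'.le]
  congr 4
  field_simp

theorem le_ofReal_one_add_rpow {K C a r t : ℝ} {v : ℝ≥0∞} (hK : 0 ≤ K) (hC : 0 ≤ C) (ha : 0 ≤ a)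
    (hr : 1 ≤ r) (ht : 0 ≤ t) (h1 : v ≤ ENNReal.ofReal K)
    (h2 : r < t → v ≤ ENNReal.ofReal (C * t ^ (-a))) :
    v ≤ ENNReal.ofReal ((K * (1 + r) ^ a + C * 2 ^ a) * (1 + t) ^ (-a)) := by
  have h3 : 0 ≤ K * (1 + r) ^ a * (1 + t) ^ (-a) := by positivity
  have h4 : 0 ≤ C * 2 ^ a * (1 + t) ^ (-a) := by positivity
  rw [add_mul]
  rcases le_or_gt t r with h | h
  · refine h1.trans (ENNReal.ofReal_le_ofReal ?_)
    have h5 : 1 ≤ (1 + r) ^ a * (1 + t) ^ (-a) := by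
      rw [Real.rpow_neg (by positivity), ← div_eq_mul_inv, one_le_div (by positivity)]
      gcongr
    have := mul_le_mul_of_nonneg_left h5 hK
    linarith
  · refine (h2 h).trans (ENNReal.ofReal_le_ofReal ?_)
    have h5 : t ^ (-a) ≤ 2 ^ a * (1 + t) ^ (-a) := by
      have := Real.rpow_le_rpow_of_nonpos (x := (1 + t) / 2) (y := t) (z := -a) (by positivity)
        (by linarith) (by linarith)
      rwa [Real.div_rpow (by positivity) (by norm_num), Real.rpow_neg (x := 2) (by norm_num),
        div_inv_eq_mul, mul_comm] at this
    have := mul_le_mul_of_nonneg_left h5 hC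
    linarith

theorem exists_rescaledInnerInt_le_far {n k : ℕ} (hn : 0 < n) (hk : 0 < k) {p q γ M R : ℝ}
    (hp : 0 < p) (hq : 0 < q) (hγ : γ ≠ 0)
    (hcase : (n = 1 ∧ (γ < -q / p ∨ 0 < γ)) ∨
      (2 ≤ n ∧ (n : ℝ) * (1 / p - 1 / q) < (k : ℝ)))
    {f : En n → ℝ} (hf : ContDiff ℝ (⊤ : ℕ∞) f) (hM : ∀ y, ‖iteratedFDeriv ℝ k f y‖ ≤ M)
    (hR0 : 0 ≤ R) (hR : ∀ y, R < ‖y‖ → iteratedFDeriv ℝ k f y = 0) :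
    ∃ C a r : ℝ, 0 ≤ C ∧ 0 ≤ a ∧ n < a * (p / q) ∧ ∀ τ x, 0 < τ → τ ≤ 1 → r < ‖x‖ →
      rescaledInnerInt k q γ f τ x ≤ ENNReal.ofReal (C * ‖x‖ ^ (-a)) := by
  rcases lt_or_gt_of_ne hγ with hneg | hpos
  · rcases hcase with ⟨rfl, h | h⟩ | ⟨hn2, h⟩
    · refine ⟨2 ^ q * (2 * k : ℝ) ^ (-γ) / |γ|
        * ((volume : Measure (En 1)).toSphere univ).toReal, -γ, 2 * R, by positivity,
        by linarith, ?_, fun τ x hτ hτ1 hx => ?_⟩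
      · have h' : γ * p < -q := by rwa [lt_div_iff₀ hp] at h
        rw [← mul_div_assoc, lt_div_iff₀ hq]
        push_cast
        linarith
      · refine (rescaledInnerInt_le_norm_rpow hn hk hq hneg hf hR0 hR hτ hτ1 hx).trans_eq ?_
        rw [neg_neg, mul_right_comm, ENNReal.ofReal_mul' ENNReal.toReal_nonneg,
          ENNReal.ofReal_toReal (measure_ne_top _ _)]
    · exact absurd hneg (not_lt.2 h.le)
    · have hne : {y : En n | R < ‖y‖}.Nonempty := by
        have : Nontrivial (En n) := by
          have : Nonempty (Fin n) := ⟨⟨0, hn⟩⟩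
          infer_instance
        exact (NormedSpace.exists_lt_norm ℝ (En n) R)
      obtain ⟨g, hgc, hg0, hfg⟩ := exists_kDiff_eq_of_preconnected hk hf
        (isOpen_lt continuous_const continuous_norm) (isPreconnected_norm_gt hn2 hR0) hne hR
      obtain ⟨B, hB⟩ : ∃ B, ∀ y, ‖g y‖ ≤ B := hgc.bounded_above_of_compact_support
        (HasCompactSupport.intro (isCompact_closedBall (0 : En n) R) fun y hy =>
          hg0 y (by simpa using hy))
      have hB0 : 0 ≤ B := (norm_nonneg _).trans (hB 0)
      refine ⟨(2 ^ k * B) ^ q * (2 * k : ℝ) ^ (k * q + n) * (k * R ^ n)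
        * (volume (Metric.closedBall (0 : En n) 1)).toReal, k * q + n, 2 * R, by positivity,
        by positivity, ?_, fun τ x hτ hτ1 hx => ?_⟩
      · have h' : (n : ℝ) * q < (k * q + n) * p := by
          have h1 : (n : ℝ) * (1 / p - 1 / q) * (p * q) < k * (p * q) := by gcongr
          have h2 : (n : ℝ) * (1 / p - 1 / q) * (p * q) = n * q - n * p := by field_simp
          linarith
        rwa [← mul_div_assoc, lt_div_iff₀ hq]
      · refine (rescaledInnerInt_le_of_kDiff_eq hk hq hR0 hg0 hB hfg hτ hx).trans_eq ?_
        rw [mul_right_comm _ (ENNReal.toReal _), ENNReal.ofReal_mul' ENNReal.toReal_nonneg,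
          ENNReal.ofReal_toReal measure_closedBall_lt_top.ne]
  · refine ⟨0, (n + 1) * (q / p), R + k * M ^ (q / γ), le_rfl, by positivity, ?_,
      fun τ x hτ hτ1 hx => ?_⟩
    · have : ((n : ℝ) + 1) * (q / p) * (p / q) = n + 1 := by field_simp
      rw [this]; linarith
    · rw [rescaledInnerInt_eq_zero_of_far hq hpos hf hM hR hτ hτ1 hx]
      exact zero_le

theorem tendsto_lintegral_rescaledInnerInt {n k : ℕ} (hn : 0 < n) (hk : 0 < k) {p q γ : ℝ}
    (hp : 0 < p) (hq : 0 < q) (hγ : γ ≠ 0)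
    (hcase : (n = 1 ∧ (γ < -q / p ∨ 0 < γ)) ∨
      (2 ≤ n ∧ (n : ℝ) * (1 / p - 1 / q) < (k : ℝ)))
    {f : En n → ℝ} (hf : ContDiff ℝ (⊤ : ℕ∞) f)
    (hsupp : HasCompactSupport (iteratedFDeriv ℝ k f)) :
    Tendsto (fun τ => ∫⁻ x, rescaledInnerInt k q γ f τ x ^ (p / q)) (𝓝[>] 0)
      (𝓝 (∫⁻ x, (∫⁻ ξ : Metric.sphere (0 : En n) 1,
        ENNReal.ofReal (|iteratedFDeriv ℝ k f x (fun _ => (ξ : En n))| ^ q / |γ|)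
          ∂(volume : Measure (En n)).toSphere) ^ (p / q))) := by
  obtain ⟨M, hM⟩ := (hf.continuous_iteratedFDeriv (m := k)
    (by exact_mod_cast le_top)).bounded_above_of_compact_support hsupp
  have hM0 : 0 ≤ M := (norm_nonneg _).trans (hM 0)
  obtain ⟨R, hR0, hR⟩ : ∃ R : ℝ, 0 ≤ R ∧ ∀ y, R < ‖y‖ → iteratedFDeriv ℝ k f y = 0 := by
    obtain ⟨R, hR0, hR⟩ := hsupp.isBounded.exists_pos_norm_le
    exact ⟨R, hR0.le, fun y hy => image_eq_zero_of_notMem_tsupport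
      fun hy' => not_lt.2 (hR y hy') hy⟩
  obtain ⟨C, a, r, hC, ha, han, hfar⟩ :=
    exists_rescaledInnerInt_le_far hn hk hp hq hγ hcase hf hM hR0 hR
  set K : ℝ := M ^ q / |γ| * ((volume : Measure (En n)).toSphere univ).toReal with hK
  have hpq : 0 < p / q := by positivity
  set A : ℝ := K * (1 + max 1 r) ^ a + C * 2 ^ a with hA
  have hK0 : 0 ≤ K := by positivity
  have hA0 : 0 ≤ A := by positivity
  refine tendsto_lintegral_filter_of_dominated_convergence
    (fun x => ENNReal.ofReal (A ^ (p / q)) * ENNReal.ofReal ((1 + ‖x‖) ^ (-(a * (p / q)))))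
    ?_ ?_ ?_ ?_
  · exact Eventually.of_forall fun τ =>
      (measurable_rescaledInnerInt k q γ τ hf.continuous).pow_const _
  · filter_upwards [Ioc_mem_nhdsGT (zero_lt_one' ℝ)] with τ hτ
    refine Eventually.of_forall fun x => ?_
    have h1 : rescaledInnerInt k q γ f τ x
        ≤ ENNReal.ofReal (A * (1 + ‖x‖) ^ (-a)) := by
      refine le_ofReal_one_add_rpow hK0 hC ha (le_max_left _ _) (norm_nonneg x) ?_
        fun hx => hfar τ x hτ.1 hτ.2 ((le_max_right _ _).trans_lt hx)
      refine (rescaledInnerInt_le_of_forall hn hq hγ hM0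
        fun u hu h => rpow_lt_of_lt_kDiff_div hf hM hτ.1 hu h).trans_eq ?_
      rw [hK, ENNReal.ofReal_mul (by positivity), ENNReal.ofReal_toReal (measure_ne_top _ _)]
    refine (ENNReal.rpow_le_rpow h1 hpq.le).trans_eq ?_
    rw [ENNReal.ofReal_rpow_of_nonneg (by positivity) hpq.le,
      Real.mul_rpow hA0 (by positivity), ← Real.rpow_mul (by positivity), neg_mul,
      ENNReal.ofReal_mul (by positivity)]
  · rw [lintegral_const_mul' _ _ ENNReal.ofReal_ne_top]
    exact ENNReal.mul_ne_top ENNReal.ofReal_ne_top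
      (finite_integral_one_add_norm (by simpa using han)).ne
  · exact Eventually.of_forall fun x => (ENNReal.continuous_rpow_const.tendsto _).comp
      (tendsto_rescaledInnerInt hn hq hγ hf hM x)

/-- upper limit estimate in the limiting BSVY identity, for smooth
functions with compactly supported `k`-th derivative. -/
theorem statement18 (n k : ℕ) (hn : 0 < n) (hk : 0 < k) (p q γ : ℝ)
    (hp : 1 ≤ p) (hq : 0 < q) (hγ : γ ≠ 0)
    (hcase : (n = 1 ∧ (γ < -q / p ∨ 0 < γ)) ∨
      (2 ≤ n ∧ (n : ℝ) * (1 / p - 1 / q) < (k : ℝ)))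
    (f : En n → ℝ) (hf : ContDiff ℝ (⊤ : ℕ∞) f)
    (hsupp : HasCompactSupport (iteratedFDeriv ℝ k f)) :
    Filter.limsup (fun lam => bsvy k k p q (γ / q) γ f lam) (Lfil γ)
      ≤ ENNReal.ofReal (|γ| ^ (-(1 / q))) *
          (∫⁻ x, (sphIntD k q f x) ^ (p / q)) ^ (1 / p) := by
  have hp0 : 0 < p := by linarith
  rw [limsup_bsvy_eq hp0 hq hγ
      (tendsto_lintegral_rescaledInnerInt hn hk hp0 hq hγ hcase hf hsupp),
    ← rpow_lintegral_const_mul_rpow hp0 hq hγ]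
  refine ENNReal.rpow_le_rpow (lintegral_mono fun x => ENNReal.rpow_le_rpow ?_ (by positivity))
    (by positivity)
  refine le_trans (le_of_eq ?_) (mul_le_mul_right (lintegral_toSphere_le_sphIntD hn k q hf x) _)
  rw [← lintegral_const_mul' _ _ ENNReal.ofReal_ne_top]
  refine lintegral_congr fun ξ => ?_
  rw [← ENNReal.ofReal_mul (by positivity), div_eq_inv_mul]
end
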